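/- There exists an absolute constant c > 0 such that for every finite set S of N points in the plane in general position, the number of crossing-free straight-edge spanning cycles of S satisfies sc(S) ≤ c · 10.9247^{N/4} · tr(S); in particular sc(S) = O(1.8181^N) · tr(S). -/

import Mathlib

open scoped Classical

noncomputable section

/-- Points of the plane. -/
abbrev Pt : Type := ℝ × ℝ

/-- A finite point set is in general position if no three of its points are collinear. -/
def GenPos (S : Finset Pt) : Prop :=
  ∀ p ∈ S, ∀ q ∈ S, ∀ r ∈ S, p ≠ q → p ≠ r → q ≠ r →
    ¬ Collinear ℝ ({p, q, r} : Set Pt)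

/-- The closed straight segment spanned by an unordered pair of points. -/
def seg2 (e : Sym2 Pt) : Set Pt :=
  Sym2.lift ⟨fun p q => segment ℝ p q, fun p q => segment_symm ℝ p q⟩ e

/-- A crossing-free straight-edge graph (plane graph) on the point set `S`:
its edges are straight segments between points of `S`, any two of which
meet only at shared endpoints. -/
structure PlaneGraph (S : Finset Pt) where
  edges : Finset (Sym2 Pt)
  endpoint_mem : ∀ e ∈ edges, ∀ p, p ∈ e → p ∈ S
  not_isDiag : ∀ e ∈ edges, ¬ e.IsDiag
  noncrossing : ∀ e₁ ∈ edges, ∀ e₂ ∈ edges, e₁ ≠ e₂ →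
    ∀ x ∈ seg2 e₁ ∩ seg2 e₂, x ∈ e₁ ∧ x ∈ e₂

/-- A triangulation of `S` is a maximal plane graph on `S`. -/
def IsTriangulation {S : Finset Pt} (T : PlaneGraph S) : Prop :=
  ∀ G : PlaneGraph S, T.edges ⊆ G.edges → G.edges = T.edges

/-- `tr S`: the number of triangulations of `S`. -/
def triCount (S : Finset Pt) : ℕ :=
  Nat.card {T : PlaneGraph S // IsTriangulation T}

/-- A plane graph is a spanning cycle of `S` if its edges form a Hamiltonian
cycle on `S`. -/
def IsSpanningCycle {S : Finset Pt} (G : PlaneGraph S) : Prop :=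
  3 ≤ S.card ∧ ∃ f : Fin S.card ≃ {p : Pt // p ∈ S},
    G.edges =
      Finset.image (fun i : Fin S.card => s(((f i : Pt)), ((f (finRotate S.card i) : Pt)))) Finset.univ

/-- `sc S`: the number of crossing-free straight-edge spanning cycles of `S`. -/
def scCount (S : Finset Pt) : ℕ :=
  Nat.card {G : PlaneGraph S // IsSpanningCycle G}

/-- A plane graph is a perfect matching of `S` if every point of `S` is incident
to exactly one edge. -/
def IsPerfectMatching {S : Finset Pt} (G : PlaneGraph S) : Prop :=
  ∀ p ∈ S, ∃! e, e ∈ G.edges ∧ p ∈ e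

/-- `pm S`: the number of crossing-free straight-edge perfect matchings of `S`. -/
def pmCount (S : Finset Pt) : ℕ :=
  Nat.card {G : PlaneGraph S // IsPerfectMatching G}

/-- The support of a plane graph `G` on `S`: the number of triangulations of `S`
containing all edges of `G`. -/
def supp {S : Finset Pt} (G : PlaneGraph S) : ℕ :=
  Nat.card {T : PlaneGraph S // IsTriangulation T ∧ G.edges ⊆ T.edges}

/-- A finite set of points is in (strictly) convex position. -/
def InConvexPosition (Q : Finset Pt) : Prop :=
  ∀ p ∈ Q, p ∉ convexHull ℝ (↑(Q.erase p) : Set Pt)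

/-- `p q` is an edge of the convex hull boundary of `Q`. -/
def IsHullEdgeOf (Q : Finset Pt) (p q : Pt) : Prop :=
  p ∈ Q ∧ q ∈ Q ∧ p ≠ q ∧
    segment ℝ p q ⊆ frontier (convexHull ℝ (Q : Set Pt))

/-- `e` is a diagonal of the convex polygon with vertex set `Q`. -/
def IsDiagonalOf (Q : Finset Pt) (e : Sym2 Pt) : Prop :=
  ∃ p ∈ Q, ∃ q ∈ Q, e = s(p, q) ∧
    openSegment ℝ p q ⊆ interior (convexHull ℝ (Q : Set Pt))

/-- `F` is a set of ps-flippable (pseudo-simultaneously flippable) edges of the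
triangulation `T`: the edges of `F` are diagonals of pairwise interior-disjoint
(empty) convex polygons whose boundary edges all belong to `T`. -/
def IsPsFlippable {S : Finset Pt} (T : PlaneGraph S) (F : Finset (Sym2 Pt)) : Prop :=
  F ⊆ T.edges ∧
  ∃ 𝒬 : Finset (Finset Pt),
    (∀ Q ∈ 𝒬, ↑Q ⊆ (S : Set Pt) ∧ 3 ≤ Q.card ∧ InConvexPosition Q ∧
      (∀ p q, IsHullEdgeOf Q p q → s(p, q) ∈ T.edges) ∧
      (∀ p ∈ S, p ∉ interior (convexHull ℝ (Q : Set Pt)))) ∧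
    (∀ Q ∈ 𝒬, ∀ Q' ∈ 𝒬, Q ≠ Q' →
      interior (convexHull ℝ (Q : Set Pt)) ∩ interior (convexHull ℝ (Q' : Set Pt)) = ∅) ∧
    (∀ e ∈ F, ∃ Q ∈ 𝒬, IsDiagonalOf Q e)

/-- The drawing of a plane graph: the union of its (closed) edge segments and
its vertex set. -/
def drawing {S : Finset Pt} (G : PlaneGraph S) : Set Pt :=
  (⋃ e ∈ G.edges, seg2 e) ∪ (S : Set Pt)

/-- A convex decomposition of `S`: a plane graph containing all convex hull
boundary edges, whose bounded faces are all convex, and with no isolated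
vertices. -/
def IsConvexDecomposition {S : Finset Pt} (D : PlaneGraph S) : Prop :=
  (∀ p q, IsHullEdgeOf S p q → s(p, q) ∈ D.edges) ∧
  (∀ x ∉ drawing D, Bornology.IsBounded (connectedComponentIn (drawing D)ᶜ x) →
    Convex ℝ (connectedComponentIn (drawing D)ᶜ x)) ∧
  (∀ p ∈ S, ∃ e ∈ D.edges, p ∈ e)

/-- `p` is an interior vertex of `S` (not on the convex hull boundary). -/
def InteriorVtx (S : Finset Pt) (p : Pt) : Prop :=
  p ∈ S ∧ p ∉ frontier (convexHull ℝ (S : Set Pt))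

/-- `p` has a valid triple of edges in `G`. -/
def IsValidAt {S : Finset Pt} (G : PlaneGraph S) (p : Pt) : Prop :=
  ∃ a ∈ S, ∃ b ∈ S, ∃ c ∈ S,
    p ∈ convexHull ℝ ({a, b, c} : Set Pt) ∧
    s(p, a) ∈ G.edges ∧ s(p, b) ∈ G.edges ∧ s(p, c) ∈ G.edges

/-- The degree of a point in a plane graph. -/
def degree {S : Finset Pt} (G : PlaneGraph S) (p : Pt) : ℕ :=
  (G.edges.filter (fun e => p ∈ e)).card

/-- `a b c` span a triangular face of the triangulation `T`. -/
def IsTriFace {S : Finset Pt} (T : PlaneGraph S) (a b c : Pt) : Prop :=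
  a ∈ S ∧ b ∈ S ∧ c ∈ S ∧
  s(a, b) ∈ T.edges ∧ s(b, c) ∈ T.edges ∧ s(a, c) ∈ T.edges ∧
  ∀ p ∈ S, p ∉ interior (convexHull ℝ ({a, b, c} : Set Pt))

/-- An edge of a triangulation is flippable if its two incident triangles form
a convex quadrilateral. -/
def IsFlippable {S : Finset Pt} (T : PlaneGraph S) (e : Sym2 Pt) : Prop :=
  e ∈ T.edges ∧ ∃ a b c d : Pt, e = s(a, b) ∧ c ≠ d ∧
    IsTriFace T a b c ∧ IsTriFace T a b d ∧
    (openSegment ℝ a b ∩ openSegment ℝ c d).Nonempty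

/-- `flip T`: the number of flippable edges of `T`. -/
def flipCount {S : Finset Pt} (T : PlaneGraph S) : ℕ :=
  (T.edges.filter (fun e => IsFlippable T e)).card

/-- `v3 T`: the number of interior vertices of degree 3 in `T`. -/
def v3 {S : Finset Pt} (T : PlaneGraph S) : ℕ :=
  (S.filter (fun p => p ∉ frontier (convexHull ℝ (S : Set Pt)) ∧ degree T p = 3)).card

/-- The number of vertices of `S` on its convex hull boundary. -/
def hullVtxCount (S : Finset Pt) : ℕ :=
  (S.filter (fun p => p ∈ frontier (convexHull ℝ (S : Set Pt)))).card

open Finset in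
def PP {m : ℕ} (A : Matrix (Fin 2 × Fin m) (Fin 2 × Fin m) ℝ) : ℝ :=
  ∑ σ : Equiv.Perm (Fin 2 × Fin m), ((Equiv.Perm.sign σ : ℤ) : ℝ) *
    ∏ k : Fin m, A (σ (0, k)) (σ (1, k))

lemma PP_congr {m : ℕ} (A B : Matrix (Fin 2 × Fin m) (Fin 2 × Fin m) ℝ) :
    PP (B * A * B.transpose) = B.det * PP A := by
  have key : ∀ σ : Equiv.Perm (Fin 2 × Fin m),
      ∏ k : Fin m, (B * A * B.transpose) (σ (0, k)) (σ (1, k)) =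
      ∑ g : Fin 2 × Fin m → Fin 2 × Fin m, (∏ x, B (σ x) (g x)) * ∏ k, A (g (0,k)) (g (1,k)) := by
    intro σ
    have h1 : ∀ k : Fin m, (B * A * B.transpose) (σ (0, k)) (σ (1, k)) =
        ∑ uv : Fin 2 → (Fin 2 × Fin m), (∏ s, B (σ (s,k)) (uv s)) * A (uv 0) (uv 1) := by
      intro k
      rw [← (finTwoArrowEquiv (Fin 2 × Fin m)).symm.sum_comp, Fintype.sum_prod_type_right]
      simp only [Matrix.mul_apply, Matrix.transpose_apply, Finset.sum_mul]
      refine Finset.sum_congr rfl fun v _ => Finset.sum_congr rfl fun u _ => ?_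
      simp [Fin.prod_univ_two]
      ring
    simp_rw [h1]
    rw [Finset.prod_univ_sum]
    let e : (Fin 2 × Fin m → Fin 2 × Fin m) ≃ (Fin m → Fin 2 → Fin 2 × Fin m) :=
      { toFun := fun g k s => g (s,k)
        invFun := fun h x => h x.2 x.1
        left_inv := fun g => by ext <;> rfl
        right_inv := fun g => by ext <;> rfl }
    rw [Fintype.piFinset_univ, ← e.sum_comp]
    refine Finset.sum_congr rfl fun g _ => ?_
    rw [Finset.prod_mul_distrib]
    congr 1
    rw [Fintype.prod_prod_type_right]
    rfl
  unfold PP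
  simp_rw [key, Finset.mul_sum]
  rw [Finset.sum_comm]
  have h2 : ∀ g : Fin 2 × Fin m → Fin 2 × Fin m,
      ∑ σ : Equiv.Perm (Fin 2 × Fin m), ((Equiv.Perm.sign σ : ℤ) : ℝ) *
        ((∏ x, B (σ x) (g x)) * ∏ k, A (g (0,k)) (g (1,k))) =
      (B.submatrix id g).det * ∏ k, A (g (0,k)) (g (1,k)) := by
    intro g
    rw [Matrix.det_apply', Finset.sum_mul]
    refine Finset.sum_congr rfl fun σ _ => ?_
    simp [mul_assoc]
  simp_rw [h2]
  rw [← Finset.sum_subset (Finset.subset_univ (Finset.univ.filter (fun g : Fin 2 × Fin m → Fin 2 × Fin m => Function.Bijective g)))]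
  · symm
    refine Finset.sum_bij (fun σ _ => (σ : Fin 2 × Fin m → Fin 2 × Fin m)) ?_ ?_ ?_ ?_
    · intro σ _; simp
    · intro σ _ τ _ h; exact DFunLike.coe_injective h
    · intro g hg
      simp only [Finset.mem_filter, Finset.mem_univ, true_and] at hg
      exact ⟨Equiv.ofBijective g hg, Finset.mem_univ _, rfl⟩
    · intro σ _
      rw [Matrix.det_permute']
      ring
  · intro g _ hg
    simp only [Finset.mem_filter, Finset.mem_univ, true_and] at hg
    have : ¬ Function.Injective g := fun h => hg ((Finite.injective_iff_bijective).1 h)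
    simp only [Function.Injective, not_forall] at this
    obtain ⟨i, j, hij, hne⟩ := this
    rw [Matrix.det_zero_of_column_eq hne, zero_mul]
    intro k; simp [hij]

lemma symp_fam {V : Type*} [AddCommGroup V] [Module ℝ V] [FiniteDimensional ℝ V]
    (ω : V →ₗ[ℝ] V →ₗ[ℝ] ℝ) (alt : ∀ x y, ω x y = - ω y x) :
    ∀ m : ℕ, ∀ W : Submodule ℝ V, 2 * m ≤ Module.finrank ℝ W →
    ∃ b : Fin 2 × Fin m → V, LinearIndependent ℝ b ∧ (∀ i, b i ∈ W) ∧
      ∀ i j, i.2 ≠ j.2 → ω (b i) (b j) = 0 := by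
  have alt0 : ∀ x, ω x x = 0 := fun x => by have := alt x x; linarith
  intro m
  induction m with
  | zero =>
    intro W _
    exact ⟨fun i => i.2.elim0, linearIndependent_empty_type, fun i => i.2.elim0, fun i => i.2.elim0⟩
  | succ m ih =>
    intro W hW
    by_cases hz : ∀ u ∈ W, ∀ v ∈ W, ω u v = 0
    · have B := Module.finBasis ℝ W
      have hc : Fintype.card (Fin 2 × Fin (m+1)) ≤ Fintype.card (Fin (Module.finrank ℝ W)) := by
        simpa using hW
      obtain ⟨f⟩ := Function.Embedding.nonempty_of_card_le hc
      refine ⟨fun i => (B (f i) : V), ?_, fun i => (B (f i)).2, fun i j _ => hz _ (B _).2 _ (B _).2⟩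
      have h1 := B.linearIndependent.comp f f.injective
      exact h1.map' W.subtype (Submodule.ker_subtype W)
    · push Not at hz
      obtain ⟨u, hu, v, hv, huv⟩ := hz
      let F : W →ₗ[ℝ] (ℝ × ℝ) := ((ω u).prod (ω v)).comp W.subtype
      let W' : Submodule ℝ V := (LinearMap.ker F).map W.subtype
      have hW' : 2 * m ≤ Module.finrank ℝ W' := by
        have h1 := LinearMap.finrank_range_add_finrank_ker F
        have h2 : Module.finrank ℝ (LinearMap.range F) ≤ 2 := by
          have := Submodule.finrank_le (LinearMap.range F)
          simpa using this
        have h3 : Module.finrank ℝ W' = Module.finrank ℝ (LinearMap.ker F) :=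
          Submodule.finrank_map_subtype_eq W _
        omega
      obtain ⟨b, hb, hbW, hbo⟩ := ih W' hW'
      have hW'' : ∀ x ∈ W', x ∈ W ∧ ω u x = 0 ∧ ω v x = 0 := by
        intro x hx
        obtain ⟨y, hy, rfl⟩ := hx
        have : F y = 0 := hy
        have h2 := Prod.ext_iff.1 this
        exact ⟨y.2, h2.1, h2.2⟩
      let c : Fin 2 × Fin (m+1) → V := fun i =>
        Fin.cases (if i.1 = 0 then u else v) (fun k => b (i.1, k)) i.2
      have c0 : c (0,0) = u := by simp [c]
      have c1 : c (1,0) = v := by simp [c]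
      have cs : ∀ s k, c (s, Fin.succ k) = b (s,k) := fun s k => by simp [c]
      have hu0 : ∀ i, ω u (b i) = 0 := fun i => (hW'' _ (hbW i)).2.1
      have hv0 : ∀ i, ω v (b i) = 0 := fun i => (hW'' _ (hbW i)).2.2
      refine ⟨c, ?_, ?_, ?_⟩
      · rw [Fintype.linearIndependent_iff] at hb ⊢
        intro g hg
        rw [Fintype.sum_prod_type_right, Fin.sum_univ_succ, Fin.sum_univ_two] at hg
        simp only [c0, c1, cs] at hg
        have hvu : ω v u ≠ 0 := by rw [alt]; simpa using huv
        have e1 : g (1,0) = 0 := by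
          have := congrArg (ω u) hg
          simp only [map_add, map_smul, map_sum, hu0, alt0, smul_eq_mul, mul_zero, Finset.sum_const_zero, map_zero, zero_add, add_zero] at this
          exact (mul_eq_zero.1 this).resolve_right huv
        have e0 : g (0,0) = 0 := by
          have := congrArg (ω v) hg
          simp only [map_add, map_smul, map_sum, hv0, alt0, smul_eq_mul, mul_zero, Finset.sum_const_zero, map_zero, zero_add, add_zero] at this
          exact (mul_eq_zero.1 this).resolve_right hvu
        rw [e0, e1, zero_smul, zero_smul, zero_add, zero_add] at hg
        have := hb (fun i => g (i.1, i.2.succ)) (by rw [Fintype.sum_prod_type_right]; exact hg)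
        rintro ⟨s, k⟩
        refine Fin.cases ?_ (fun k => this (s,k)) k
        fin_cases s
        · exact e0
        · exact e1
      · rintro ⟨s, k⟩
        refine Fin.cases ?_ (fun k => ?_) k
        · fin_cases s
          · exact c0 ▸ hu
          · exact c1 ▸ hv
        · rw [cs]; exact (hW'' _ (hbW _)).1
      · rintro ⟨s, k⟩ ⟨t, l⟩
        refine Fin.cases ?_ (fun k => ?_) k <;> refine Fin.cases ?_ (fun l => ?_) l
        · simp
        · intro _
          rw [cs]
          fin_cases s
          · exact (congrArg (fun z => ω z _) c0).trans (hu0 _)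
          · exact (congrArg (fun z => ω z _) c1).trans (hv0 _)
        · intro _
          rw [cs, alt, neg_eq_zero]
          fin_cases t
          · exact (congrArg (fun z => ω z _) c0).trans (hu0 _)
          · exact (congrArg (fun z => ω z _) c1).trans (hv0 _)
        · intro h
          rw [cs, cs]
          exact hbo _ _ (fun h' => h (by simpa using h'))

lemma PP_blockbound {m : ℕ} (A : Matrix (Fin 2 × Fin m) (Fin 2 × Fin m) ℝ)
    (hA : ∀ x y, A x y = - A y x) (hb : ∀ i j, i.2 ≠ j.2 → A i j = 0) :
    |PP A| ≤ 2 ^ m * (m.factorial : ℝ) * Real.sqrt |A.det| := by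
  have hbd : A = Matrix.blockDiagonal (fun k => Matrix.of fun s t => A (s,k) (t,k)) := by
    ext ⟨s,k⟩ ⟨t,l⟩
    rw [Matrix.blockDiagonal_apply]
    split_ifs with h
    · simp at h; subst h; rfl
    · exact hb _ _ h
  have h0 : ∀ x, A x x = 0 := fun x => by have := hA x x; linarith
  have hdet : A.det = ∏ k, (A (0,k) (1,k))^2 := by
    rw [hbd, Matrix.det_blockDiagonal]
    refine Finset.prod_congr rfl fun k _ => ?_
    rw [Matrix.det_fin_two]
    simp only [Matrix.of_apply, h0]
    rw [hA (1,k) (0,k), Matrix.blockDiagonal_apply]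
    simp
    ring
  have hs : Real.sqrt |A.det| = ∏ k, |A (0,k) (1,k)| := by
    rw [hdet, Finset.prod_pow, abs_pow, Real.sqrt_sq (abs_nonneg _), Finset.abs_prod]
  rw [hs]
  let Good : Finset (Equiv.Perm (Fin 2 × Fin m)) := Finset.univ.filter fun σ => ∀ k, (σ (0,k)).2 = (σ (1,k)).2
  have hval : ∀ σ ∈ Good, ∏ k, |A (σ (0,k)) (σ (1,k))| = ∏ k, |A (0,k) (1,k)| := by
    intro σ hσ
    simp only [Good, Finset.mem_filter, Finset.mem_univ, true_and] at hσ
    have h1 : ∀ k, |A (σ (0,k)) (σ (1,k))| = |A (0, (σ (0,k)).2) (1, (σ (0,k)).2)| := by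
      intro k
      have hk := hσ k
      have hne : σ (0,k) ≠ σ (1,k) := fun h => by simpa using σ.injective h
      generalize σ (0,k) = x at *
      generalize σ (1,k) = y at *
      obtain ⟨s,a⟩ := x; obtain ⟨t,b⟩ := y
      simp only at hk; subst hk
      fin_cases s <;> fin_cases t
      · simp at hne
      · rfl
      · simp only [Fin.zero_eta, Fin.mk_one]; rw [hA, abs_neg];
      · simp at hne
    simp_rw [h1]
    have hinj : Function.Injective fun k => (σ (0,k)).2 := by
      intro k l hkl
      simp only at hkl
      by_contra hne
      have a1 := hσ k; have a2 := hσ l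
      have n1 : σ (0,k) ≠ σ (1,k) := fun h => by simpa using σ.injective h
      have n2 : σ (0,k) ≠ σ (0,l) := fun h => hne (by simpa using σ.injective h)
      have n3 : σ (1,k) ≠ σ (0,l) := fun h => by simpa using σ.injective h
      have m1 : (σ (0,k)).1 ≠ (σ (1,k)).1 := fun h => n1 (Prod.ext h a1)
      have m2 : (σ (0,k)).1 ≠ (σ (0,l)).1 := fun h => n2 (Prod.ext h hkl)
      have m3 : (σ (1,k)).1 ≠ (σ (0,l)).1 := fun h => n3 (Prod.ext h (a1.symm.trans hkl))
      omega
    exact (Equiv.ofBijective _ (Finite.injective_iff_bijective.1 hinj)).prod_comp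
      (fun k => |A (0,k) (1,k)|)
  have hcard : (Good.card : ℝ) ≤ 2 ^ m * (m.factorial : ℝ) := by
    have : Good.card ≤ Fintype.card ((Fin m → Fin 2) × Equiv.Perm (Fin m)) := by
      have hinj : ∀ σ ∈ Good, Function.Injective fun k => (σ (0,k)).2 := by
        intro σ hσ
        simp only [Good, Finset.mem_filter, Finset.mem_univ, true_and] at hσ
        intro k l hkl
        simp only at hkl
        by_contra hne
        have a1 := hσ k; have a2 := hσ l
        have n1 : σ (0,k) ≠ σ (1,k) := fun h => by simpa using σ.injective h
        have n2 : σ (0,k) ≠ σ (0,l) := fun h => hne (by simpa using σ.injective h)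
        have n3 : σ (1,k) ≠ σ (0,l) := fun h => by simpa using σ.injective h
        have m1 : (σ (0,k)).1 ≠ (σ (1,k)).1 := fun h => n1 (Prod.ext h a1)
        have m2 : (σ (0,k)).1 ≠ (σ (0,l)).1 := fun h => n2 (Prod.ext h hkl)
        have m3 : (σ (1,k)).1 ≠ (σ (0,l)).1 := fun h => n3 (Prod.ext h (a1.symm.trans hkl))
        omega
      rw [← Fintype.card_coe]
      refine Fintype.card_le_of_injective (fun σ : {x // x ∈ Good} => ((fun k => (σ.1 (0,k)).1 : Fin m → Fin 2),
        Equiv.ofBijective _ (Finite.injective_iff_bijective.1 (hinj σ.1 σ.2)))) ?_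
      rintro ⟨σ, hσ⟩ ⟨τ, hτ⟩ h
      simp only [Prod.mk.injEq] at h
      obtain ⟨h1, h2⟩ := h
      have h3 : ∀ k, (σ (0,k)).2 = (τ (0,k)).2 := fun k => by
        simpa using congrArg (fun e : Equiv.Perm (Fin m) => e k) h2
      have h4 : ∀ k, (σ (0,k)).1 = (τ (0,k)).1 := fun k => congrFun h1 k
      simp only [Good, Finset.mem_filter, Finset.mem_univ, true_and] at hσ hτ
      apply Subtype.ext
      ext1 ⟨s,k⟩
      fin_cases s
      · exact Prod.ext (h4 k) (h3 k)
      · have n1 : σ (0,k) ≠ σ (1,k) := fun h => by simpa using σ.injective h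
        have n2 : τ (0,k) ≠ τ (1,k) := fun h => by simpa using τ.injective h
        have m1 : (σ (0,k)).1 ≠ (σ (1,k)).1 := fun h => n1 (Prod.ext h (hσ k))
        have m2 : (τ (0,k)).1 ≠ (τ (1,k)).1 := fun h => n2 (Prod.ext h (hτ k))
        have := h4 k
        refine Prod.ext ?_ ?_
        · show (σ (1,k)).1 = (τ (1,k)).1
          omega
        · show (σ (1,k)).2 = (τ (1,k)).2
          rw [← hσ, ← hτ, h3]
    have h2 : Fintype.card ((Fin m → Fin 2) × Equiv.Perm (Fin m)) = 2 ^ m * m.factorial := by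
      rw [Fintype.card_prod, Fintype.card_perm]; simp
    rw [h2] at this
    exact_mod_cast this
  calc |PP A| ≤ ∑ σ : Equiv.Perm (Fin 2 × Fin m), ∏ k : Fin m, |A (σ (0, k)) (σ (1, k))| := by
        unfold PP
        refine (Finset.abs_sum_le_sum_abs _ _).trans (Finset.sum_le_sum fun σ _ => ?_)
        rw [abs_mul, Finset.abs_prod]
        have : |((Equiv.Perm.sign σ : ℤ) : ℝ)| = 1 := by
          rcases Int.units_eq_one_or (Equiv.Perm.sign σ) with h | h <;> simp [h]
        rw [this, one_mul]
    _ = ∑ σ ∈ Good, ∏ k : Fin m, |A (σ (0, k)) (σ (1, k))| := by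
        symm
        refine Finset.sum_subset (Finset.subset_univ _) fun σ _ hσ => ?_
        simp only [Good, Finset.mem_filter, Finset.mem_univ, true_and, not_forall] at hσ
        obtain ⟨k, hk⟩ := hσ
        exact Finset.prod_eq_zero (Finset.mem_univ k) (by rw [hb _ _ hk, abs_zero])
    _ = Good.card * ∏ k, |A (0,k) (1,k)| := by
        rw [Finset.sum_congr rfl hval, Finset.sum_const, nsmul_eq_mul]
    _ ≤ _ := mul_le_mul_of_nonneg_right hcard (Finset.prod_nonneg fun _ _ => abs_nonneg _)

lemma PP_bound_det {m : ℕ} (A : Matrix (Fin 2 × Fin m) (Fin 2 × Fin m) ℝ)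
    (hA : ∀ x y, A x y = - A y x) :
    |PP A| ≤ 2 ^ m * (m.factorial : ℝ) * Real.sqrt |A.det| := by
  let ω : (Fin 2 × Fin m → ℝ) →ₗ[ℝ] (Fin 2 × Fin m → ℝ) →ₗ[ℝ] ℝ := Matrix.toLinearMap₂' ℝ A
  have hω : ∀ x y, ω x y = ∑ i, ∑ j, x i * A i j * y j := by
    intro x y
    simp only [ω, Matrix.toLinearMap₂'_apply, smul_eq_mul]
    refine Finset.sum_congr rfl fun i _ => Finset.sum_congr rfl fun j _ => ?_
    ring
  have alt : ∀ x y, ω x y = - ω y x := by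
    intro x y
    rw [hω, hω, Finset.sum_comm, ← Finset.sum_neg_distrib]
    refine Finset.sum_congr rfl fun i _ => ?_
    rw [← Finset.sum_neg_distrib]
    refine Finset.sum_congr rfl fun j _ => ?_
    rw [hA]; ring
  obtain ⟨b, hb, -, hbo⟩ := symp_fam ω alt m ⊤ (by simp)
  let B : Matrix (Fin 2 × Fin m) (Fin 2 × Fin m) ℝ := Matrix.of b
  have hBdet : B.det ≠ 0 := by
    have : LinearIndependent ℝ B.row := hb
    rw [Matrix.linearIndependent_rows_iff_isUnit, Matrix.isUnit_iff_isUnit_det] at this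
    exact this.ne_zero
  have hBA : ∀ i j, (B * A * B.transpose) i j = ω (b i) (b j) := by
    intro i j
    rw [hω, Finset.sum_comm]
    simp only [Matrix.mul_apply, Matrix.transpose_apply, Finset.sum_mul, B, Matrix.of_apply]
  have h1 := PP_blockbound (B * A * B.transpose) (fun x y => by rw [hBA, hBA, alt])
    (fun i j h => by rw [hBA]; exact hbo i j h)
  rw [PP_congr, Matrix.det_mul, Matrix.det_mul, Matrix.det_transpose, abs_mul] at h1
  have h2 : Real.sqrt |B.det * A.det * B.det| = |B.det| * Real.sqrt |A.det| := by
    rw [show B.det * A.det * B.det = B.det ^2 * A.det by ring, abs_mul, Real.sqrt_mul (abs_nonneg _), abs_pow,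
      Real.sqrt_sq (abs_nonneg _)]
  rw [h2] at h1
  have h3 : 0 < |B.det| := abs_pos.2 hBdet
  nlinarith

lemma hadamard {ι : Type*} [Fintype ι] [DecidableEq ι] (A : Matrix ι ι ℝ) :
    |A.det| ≤ ∏ i, Real.sqrt (∑ j, A i j ^ 2) := by
  have key : ∀ n : ℕ, ∀ A : Matrix (Fin n) (Fin n) ℝ, |A.det| ≤ ∏ i, Real.sqrt (∑ j, A i j ^ 2) := by
    intro n A
    rcases n with _ | n
    · simp
    have : Fact (Module.finrank ℝ (EuclideanSpace ℝ (Fin (n+1))) = n+1) := ⟨by simp⟩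
    let bs := EuclideanSpace.basisFun (Fin (n+1)) ℝ
    let o := bs.toBasis.orientation
    have h := o.abs_volumeForm_apply_le (fun i => WithLp.toLp 2 (A i))
    rw [o.volumeForm_robust bs rfl] at h
    have h2 : bs.toBasis.det (fun i => WithLp.toLp 2 (A i)) = A.det := by
      rw [Module.Basis.det_apply, ← Matrix.det_transpose]
      congr 1
    rw [h2] at h
    refine h.trans (le_of_eq ?_)
    refine Finset.prod_congr rfl fun i _ => ?_
    rw [EuclideanSpace.norm_eq]
    simp
  let e := Fintype.equivFin ι
  have h := key _ (A.submatrix e.symm e.symm)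
  rw [Matrix.det_submatrix_equiv_self] at h
  refine h.trans (le_of_eq ?_)
  rw [← e.symm.prod_comp]
  refine Finset.prod_congr rfl fun i _ => ?_
  congr 1
  exact e.symm.sum_comp (fun j => A (e.symm i) j ^ 2)

lemma PP_bound {m : ℕ} (A : Matrix (Fin 2 × Fin m) (Fin 2 × Fin m) ℝ)
    (hA : ∀ x y, A x y = - A y x) :
    |PP A| ≤ 2 ^ m * (m.factorial : ℝ) * Real.sqrt (∏ i, Real.sqrt (∑ j, A i j ^ 2)) := by
  refine (PP_bound_det A hA).trans ?_
  gcongr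
  exact hadamard A

/-- orientation determinant -/
def oo (p q r : Pt) : ℝ := (q.1 - p.1) * (r.2 - p.2) - (q.2 - p.2) * (r.1 - p.1)

/-- proper crossing of segments `ab`, `cd` -/
def XX (a b c d : Pt) : Prop := oo a b c * oo a b d < 0 ∧ oo c d a * oo c d b < 0

/-- general position -/
def GP (S : Finset Pt) : Prop :=
  ∀ p ∈ S, ∀ q ∈ S, ∀ r ∈ S, p ≠ q → p ≠ r → q ≠ r → oo p q r ≠ 0

/-- sheared abscissa -/
def ell (t : ℝ) (p : Pt) : ℝ := p.1 + t * p.2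

lemma oo_ell (t : ℝ) (p q r : Pt) :
    oo p q r = (ell t q - ell t p) * (r.2 - p.2) - (q.2 - p.2) * (ell t r - ell t p) := by
  unfold oo ell; ring

lemma oo_swap12 (p q r : Pt) : oo q p r = - oo p q r := by unfold oo; ring
lemma oo_swap23 (p q r : Pt) : oo p r q = - oo p q r := by unfold oo; ring
lemma oo_rot (p q r : Pt) : oo q r p = oo p q r := by unfold oo; ring
lemma oo_rot' (p q r : Pt) : oo r p q = oo p q r := by unfold oo; ring
lemma oo_self12 (p r : Pt) : oo p p r = 0 := by unfold oo; ring
lemma oo_self13 (p r : Pt) : oo p r p = 0 := by unfold oo; ring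
lemma oo_self23 (p r : Pt) : oo p r r = 0 := by unfold oo; ring

lemma XX_swap1 {a b c d : Pt} : XX b a c d ↔ XX a b c d := by
  unfold XX; rw [oo_swap12 a b c, oo_swap12 a b d, mul_comm (oo c d b)]; simp
lemma XX_swap2 {a b c d : Pt} : XX a b d c ↔ XX a b c d := by
  unfold XX; rw [oo_swap12 c d a, oo_swap12 c d b, mul_comm (oo a b d)]; simp
lemma XX_symm {a b c d : Pt} : XX c d a b ↔ XX a b c d := by
  unfold XX; exact and_comm

/-- any finite set has a shear making abscissas distinct -/
lemma exists_shear (S : Finset Pt) : ∃ t : ℝ, Set.InjOn (ell t) (S : Set Pt) := by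
  let bad : Finset ℝ := (S ×ˢ S).image fun pq => - (pq.1.1 - pq.2.1) / (pq.1.2 - pq.2.2)
  obtain ⟨t, ht⟩ := Infinite.exists_notMem_finset bad
  refine ⟨t, fun p hp q hq h => ?_⟩
  unfold ell at h
  by_cases h2 : p.2 = q.2
  · refine Prod.ext ?_ h2
    rw [h2] at h; linarith
  · exfalso
    apply ht
    refine Finset.mem_image.2 ⟨(p,q), Finset.mem_product.2 ⟨hp, hq⟩, ?_⟩
    have : p.2 - q.2 ≠ 0 := sub_ne_zero.2 h2
    simp only
    field_simp
    linarith

def bb (t : ℝ) (p q : Pt) : ℝ := if ell t p < ell t q then 1 else -1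
def ab (t : ℝ) (p q v : Pt) : Prop :=
  (ell t p < ell t v ∧ ell t v < ell t q ∧ 0 < oo p q v) ∨
  (ell t q < ell t v ∧ ell t v < ell t p ∧ 0 < oo q p v)
def al (t : ℝ) (p q v : Pt) : ℝ := if ab t p q v then -1 else 1

lemma al_swap (t : ℝ) (p q v : Pt) : al t q p v = al t p q v := by
  unfold al ab; congr 1; rw [eq_iff_iff]; exact or_comm

lemma bb_swap (t : ℝ) {p q : Pt} (h : ell t p ≠ ell t q) : bb t q p = - bb t p q := by
  unfold bb
  rcases lt_or_gt_of_ne h with h | h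
  · rw [if_neg (not_lt.2 h.le), if_pos h]
  · rw [if_pos h, if_neg (not_lt.2 h.le)]; ring

lemma bb_sq (t : ℝ) (p q : Pt) : bb t p q * bb t p q = 1 := by
  unfold bb; split_ifs <;> norm_num

def br (t : ℝ) (a b c d : Pt) : ℝ :=
  (bb t a c * bb t a d * (bb t b c * bb t b d)) * (al t a b c * al t a b d) * (al t c d a * al t c d b)

lemma nest_geom (t : ℝ) {a b c d : Pt} (h1 : ell t a < ell t c) (h2 : ell t c < ell t d) (h3 : ell t d < ell t b)
    (hs : oo a b c * oo a b d < 0) : XX a b c d := by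
  refine ⟨hs, ?_⟩
  have hK : 0 < ell t b - ell t a := by linarith
  have e1 : (ell t b - ell t a) * oo c d a = (ell t d - ell t c) * (- oo a b c) - (oo a b d - oo a b c) * (ell t a - ell t c) := by
    simp only [oo_ell t]; ring
  have e2 : (ell t b - ell t a) * oo c d b = oo a b c * (ell t b - ell t d) - oo a b d * (ell t b - ell t c) := by
    simp only [oo_ell t]; ring
  have h4 : 0 < ell t b - ell t c := by linarith
  have h5 : 0 < ell t b - ell t d := by linarith
  have h6 : 0 < ell t c - ell t a := by linarith
  have h7 : 0 < ell t d - ell t a := by linarith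
  have e1' : (ell t b - ell t a) * oo c d a = - oo a b c * (ell t d - ell t a) + oo a b d * (ell t c - ell t a) := by
    rw [e1]; ring
  rcases mul_neg_iff.1 hs with ⟨hc, hd⟩ | ⟨hc, hd⟩
  · have a1 : 0 < (ell t b - ell t a) * oo c d b := by
      rw [e2]; nlinarith [mul_pos hc h5, mul_pos (neg_pos.2 hd) h4]
    have a2 : (ell t b - ell t a) * oo c d a < 0 := by
      rw [e1']; nlinarith [mul_pos hc h7, mul_pos (neg_pos.2 hd) h6]
    have a3 := (mul_pos_iff_of_pos_left hK).1 a1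
    have a4 : oo c d a < 0 := by by_contra h; push Not at h; nlinarith
    exact mul_neg_of_neg_of_pos a4 a3
  · have a1 : 0 < (ell t b - ell t a) * oo c d a := by
      rw [e1']; nlinarith [mul_pos (neg_pos.2 hc) h7, mul_pos hd h6]
    have a2 : (ell t b - ell t a) * oo c d b < 0 := by
      rw [e2]; nlinarith [mul_pos (neg_pos.2 hc) h5, mul_pos hd h4]
    have a3 := (mul_pos_iff_of_pos_left hK).1 a1
    have a4 : oo c d b < 0 := by by_contra h; push Not at h; nlinarith
    exact mul_neg_of_pos_of_neg a3 a4

/-- interleaved: `a<c<b<d`, if `c` above `ab` and `b` above `cd` (or both below), crossing. -/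
lemma inter_geom (t : ℝ) {a b c d : Pt} (h1 : ell t a < ell t c) (h2 : ell t c < ell t b) (h3 : ell t b < ell t d)
    (hs : 0 < oo a b c * oo c d b) : XX a b c d := by
  have e1 : (ell t b - ell t c) * oo a b d = - oo c d b * (ell t b - ell t a) - oo a b c * (ell t d - ell t b) := by
    simp only [oo_ell t]; ring
  have e2 : (ell t b - ell t c) * oo c d a = - oo a b c * (ell t d - ell t c) - oo c d b * (ell t c - ell t a) := by
    simp only [oo_ell t]; ring
  have hK : 0 < ell t b - ell t c := by linarith
  have h4 : 0 < ell t b - ell t a := by linarith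
  have h5 : 0 < ell t d - ell t b := by linarith
  have h6 : 0 < ell t d - ell t c := by linarith
  have h7 : 0 < ell t c - ell t a := by linarith
  rcases mul_pos_iff.1 hs with ⟨hc, hd⟩ | ⟨hc, hd⟩
  · have a1 : oo a b d < 0 := by
      by_contra h; push Not at h
      nlinarith [mul_pos hd h4, mul_pos hc h5, mul_nonneg hK.le h]
    have a2 : oo c d a < 0 := by
      by_contra h; push Not at h
      nlinarith [mul_pos hc h6, mul_pos hd h7, mul_nonneg hK.le h]
    exact ⟨mul_neg_of_pos_of_neg hc a1, mul_neg_of_neg_of_pos a2 hd⟩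
  · have a1 : 0 < oo a b d := by
      by_contra h; push Not at h
      nlinarith [mul_pos (neg_pos.2 hd) h4, mul_pos (neg_pos.2 hc) h5, mul_nonneg hK.le (neg_nonneg.2 h)]
    have a2 : 0 < oo c d a := by
      by_contra h; push Not at h
      nlinarith [mul_pos (neg_pos.2 hc) h6, mul_pos (neg_pos.2 hd) h7, mul_nonneg hK.le (neg_nonneg.2 h)]
    exact ⟨mul_neg_of_neg_of_pos hc a1, mul_neg_of_pos_of_neg a2 hd⟩

lemma br_aux (t : ℝ) {a b c d : Pt} (hab : ell t a < ell t b) (hcd : ell t c < ell t d) (hac : ell t a < ell t c)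
    (hbc : ell t b ≠ ell t c) (hbd : ell t b ≠ ell t d)
    (n1 : oo a b c ≠ 0) (n2 : oo a b d ≠ 0) (n4 : oo c d b ≠ 0)
    (hX : ¬ XX a b c d) : br t a b c d = 1 := by
  have had : ell t a < ell t d := hac.trans hcd
  have b1 : bb t a c = 1 := if_pos hac
  have b2 : bb t a d = 1 := if_pos had
  have A1 : al t c d a = 1 := if_neg (by rintro (⟨h, _⟩ | ⟨h, h', _⟩) <;> linarith)
  rcases lt_or_gt_of_ne hbc with h | h
  · have b3 : bb t b c = 1 := if_pos h
    have b4 : bb t b d = 1 := if_pos (h.trans hcd)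
    have A2 : al t c d b = 1 := if_neg (by rintro (⟨h, _⟩ | ⟨h, h', _⟩) <;> linarith)
    have A3 : al t a b c = 1 := if_neg (by rintro (⟨h, h', _⟩ | ⟨h, h', _⟩) <;> linarith)
    have A4 : al t a b d = 1 := if_neg (by rintro (⟨h, h', _⟩ | ⟨h, h', _⟩) <;> linarith)
    simp [br, *]
  · have b3 : bb t b c = -1 := if_neg (not_lt.2 h.le)
    rcases lt_or_gt_of_ne hbd with h' | h'
    · have b4 : bb t b d = 1 := if_pos h'
      have A4 : al t a b d = 1 := if_neg (by rintro (⟨h, h', _⟩ | ⟨h, h', _⟩) <;> linarith)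
      have h9 : oo a b c * oo c d b < 0 := by
        by_contra hc; push Not at hc
        exact hX (inter_geom t hac h h' (lt_of_le_of_ne hc (mul_ne_zero n1 n4).symm))
      rcases mul_neg_iff.1 h9 with ⟨hc, hd⟩ | ⟨hc, hd⟩
      · have A2 : al t c d b = 1 := if_neg (by rintro (⟨h, h', h''⟩ | ⟨h, h', _⟩) <;> linarith)
        have A3 : al t a b c = -1 := if_pos (Or.inl ⟨hac, h, hc⟩)
        simp [br, *]
      · have A2 : al t c d b = -1 := if_pos (Or.inl ⟨h, h', hd⟩)
        have A3 : al t a b c = 1 := if_neg (by rintro (⟨h, h', h''⟩ | ⟨h, h', _⟩) <;> linarith)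
        simp [br, *]
    · have b4 : bb t b d = -1 := if_neg (not_lt.2 h'.le)
      have A2 : al t c d b = 1 := if_neg (by rintro (⟨h, h', h''⟩ | ⟨h, h', _⟩) <;> linarith)
      have h9 : 0 < oo a b c * oo a b d := by
        by_contra hc; push Not at hc
        exact hX (nest_geom t hac hcd h' (lt_of_le_of_ne hc (mul_ne_zero n1 n2)))
      rcases mul_pos_iff.1 h9 with ⟨hc, hd⟩ | ⟨hc, hd⟩
      · have A3 : al t a b c = -1 := if_pos (Or.inl ⟨hac, h, hc⟩)
        have A4 : al t a b d = -1 := if_pos (Or.inl ⟨had, h', hd⟩)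
        simp [br, *]
      · have A3 : al t a b c = 1 := if_neg (by rintro (⟨h, h', h''⟩ | ⟨h, h', _⟩) <;> linarith)
        have A4 : al t a b d = 1 := if_neg (by rintro (⟨h, h', h''⟩ | ⟨h, h', _⟩) <;> linarith)
        simp [br, *]

lemma br_eq_one (t : ℝ) {a b c d : Pt} (hab : ell t a ≠ ell t b) (hcd : ell t c ≠ ell t d)
    (hac : ell t a ≠ ell t c) (had : ell t a ≠ ell t d)
    (hbc : ell t b ≠ ell t c) (hbd : ell t b ≠ ell t d)
    (n1 : oo a b c ≠ 0) (n2 : oo a b d ≠ 0) (n3 : oo c d a ≠ 0) (n4 : oo c d b ≠ 0)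
    (hX : ¬ XX a b c d) : br t a b c d = 1 := by
  wlog h1 : ell t a < ell t b generalizing a b
  · have := this hab.symm hbc hbd hac had (by rwa [oo_swap12, neg_ne_zero]) (by rwa [oo_swap12, neg_ne_zero])
      n4 n3 (by rwa [XX_swap1]) (lt_of_le_of_ne (not_lt.1 h1) hab.symm)
    rw [← this]; unfold br; rw [al_swap t b a c, al_swap t b a d]; ring
  wlog h2 : ell t c < ell t d generalizing c d
  · have := this hcd.symm had hac hbd hbc n2 n1 (by rwa [oo_swap12, neg_ne_zero]) (by rwa [oo_swap12, neg_ne_zero])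
      (by rwa [XX_swap2]) (lt_of_le_of_ne (not_lt.1 h2) hcd.symm)
    rw [← this]; unfold br; rw [al_swap t d c a, al_swap t d c b]; ring
  rcases lt_or_gt_of_ne hac with h3 | h3
  · exact br_aux t h1 h2 h3 hbc hbd n1 n2 n4 hX
  · have := br_aux t h2 h1 h3 had.symm hbd.symm n3 n4 n2 (by rwa [XX_symm])
    rw [← this]; unfold br
    rw [bb_swap t hac, bb_swap t had, bb_swap t hbc, bb_swap t hbd]; ring

def e0 (m : ℕ) : Fin 2 × Fin m ≃ Fin (m * 2) := (Equiv.prodComm _ _).trans finProdFinEquiv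

lemma e0_val (m : ℕ) (s : Fin 2) (k : Fin m) : ((e0 m (s,k) : Fin (m*2)) : ℕ) = s + 2 * k := rfl

lemma sign_form {m : ℕ} (σ : Equiv.Perm (Fin 2 × Fin m)) (f : Fin 2 × Fin m → ℝ)
    (hf : ∀ x y, f x < f y ↔ e0 m (σ x) < e0 m (σ y)) :
    ((Equiv.Perm.sign σ : ℤ) : ℝ) =
      (∏ l, if f (0,l) < f (1,l) then (1:ℝ) else -1) *
      ∏ l, ∏ k, if k < l then ∏ s : Fin 2, ∏ t : Fin 2, (if f (s,k) < f (t,l) then (1:ℝ) else -1) else 1 := by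
  have h1 : Equiv.Perm.sign σ = Equiv.Perm.sign ((e0 m).permCongr σ) := (Equiv.Perm.sign_permCongr _ _).symm
  rw [h1, Equiv.Perm.sign_eq_prod_prod_Iio]
  push_cast
  rw [← (e0 m).prod_comp, Fintype.prod_prod_type_right]
  rw [← Finset.prod_mul_distrib]
  refine Finset.prod_congr rfl fun l _ => ?_
  have h2 : ∀ t : Fin 2, ∏ i ∈ Finset.Iio (e0 m (t, l)), (((if (e0 m).permCongr σ i < (e0 m).permCongr σ (e0 m (t,l)) then (1:ℤˣ) else -1 : ℤˣ) : ℤ) : ℝ)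
      = ∏ k, ∏ s : Fin 2, if (k < l ∨ (k = l ∧ s < t)) then (if f (s,k) < f (t,l) then (1:ℝ) else -1) else 1 := by
    intro t
    rw [← Fintype.prod_prod_type_right (f := fun x : Fin 2 × Fin m => if (x.2 < l ∨ (x.2 = l ∧ x.1 < t)) then (if f (x.1,x.2) < f (t,l) then (1:ℝ) else -1) else 1)]
    rw [← Finset.prod_filter]
    symm
    refine Finset.prod_bij (fun x _ => e0 m x) ?_ ?_ ?_ ?_
    · rintro ⟨s,k⟩ h
      simp only [Finset.mem_filter, Finset.mem_univ, true_and] at h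
      simp only [Finset.mem_Iio, Fin.lt_def, e0_val]
      rcases h with h | ⟨rfl, h⟩
      · have := s.2; have := t.2; rw [Fin.lt_def] at h; omega
      · rw [Fin.lt_def] at h; omega
    · intro x _ y _ h; exact (e0 m).injective h
    · intro i hi
      obtain ⟨⟨s,k⟩, rfl⟩ := (e0 m).surjective i
      refine ⟨(s,k), ?_, rfl⟩
      simp only [Finset.mem_Iio, Fin.lt_def, e0_val] at hi
      simp only [Finset.mem_filter, Finset.mem_univ, true_and, Fin.lt_def, Fin.ext_iff]
      have := s.2; have := t.2; omega
    · rintro ⟨s,k⟩ h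
      simp only [Equiv.permCongr_apply, Equiv.symm_apply_apply, hf]
      split_ifs <;> simp
  simp_rw [h2]
  rw [Fin.prod_univ_two, ← Finset.prod_mul_distrib]
  have h3 : (if f (0,l) < f (1,l) then (1:ℝ) else -1) = ∏ k, if k = l then (if f (0,l) < f (1,l) then (1:ℝ) else -1) else 1 := by
    simp
  rw [h3, ← Finset.prod_mul_distrib]
  refine Finset.prod_congr rfl fun k _ => ?_
  simp only [Fin.prod_univ_two]
  by_cases hk : k = l
  · subst hk; simp
  · by_cases hk' : k < l
    · simp only [hk, hk', true_or, if_true, if_false, one_mul]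
      split_ifs <;> norm_num
    · simp [hk, hk']

lemma prod_offdiag {m : ℕ} (F : Fin m → Fin m → ℝ) (h : ∀ k, F k k = 1) :
    ∏ k, ∏ l, F k l = ∏ l, ∏ k, if k < l then F k l * F l k else 1 := by
  have h1 : ∀ k l, F k l = (if k < l then F k l else 1) * (if l < k then F k l else 1) := by
    intro k l
    rcases lt_trichotomy k l with h' | h' | h'
    · simp [h', h'.le]
    · subst h'; simp [h]
    · simp [h', h'.le]
  have h2 : ∏ k, ∏ l, F k l = (∏ k, ∏ l, (if k < l then F k l else 1)) * ∏ k, ∏ l, (if l < k then F k l else 1) := by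
    rw [← Finset.prod_mul_distrib]
    refine Finset.prod_congr rfl fun k _ => ?_
    rw [← Finset.prod_mul_distrib]
    exact Finset.prod_congr rfl fun l _ => h1 k l
  rw [h2, Finset.prod_comm, ← Finset.prod_mul_distrib]
  refine Finset.prod_congr rfl fun k _ => ?_
  rw [← Finset.prod_mul_distrib]
  refine Finset.prod_congr rfl fun l _ => ?_
  split_ifs <;> simp

/-- Kasteleyn sign identity. -/
lemma kast_sign {m : ℕ} (t : ℝ) (pt : Fin (m*2) → Pt) (hmono : StrictMono fun i => ell t (pt i))
    (hgp : ∀ i j k, i ≠ j → i ≠ k → j ≠ k → oo (pt i) (pt j) (pt k) ≠ 0)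
    (σ : Equiv.Perm (Fin 2 × Fin m))
    (hX : ∀ k l, k ≠ l → ¬ XX (pt (e0 m (σ (0,k)))) (pt (e0 m (σ (1,k)))) (pt (e0 m (σ (0,l)))) (pt (e0 m (σ (1,l))))) :
    ((Equiv.Perm.sign σ : ℤ) : ℝ) *
      ∏ k, (bb t (pt (e0 m (σ (0,k)))) (pt (e0 m (σ (1,k)))) *
        ∏ i, al t (pt (e0 m (σ (0,k)))) (pt (e0 m (σ (1,k)))) (pt i)) = 1 := by
  set P : Fin 2 × Fin m → Pt := fun x => pt (e0 m (σ x)) with hP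
  have hmono' : ∀ i j, ell t (pt i) < ell t (pt j) ↔ i < j := fun i j => hmono.lt_iff_lt
  rw [sign_form σ (fun x => ell t (P x)) (fun x y => hmono' _ _)]
  have hne : ∀ x y, x ≠ y → ell t (P x) ≠ ell t (P y) := by
    intro x y h h'
    exact h (σ.injective ((e0 m).injective (hmono.injective h')))
  have hgp' : ∀ x y z, x ≠ y → x ≠ z → y ≠ z → oo (P x) (P y) (P z) ≠ 0 := by
    intro x y z h1 h2 h3
    exact hgp _ _ _ (fun h => h1 (σ.injective ((e0 m).injective h)))
      (fun h => h2 (σ.injective ((e0 m).injective h))) (fun h => h3 (σ.injective ((e0 m).injective h)))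
  have h1 : ∀ k, ∏ i, al t (P (0,k)) (P (1,k)) (pt i) = ∏ l, ∏ s, al t (P (0,k)) (P (1,k)) (P (s,l)) := by
    intro k
    rw [← Fintype.prod_prod_type_right (f := fun x : Fin 2 × Fin m => al t (P (0,k)) (P (1,k)) (P (x.1,x.2)))]
    rw [← (σ.trans (e0 m)).prod_comp]
    rfl
  rw [Finset.prod_mul_distrib]
  change _ * ((∏ k, bb t (P (0,k)) (P (1,k))) * ∏ k, ∏ i, al t (P (0,k)) (P (1,k)) (pt i)) = 1
  rw [Finset.prod_congr rfl fun k _ => h1 k]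
  rw [prod_offdiag (fun k l => ∏ s, al t (P (0,k)) (P (1,k)) (P (s,l)))]
  · have h2 : ∏ l, (if ell t (P (0,l)) < ell t (P (1,l)) then (1:ℝ) else -1) = ∏ k, bb t (P (0,k)) (P (1,k)) := rfl
    rw [h2]
    have h3 : (∏ k, bb t (P (0,k)) (P (1,k))) * (∏ k, bb t (P (0,k)) (P (1,k))) = 1 := by
      rw [← Finset.prod_mul_distrib]
      exact Finset.prod_eq_one fun k _ => bb_sq _ _ _
    rw [show ∀ a b c d : ℝ, a * b * (c * d) = (a * c) * (b * d) by intros; ring, h3, one_mul, ← Finset.prod_mul_distrib]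
    refine Finset.prod_eq_one fun l _ => ?_
    rw [← Finset.prod_mul_distrib]
    refine Finset.prod_eq_one fun k _ => ?_
    split_ifs with hkl
    · have hkl' : k ≠ l := hkl.ne
      have := br_eq_one t (a := P (0,k)) (b := P (1,k)) (c := P (0,l)) (d := P (1,l))
        (hne _ _ (by simp)) (hne _ _ (by simp)) (hne _ _ (by simp [hkl'])) (hne _ _ (by simp))
        (hne _ _ (by simp)) (hne _ _ (by simp [hkl']))
        (hgp' _ _ _ (by simp) (by simp [hkl']) (by simp)) (hgp' _ _ _ (by simp) (by simp) (by simp [hkl']))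
        (hgp' _ _ _ (by simp) (by simp [hkl'.symm]) (by simp)) (hgp' _ _ _ (by simp) (by simp) (by simp [hkl'.symm]))
        (hX k l hkl')
      refine Eq.trans ?_ this
      simp only [Fin.prod_univ_two]
      unfold br
      simp only [bb]
      ring
    · simp
  · intro k
    rw [Fin.prod_univ_two]
    have a1 : al t (P (0,k)) (P (1,k)) (P (0,k)) = 1 := if_neg (by rintro (⟨h, h', h''⟩ | ⟨h, h', _⟩) <;> linarith)
    have a2 : al t (P (0,k)) (P (1,k)) (P (1,k)) = 1 := if_neg (by rintro (⟨h, h', h''⟩ | ⟨h, h', _⟩) <;> linarith)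
    rw [a1, a2, one_mul]

/-- perfect matching of `S` (as a set of pairs) -/
def PM (S : Finset Pt) (M : Finset (Sym2 Pt)) : Prop :=
  (∀ e ∈ M, ¬ e.IsDiag ∧ ∀ p ∈ e, p ∈ S) ∧ ∀ p ∈ S, ∃! e, e ∈ M ∧ p ∈ e

lemma PM_enum {S : Finset Pt} {M : Finset (Sym2 Pt)} (h : PM S M) :
    ∃ π : Fin 2 × Fin M.card ≃ {p // p ∈ S},
      M = Finset.univ.image fun k => s((π (0,k) : Pt), (π (1,k) : Pt)) := by
  obtain ⟨h1, h2⟩ := h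
  let e := M.equivFin.symm
  have hrep : ∀ k, ∃ ab : Pt × Pt, (e k : Sym2 Pt) = s(ab.1, ab.2) := by
    intro k
    induction (e k : Sym2 Pt) using Sym2.ind with
    | _ a b => exact ⟨(a,b), rfl⟩
  choose r hr using hrep
  have hmem : ∀ k, (r k).1 ∈ S ∧ (r k).2 ∈ S ∧ (r k).1 ≠ (r k).2 := by
    intro k
    have := h1 _ (e k).2
    rw [hr k] at this
    exact ⟨this.2 _ (by simp), this.2 _ (by simp), fun h => this.1 (by simpa using h)⟩
  let F : Fin 2 × Fin M.card → {p // p ∈ S} := fun x =>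
    if x.1 = 0 then ⟨(r x.2).1, (hmem _).1⟩ else ⟨(r x.2).2, (hmem _).2.1⟩
  have hF : ∀ x, (F x : Pt) ∈ (e x.2 : Sym2 Pt) := by
    rintro ⟨s, k⟩
    rw [hr]
    by_cases hs : s = 0
    · simp [F, hs]
    · simp [F, hs]
  have hbij : Function.Bijective F := by
    constructor
    · rintro ⟨s,k⟩ ⟨t,l⟩ hst
      have hkl : k = l := by
        have a1 := hF (s,k); have a2 := hF (t,l)
        rw [← hst] at a2
        obtain ⟨e', -, he'⟩ := h2 _ (F (s,k)).2
        have b1 := he' _ ⟨(e k).2, a1⟩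
        have b2 := he' _ ⟨(e l).2, a2⟩
        exact e.injective (Subtype.ext (b1.trans b2.symm))
      subst hkl
      have := (hmem k).2.2
      fin_cases s <;> fin_cases t
      · rfl
      · simp [F, this] at hst
      · simp [F, this.symm] at hst
      · rfl
    · rintro ⟨p, hp⟩
      obtain ⟨e', ⟨he, hpe⟩, -⟩ := h2 p hp
      obtain ⟨k, hk⟩ := e.surjective ⟨e', he⟩
      have hk' : (e k : Sym2 Pt) = e' := congrArg Subtype.val hk
      rw [← hk', hr k, Sym2.mem_iff] at hpe
      rcases hpe with h | h
      · exact ⟨(0,k), Subtype.ext (by simp [F, h])⟩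
      · exact ⟨(1,k), Subtype.ext (by simp [F, h])⟩
  refine ⟨Equiv.ofBijective F hbij, ?_⟩
  have hs : ∀ k, s((F (0,k) : Pt), (F (1,k) : Pt)) = e k := by
    intro k; rw [hr k]; simp [F]
  ext x
  simp only [Finset.mem_image, Finset.mem_univ, true_and, Equiv.ofBijective_apply, hs]
  constructor
  · intro hx
    obtain ⟨k, hk⟩ := e.surjective ⟨x, hx⟩
    exact ⟨k, by rw [hk]⟩
  · rintro ⟨k, rfl⟩; exact (e k).2

lemma PM_card {S : Finset Pt} {M : Finset (Sym2 Pt)} (h : PM S M) : S.card = M.card * 2 := by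
  obtain ⟨π, -⟩ := PM_enum h
  have := Fintype.card_congr π
  simp at this
  omega

def shearPerm {m : ℕ} (φ : Fin m → Equiv.Perm (Fin 2)) (τ : Equiv.Perm (Fin m)) : Equiv.Perm (Fin 2 × Fin m) :=
  ((Equiv.prodComm _ _).trans (Equiv.prodShear τ φ)).trans (Equiv.prodComm _ _)

lemma shearPerm_apply {m : ℕ} (φ : Fin m → Equiv.Perm (Fin 2)) (τ : Equiv.Perm (Fin m)) (s : Fin 2) (k : Fin m) :
    shearPerm φ τ (s,k) = (φ k s, τ k) := rfl

lemma perm_two_sym {α : Type*} (f : Fin 2 → α) (φ : Equiv.Perm (Fin 2)) :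
    s(f (φ 0), f (φ 1)) = s(f 0, f 1) := by
  have h : φ 0 ≠ φ 1 := fun h => by simpa using φ.injective h
  have h' : (φ 0 = 0 ∧ φ 1 = 1) ∨ (φ 0 = 1 ∧ φ 1 = 0) := by
    generalize φ 0 = a at *; generalize φ 1 = b at *
    fin_cases a <;> fin_cases b <;> simp at *
  rcases h' with ⟨h1, h2⟩ | ⟨h1, h2⟩
  · rw [h1, h2]
  · rw [h1, h2, Sym2.eq_swap]

lemma al_sq (t : ℝ) (p q v : Pt) : al t p q v ^ 2 = 1 := by
  unfold al; split_ifs <;> norm_num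

lemma exists_sorted {S : Finset Pt} {n : ℕ} (hn : S.card = n) {t : ℝ} (ht : Set.InjOn (ell t) (S : Set Pt)) :
    ∃ pt : Fin n → Pt, StrictMono (fun i => ell t (pt i)) ∧ (∀ i, pt i ∈ S) ∧ ∀ p ∈ S, ∃ i, pt i = p := by
  have hc : (S.image (ell t)).card = n := by rw [Finset.card_image_of_injOn ht, hn]
  let iso := (S.image (ell t)).orderIsoOfFin hc
  have h : ∀ i, ∃ p ∈ S, ell t p = iso i := fun i => by
    have := (iso i).2
    rw [Finset.mem_image] at this
    exact this
  choose pt hpt hpt' using h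
  refine ⟨pt, ?_, hpt, ?_⟩
  · intro i j hij
    simp only [hpt']
    exact_mod_cast iso.strictMono hij
  · intro p hp
    obtain ⟨i, hi⟩ := iso.surjective ⟨ell t p, Finset.mem_image_of_mem _ hp⟩
    refine ⟨i, ht (hpt i) hp ?_⟩
    rw [hpt', hi]

theorem kast (S : Finset Pt) (hGP : GP S) (G : Finset (Sym2 Pt)) (hd : ∀ e ∈ G, ¬ e.IsDiag)
    (hplane : ∀ a b c d, s(a,b) ∈ G → s(c,d) ∈ G → ¬ XX a b c d)
    (w : Sym2 Pt → ℝ) (hw : ∀ e, 0 ≤ w e) :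
    ∑ M ∈ G.powerset.filter (PM S), ∏ e ∈ M, w e ≤
      Real.sqrt (∏ p ∈ S, Real.sqrt (∑ q ∈ S, if s(p,q) ∈ G then w s(p,q) ^ 2 else 0)) := by
  rcases (G.powerset.filter (PM S)).eq_empty_or_nonempty with h0 | ⟨M0, hM0⟩
  · rw [h0, Finset.sum_empty]; exact Real.sqrt_nonneg _
  have hM0' := (Finset.mem_filter.1 hM0).2
  obtain ⟨m, hm⟩ : ∃ m, S.card = m * 2 := ⟨_, PM_card hM0'⟩
  obtain ⟨t, ht⟩ := exists_shear S
  obtain ⟨pt, hmono, hptS, hsurj⟩ := exists_sorted hm ht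
  have hinj : Function.Injective pt := fun i j h => hmono.injective (by simp [h])
  set P : Fin 2 × Fin m → Pt := fun x => pt (e0 m x) with hP
  have hPinj : Function.Injective P := fun x y h => (e0 m).injective (hinj h)
  have hPS : ∀ x, P x ∈ S := fun x => hptS _
  have hPsurj : ∀ p ∈ S, ∃ x, P x = p := by
    intro p hp
    obtain ⟨i, hi⟩ := hsurj p hp
    obtain ⟨x, rfl⟩ := (e0 m).surjective i
    exact ⟨x, hi⟩
  let wt : Pt → Pt → ℝ := fun p q => if s(p,q) ∈ G then w s(p,q) else 0
  have hwt : ∀ p q, 0 ≤ wt p q := fun p q => by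
    simp only [wt]; split_ifs
    · exact hw _
    · exact le_rfl
  let ep : Pt → Pt → ℝ := fun p q => bb t p q * ∏ i, al t p q (pt i)
  have hep : ∀ p q, ep p q ^ 2 = 1 := by
    intro p q
    simp only [ep, mul_pow, ← Finset.prod_pow, al_sq, Finset.prod_const_one, mul_one]
    rw [sq, bb_sq]
  let A : Matrix (Fin 2 × Fin m) (Fin 2 × Fin m) ℝ := Matrix.of fun x y => ep (P x) (P y) * wt (P x) (P y)
  have hA : ∀ x y, A x y = - A y x := by
    intro x y
    simp only [A, Matrix.of_apply]
    by_cases hxy : x = y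
    · subst hxy
      have : wt (P x) (P x) = 0 := by
        simp only [wt]; rw [if_neg]; intro h; exact hd _ h (by simp)
      rw [this]; simp
    · have h1 : ell t (P x) ≠ ell t (P y) := fun h => hxy (hPinj (ht (hPS x) (hPS y) h))
      have h2 : ep (P y) (P x) = - ep (P x) (P y) := by
        simp only [ep]; rw [bb_swap t h1]
        simp only [al_swap t (P x) (P y)]; ring
      have h3 : wt (P y) (P x) = wt (P x) (P y) := by
        simp only [wt]; rw [Sym2.eq_swap]
      rw [h2, h3]; ring
  have hgp : ∀ i j k, i ≠ j → i ≠ k → j ≠ k → oo (pt i) (pt j) (pt k) ≠ 0 := fun i j k h1 h2 h3 =>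
    hGP _ (hptS i) _ (hptS j) _ (hptS k) (fun h => h1 (hinj h)) (fun h => h2 (hinj h)) (fun h => h3 (hinj h))
  let W : Equiv.Perm (Fin 2 × Fin m) → ℝ := fun σ => ∏ k, wt (P (σ (0,k))) (P (σ (1,k)))
  have hPP : PP A = ∑ σ, W σ := by
    unfold PP
    refine Finset.sum_congr rfl fun σ _ => ?_
    simp only [A, Matrix.of_apply, Finset.prod_mul_distrib, W]
    by_cases hall : ∀ k, s(P (σ (0,k)), P (σ (1,k))) ∈ G
    · have := kast_sign t pt hmono hgp σ (fun k l _ => hplane _ _ _ _ (hall k) (hall l))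
      rw [← mul_assoc]
      rw [show (((Equiv.Perm.sign σ : ℤ) : ℝ) * ∏ k, ep (P (σ (0,k))) (P (σ (1,k)))) = 1 from this, one_mul]
    · push Not at hall
      obtain ⟨k, hk⟩ := hall
      have : ∏ k, wt (P (σ (0,k))) (P (σ (1,k))) = 0 :=
        Finset.prod_eq_zero (Finset.mem_univ k) (if_neg hk)
      rw [this]; simp
  -- enumerations of matchings
  have henum : ∀ M, PM S M → ∃ σ : Equiv.Perm (Fin 2 × Fin m),
      M = Finset.univ.image fun k => s(P (σ (0,k)), P (σ (1,k))) := by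
    intro M hM
    obtain ⟨π, hπ⟩ := PM_enum hM
    have hc : M.card = m := by have := PM_card hM; omega
    subst hc
    let lab : Fin 2 × Fin M.card ≃ {p // p ∈ S} := Equiv.ofBijective (fun x => ⟨P x, hPS x⟩)
      ⟨fun x y h => hPinj (congrArg Subtype.val h), fun ⟨p, hp⟩ => by
        obtain ⟨x, hx⟩ := hPsurj p hp; exact ⟨x, Subtype.ext hx⟩⟩
    refine ⟨π.trans lab.symm, ?_⟩
    have hl : ∀ x, P ((π.trans lab.symm) x) = π x := by
      intro x
      have : lab (lab.symm (π x)) = π x := lab.apply_symm_apply _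
      exact congrArg Subtype.val this
    simp only [hl]
    exact hπ
  choose! En hEn using henum
  let I := (Fin m → Equiv.Perm (Fin 2)) × Equiv.Perm (Fin m)
  let act : Finset (Sym2 Pt) × I → Equiv.Perm (Fin 2 × Fin m) := fun x => (shearPerm x.2.1 x.2.2).trans (En x.1)
  have hactimg : ∀ M, PM S M → ∀ i : I, ∀ k, s(P (act (M,i) (0,k)), P (act (M,i) (1,k))) =
      s(P (En M (0, i.2 k)), P (En M (1, i.2 k))) := by
    intro M hM i k
    exact perm_two_sym (fun s => P (En M (s, i.2 k))) (i.1 k)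
  have himg : ∀ M, PM S M → ∀ i : I, M = Finset.univ.image fun k => s(P (act (M,i) (0,k)), P (act (M,i) (1,k))) := by
    intro M hM i
    conv_lhs => rw [hEn M hM]
    ext e
    simp only [Finset.mem_image, Finset.mem_univ, true_and, hactimg M hM i]
    constructor
    · rintro ⟨k, hk⟩; exact ⟨i.2.symm k, by simpa using hk⟩
    · rintro ⟨k, hk⟩; exact ⟨_, hk⟩
  have hWact : ∀ M ∈ G.powerset.filter (PM S), ∀ i : I, W (act (M,i)) = ∏ e ∈ M, w e := by
    intro M hM i
    obtain ⟨hMG, hM⟩ := Finset.mem_filter.1 hM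
    rw [Finset.mem_powerset] at hMG
    set σ := act (M,i) with hσ
    have hi := himg M hM i
    rw [← hσ] at hi
    have hin : ∀ k, s(P (σ (0,k)), P (σ (1,k))) ∈ G := fun k => hMG (by
      rw [hi]; exact Finset.mem_image_of_mem _ (Finset.mem_univ k))
    conv_rhs => rw [hi]
    rw [Finset.prod_image]
    · simp only [W]
      exact Finset.prod_congr rfl fun k _ => if_pos (hin k)
    · intro k _ l _ hkl
      simp only [Sym2.eq_iff] at hkl
      rcases hkl with ⟨h, _⟩ | ⟨h, _⟩
      · simpa using σ.injective (hPinj h)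
      · simpa using σ.injective (hPinj h)
  have hact_inj : Set.InjOn act (↑((G.powerset.filter (PM S)) ×ˢ (Finset.univ : Finset I)) : Set _) := by
    rintro ⟨M, i⟩ hM ⟨M', i'⟩ hM' heq
    simp only [Finset.coe_product, Set.mem_prod, Finset.mem_coe, Finset.mem_filter] at hM hM'
    have e1 := himg M hM.1.2 i
    have e2 := himg M' hM'.1.2 i'
    rw [← heq] at e2
    have hMM : M = M' := e1.trans e2.symm
    subst hMM
    have h3 : shearPerm i.1 i.2 = shearPerm i'.1 i'.2 := by
      ext1 x
      have := congrArg (fun e : Equiv.Perm _ => e x) heq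
      exact (En M).injective this
    have h4 : ∀ s k, ((i.1 k s, i.2 k) : Fin 2 × Fin m) = (i'.1 k s, i'.2 k) := fun s k => by
      rw [← shearPerm_apply, ← shearPerm_apply, h3]
    have h5 : i = i' := by
      refine Prod.ext ?_ ?_
      · funext k; ext1 s; exact (Prod.ext_iff.1 (h4 s k)).1
      · ext1 k; exact (Prod.ext_iff.1 (h4 0 k)).2
    rw [h5]
  have hWnn : ∀ σ, 0 ≤ W σ := fun σ => Finset.prod_nonneg fun k _ => hwt _ _
  have hcardI : (Fintype.card I : ℝ) = 2 ^ m * (m.factorial : ℝ) := by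
    simp only [I, Fintype.card_prod, Fintype.card_pi, Fintype.card_perm, Fintype.card_fin, Finset.prod_const,
      Finset.card_univ, Nat.factorial_two]
    push_cast; ring
  have hlow : (2 ^ m * (m.factorial : ℝ)) * ∑ M ∈ G.powerset.filter (PM S), ∏ e ∈ M, w e ≤ ∑ σ, W σ := by
    calc (2 ^ m * (m.factorial : ℝ)) * ∑ M ∈ G.powerset.filter (PM S), ∏ e ∈ M, w e
        = ∑ x ∈ (G.powerset.filter (PM S)) ×ˢ (Finset.univ : Finset I), W (act x) := by
          rw [Finset.sum_product, Finset.mul_sum]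
          refine Finset.sum_congr rfl fun M hM => ?_
          rw [Finset.sum_congr rfl fun i _ => hWact M hM i, Finset.sum_const, nsmul_eq_mul, Finset.card_univ, hcardI]
      _ = ∑ σ ∈ ((G.powerset.filter (PM S)) ×ˢ (Finset.univ : Finset I)).image act, W σ := by
          rw [Finset.sum_image hact_inj]
      _ ≤ ∑ σ, W σ := Finset.sum_le_sum_of_subset_of_nonneg (Finset.subset_univ _) fun σ _ _ => hWnn σ
  have hup := PP_bound A hA
  have hrow : ∏ i, Real.sqrt (∑ j, A i j ^ 2) =
      ∏ p ∈ S, Real.sqrt (∑ q ∈ S, if s(p,q) ∈ G then w s(p,q) ^ 2 else 0) := by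
    have hSimg : S = Finset.univ.image P := by
      ext p; simp only [Finset.mem_image, Finset.mem_univ, true_and]
      exact ⟨fun h => hPsurj p h, fun ⟨x, hx⟩ => hx ▸ hPS x⟩
    have hs : ∀ f : Pt → ℝ, ∑ q ∈ S, f q = ∑ x, f (P x) := by
      intro f; conv_lhs => rw [hSimg]
      rw [Finset.sum_image hPinj.injOn]
    have hp : ∀ f : Pt → ℝ, ∏ q ∈ S, f q = ∏ x, f (P x) := by
      intro f; conv_lhs => rw [hSimg]
      rw [Finset.prod_image hPinj.injOn]
    rw [hp]
    refine Finset.prod_congr rfl fun x _ => ?_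
    rw [hs]
    congr 1
    refine Finset.sum_congr rfl fun y _ => ?_
    simp only [A, Matrix.of_apply, mul_pow, hep, one_mul, wt]
    split_ifs <;> simp
  rw [hPP, hrow] at hup
  have hpos : (0:ℝ) < 2 ^ m * (m.factorial : ℝ) := by positivity
  have := (hlow.trans (le_abs_self _)).trans hup
  exact le_of_mul_le_mul_left this hpos

structure PlaneSet (S : Finset Pt) (T : Finset (Sym2 Pt)) : Prop where
  mem : ∀ a b, s(a,b) ∈ T → a ∈ S ∧ b ∈ S ∧ a ≠ b
  plane : ∀ a b c d, s(a,b) ∈ T → s(c,d) ∈ T → ¬ XX a b c d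

structure Tri (S : Finset Pt) (T : Finset (Sym2 Pt)) : Prop extends PlaneSet S T where
  max : ∀ p ∈ S, ∀ q ∈ S, p ≠ q → (∀ a b, s(a,b) ∈ T → ¬ XX a b p q) → s(p,q) ∈ T

lemma GP_of_GenPos {S : Finset Pt} (h : GenPos S) : GP S := by
  intro p hp q hq r hr h1 h2 h3 h0
  refine h p hp q hq r hr h1 h2 h3 ?_
  rw [collinear_iff_of_mem (p₀ := p) (by simp)]
  refine ⟨q - p, ?_⟩
  intro x hx
  simp only [Set.mem_insert_iff, Set.mem_singleton_iff] at hx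
  unfold oo at h0
  rcases hx with rfl | rfl | rfl
  · exact ⟨0, by simp⟩
  · exact ⟨1, by simp⟩
  · by_cases h4 : q.1 - p.1 = 0
    · have h5 : q.2 - p.2 ≠ 0 := fun h5 => h1 (Prod.ext (by linarith) (by linarith))
      refine ⟨(x.2 - p.2) / (q.2 - p.2), ?_⟩
      have h6 : x.1 - p.1 = 0 := by
        rw [h4] at h0; simp at h0; tauto
      refine Prod.ext ?_ ?_
      · simp [h4]; linarith
      · simp; field_simp; ring
    · refine ⟨(x.1 - p.1) / (q.1 - p.1), ?_⟩
      refine Prod.ext ?_ ?_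
      · simp; field_simp; ring
      · simp; field_simp; linarith

lemma oo_comb (a b c d : Pt) (t : ℝ) : oo a b (c + t • (d - c)) = (1 - t) * oo a b c + t * oo a b d := by
  unfold oo; simp; ring

lemma seg_comm_lemma {S : Finset Pt} (hS : GP S) {a b c d : Pt} (ha : a ∈ S) (hb : b ∈ S) (hc : c ∈ S) (hd : d ∈ S)
    (hab : a ≠ b) (hcd : c ≠ d) (hne : s(a,b) ≠ s(c,d)) (hX : ¬ XX a b c d)
    {x : Pt} (h1 : x ∈ segment ℝ a b) (h2 : x ∈ segment ℝ c d) : (x = a ∨ x = b) ∧ (x = c ∨ x = d) := by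
  rw [segment_eq_image'] at h1 h2
  obtain ⟨s, ⟨hs0, hs1⟩, rfl⟩ := h1
  obtain ⟨t, ⟨ht0, ht1⟩, hx⟩ := h2
  simp only at hx
  have e1 : (1 - t) * oo a b c + t * oo a b d = 0 := by
    rw [← oo_comb, hx, oo_comb, oo_self13, oo_self23]; ring
  have e2 : (1 - s) * oo c d a + s * oo c d b = 0 := by
    rw [← oo_comb, ← hx, oo_comb, oo_self13, oo_self23]; ring
  have hne' : ¬ (a = c ∧ b = d) ∧ ¬ (a = d ∧ b = c) := by
    rw [Ne, Sym2.eq_iff] at hne; tauto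
  simp only
  by_cases ac : a = c
  · subst ac
    have bd : b ≠ d := fun h => hne'.1 ⟨rfl, h⟩
    have n := hS a ha b hb d hd hab hcd bd
    rw [oo_self13] at e1
    have : t = 0 := by simpa [n] using e1
    subst this
    rw [← hx]; simp
  by_cases ad : a = d
  · subst ad
    have bc : b ≠ c := fun h => hne'.2 ⟨rfl, h⟩
    have n := hS a ha b hb c hc hab ac bc
    rw [oo_self13] at e1
    have : t = 1 := by have : 1 - t = 0 := by simpa [n] using e1
                       linarith
    subst this
    rw [← hx]; simp
  by_cases bc : b = c
  · subst bc
    have n := hS a ha b hb d hd hab ad hcd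
    rw [oo_self23] at e1
    have : t = 0 := by simpa [n] using e1
    subst this
    rw [← hx]; simp
  by_cases bd : b = d
  · subst bd
    have n := hS a ha b hb c hc hab ac bc
    rw [oo_self23] at e1
    have : t = 1 := by have : 1 - t = 0 := by simpa [n] using e1
                       linarith
    subst this
    rw [← hx]; simp
  exfalso
  apply hX
  have n1 := hS a ha b hb c hc hab ac bc
  have n2 := hS a ha b hb d hd hab ad bd
  have n3 := hS c hc d hd a ha hcd (Ne.symm ac) (Ne.symm ad)
  have n4 := hS c hc d hd b hb hcd (Ne.symm bc) (Ne.symm bd)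
  have gen : ∀ t f g : ℝ, 0 ≤ t → t ≤ 1 → f ≠ 0 → g ≠ 0 → (1 - t) * f + t * g = 0 → f * g < 0 := by
    intro t f g h0 h1 hf hg h
    by_contra hc
    push Not at hc
    have hpos : 0 < f * g := lt_of_le_of_ne hc (mul_ne_zero hf hg).symm
    have k1 : (1 - t) * f * f + t * (f * g) = 0 := by linear_combination f * h
    have hf2 : 0 < f * f := mul_self_pos.2 hf
    have k2 : 0 ≤ (1 - t) * (f * f) := mul_nonneg (by linarith) hf2.le
    have k3 : 0 ≤ t * (f * g) := mul_nonneg h0 hpos.le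
    have k4 : t = 0 := by
      have : t * (f*g) = 0 := by nlinarith
      rcases mul_eq_zero.1 this with h | h
      · exact h
      · exact absurd h hpos.ne'
    subst k4
    simp at h; exact hf h
  exact ⟨gen t _ _ ht0 ht1 n1 n2 e1, gen s _ _ hs0 hs1 n3 n4 e2⟩

lemma XX_point {a b c d : Pt} (h : XX a b c d) :
    ∃ s t : ℝ, 0 < s ∧ s < 1 ∧ 0 < t ∧ t < 1 ∧ a + s • (b - a) = c + t • (d - c) := by
  obtain ⟨h1, h2⟩ := h
  have gen : ∀ f g : ℝ, f * g < 0 → f - g ≠ 0 ∧ 0 < f / (f - g) ∧ f / (f - g) < 1 := by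
    intro f g h
    rcases mul_neg_iff.1 h with ⟨hf, hg⟩ | ⟨hf, hg⟩
    · have : 0 < f - g := by linarith
      exact ⟨this.ne', div_pos hf this, by rw [div_lt_one this]; linarith⟩
    · have : f - g < 0 := by linarith
      exact ⟨this.ne, div_pos_of_neg_of_neg hf this, by rw [div_lt_one_of_neg this]; linarith⟩
  obtain ⟨n1, p1, q1⟩ := gen _ _ h1
  obtain ⟨n2, p2, q2⟩ := gen _ _ h2
  refine ⟨_, _, p2, q2, p1, q1, ?_⟩
  have e : oo c d a - oo c d b = - (oo a b c - oo a b d) := by unfold oo; ring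
  rw [e]
  refine Prod.ext ?_ ?_
  · simp only [Prod.fst_add, Prod.smul_fst, Prod.fst_sub, smul_eq_mul]
    field_simp
    unfold oo; ring
  · simp only [Prod.snd_add, Prod.smul_snd, Prod.snd_sub, smul_eq_mul]
    field_simp
    unfold oo; ring

lemma XX_ne {a b c d : Pt} (h : XX a b c d) : a ≠ b ∧ c ≠ d ∧ a ≠ c ∧ a ≠ d ∧ b ≠ c ∧ b ≠ d := by
  unfold XX at h
  refine ⟨?_, ?_, ?_, ?_, ?_, ?_⟩ <;> rintro rfl <;> simp [oo_self12, oo_self13, oo_self23] at h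

lemma mem_seg_of {a b : Pt} {s : ℝ} (h0 : 0 ≤ s) (h1 : s ≤ 1) : a + s • (b - a) ∈ segment ℝ a b := by
  rw [segment_eq_image']; exact ⟨s, ⟨h0, h1⟩, rfl⟩

lemma planeSet_of_graph {S : Finset Pt} (G : PlaneGraph S) : PlaneSet S G.edges := by
  constructor
  · intro a b h
    exact ⟨G.endpoint_mem _ h a (by simp), G.endpoint_mem _ h b (by simp), fun h' => G.not_isDiag _ h (by simpa using h')⟩
  · intro a b c d h1 h2 hX
    obtain ⟨n1, n2, n3, n4, n5, n6⟩ := XX_ne hX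
    obtain ⟨s, t, s0, s1, t0, t1, he⟩ := XX_point hX
    have hne : s(a,b) ≠ s(c,d) := by rw [Ne, Sym2.eq_iff]; tauto
    have := G.noncrossing _ h1 _ h2 hne (a + s • (b - a))
      ⟨mem_seg_of s0.le s1.le, by rw [he]; exact mem_seg_of t0.le t1.le⟩
    rw [Sym2.mem_iff, Sym2.mem_iff] at this
    obtain ⟨h3, h4⟩ := this
    rcases h3 with h3 | h3 <;> rw [h3] at h4 <;> tauto

def graphOf {S : Finset Pt} (hS : GP S) (T : Finset (Sym2 Pt)) (hT : PlaneSet S T) : PlaneGraph S where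
  edges := T
  endpoint_mem := by
    intro e he p hp
    induction e using Sym2.ind with
    | _ a b =>
      obtain ⟨h1, h2, h3⟩ := hT.mem a b he
      rcases Sym2.mem_iff.1 hp with rfl | rfl <;> assumption
  not_isDiag := by
    intro e he
    induction e using Sym2.ind with
    | _ a b =>
      obtain ⟨h1, h2, h3⟩ := hT.mem a b he
      simpa using h3
  noncrossing := by
    intro e he f hf hne x hx
    induction e using Sym2.ind with
    | _ a b =>
    induction f using Sym2.ind with
    | _ c d =>
      obtain ⟨h1, h2, h3⟩ := hT.mem a b he
      obtain ⟨h4, h5, h6⟩ := hT.mem c d hf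
      have := seg_comm_lemma hS h1 h2 h4 h5 h3 h6 hne (hT.plane _ _ _ _ he hf) hx.1 hx.2
      rw [Sym2.mem_iff, Sym2.mem_iff]
      exact this

lemma PlaneGraph_ext {S : Finset Pt} {G H : PlaneGraph S} (h : G.edges = H.edges) : G = H := by
  cases G; cases H; simp at h; subst h; rfl

lemma PlaneSet_insert {S : Finset Pt} {T : Finset (Sym2 Pt)} (hT : PlaneSet S T) {p q : Pt}
    (hp : p ∈ S) (hq : q ∈ S) (hpq : p ≠ q) (h : ∀ a b, s(a,b) ∈ T → ¬ XX a b p q) :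
    PlaneSet S (insert s(p,q) T) := by
  constructor
  · intro a b hab
    rcases Finset.mem_insert.1 hab with h' | h'
    · rcases Sym2.eq_iff.1 h' with ⟨rfl, rfl⟩ | ⟨rfl, rfl⟩
      · exact ⟨hp, hq, hpq⟩
      · exact ⟨hq, hp, hpq.symm⟩
    · exact hT.mem a b h'
  · have key : ∀ a b c d, s(a,b) = s(p,q) → s(c,d) ∈ insert s(p,q) T → ¬ XX a b c d := by
      intro a b c d hab hcd hX
      have hX' : XX p q c d := by
        rcases Sym2.eq_iff.1 hab with ⟨rfl, rfl⟩ | ⟨rfl, rfl⟩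
        · exact hX
        · exact XX_swap1.1 hX
      rcases Finset.mem_insert.1 hcd with h' | h'
      · obtain ⟨n1, n2, n3, n4, n5, n6⟩ := XX_ne hX'
        rw [Sym2.eq_iff] at h'
        rcases h' with ⟨rfl, rfl⟩ | ⟨rfl, rfl⟩ <;> tauto
      · exact h c d h' (XX_symm.1 hX')
    intro a b c d hab hcd hX
    rcases Finset.mem_insert.1 hab with h' | h'
    · exact key a b c d h' hcd hX
    · rcases Finset.mem_insert.1 hcd with h'' | h''
      · exact key c d a b h'' hab (XX_symm.1 hX)
      · exact hT.plane a b c d h' h'' hX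

lemma PlaneSet_subset {S : Finset Pt} {T T' : Finset (Sym2 Pt)} (hT : PlaneSet S T) (h : T' ⊆ T) : PlaneSet S T' :=
  ⟨fun a b hab => hT.mem a b (h hab), fun a b c d h1 h2 => hT.plane a b c d (h h1) (h h2)⟩

lemma PlaneSet_sub {S : Finset Pt} {T : Finset (Sym2 Pt)} (hT : PlaneSet S T) : T ⊆ S.sym2 := by
  intro e he
  induction e using Sym2.ind with
  | _ a b =>
    obtain ⟨h1, h2, h3⟩ := hT.mem a b he
    simp [h1, h2]

def TT (S : Finset Pt) : Finset (Finset (Sym2 Pt)) := S.sym2.powerset.filter (Tri S)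

lemma mem_TT {S : Finset Pt} {T : Finset (Sym2 Pt)} : T ∈ TT S ↔ Tri S T := by
  simp only [TT, Finset.mem_filter, Finset.mem_powerset]
  exact ⟨fun h => h.2, fun h => ⟨PlaneSet_sub h.toPlaneSet, h⟩⟩

lemma tri_of_isTri {S : Finset Pt} (hS : GP S) {T : PlaneGraph S} (h : IsTriangulation T) : Tri S T.edges := by
  refine ⟨planeSet_of_graph T, ?_⟩
  intro p hp q hq hpq hX
  have h1 := h (graphOf hS _ (PlaneSet_insert (planeSet_of_graph T) hp hq hpq hX)) (Finset.subset_insert _ _)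
  have : s(p,q) ∈ insert s(p,q) T.edges := Finset.mem_insert_self _ _
  change insert s(p,q) T.edges = T.edges at h1
  rwa [h1] at this

lemma isTri_of_tri {S : Finset Pt} (hS : GP S) {T : Finset (Sym2 Pt)} (h : Tri S T) :
    IsTriangulation (graphOf hS T h.toPlaneSet) := by
  intro G hG
  refine Finset.Subset.antisymm ?_ hG
  intro e he
  induction e using Sym2.ind with
  | _ a b =>
    have hp := planeSet_of_graph G
    obtain ⟨h1, h2, h3⟩ := hp.mem a b he
    exact h.max a h1 b h2 h3 fun c d hcd => hp.plane _ _ _ _ (hG hcd) he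

lemma triCount_eq {S : Finset Pt} (hS : GP S) : triCount S = (TT S).card := by
  unfold triCount
  rw [← Fintype.card_coe, ← Nat.card_eq_fintype_card]
  refine Nat.card_congr
    { toFun := fun T => ⟨T.1.edges, mem_TT.2 (tri_of_isTri hS T.2)⟩
      invFun := fun T => ⟨graphOf hS T.1 (mem_TT.1 T.2).toPlaneSet, isTri_of_tri hS (mem_TT.1 T.2)⟩
      left_inv := fun T => Subtype.ext (PlaneGraph_ext rfl)
      right_inv := fun T => Subtype.ext rfl }

lemma exists_tri {S : Finset Pt} {C : Finset (Sym2 Pt)} (hC : PlaneSet S C) : ∃ T, Tri S T ∧ C ⊆ T := by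
  let F := S.sym2.powerset.filter fun T => PlaneSet S T ∧ C ⊆ T
  have hne : F.Nonempty := ⟨C, by simp [F, hC, PlaneSet_sub hC]⟩
  obtain ⟨T, hT, hmax⟩ := Finset.exists_max_image F Finset.card hne
  simp only [F, Finset.mem_filter, Finset.mem_powerset] at hT
  refine ⟨T, ⟨hT.2.1, ?_⟩, hT.2.2⟩
  intro p hp q hq hpq hX
  by_contra hn
  have h1 := PlaneSet_insert hT.2.1 hp hq hpq hX
  have := hmax (insert s(p,q) T) (by
    simp only [F, Finset.mem_filter, Finset.mem_powerset]
    exact ⟨PlaneSet_sub h1, h1, hT.2.2.trans (Finset.subset_insert _ _)⟩)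
  rw [Finset.card_insert_of_notMem hn] at this
  omega

/-- edge sets of spanning cycles -/
def Cyc (S : Finset Pt) (C : Finset (Sym2 Pt)) : Prop :=
  3 ≤ S.card ∧ ∃ f : Fin S.card ≃ {p : Pt // p ∈ S},
    C = Finset.image (fun i : Fin S.card => s(((f i : Pt)), ((f (finRotate S.card i) : Pt)))) Finset.univ

def CC (S : Finset Pt) : Finset (Finset (Sym2 Pt)) :=
  S.sym2.powerset.filter fun C => PlaneSet S C ∧ Cyc S C

lemma scCount_le {S : Finset Pt} : scCount S ≤ (CC S).card := by
  unfold scCount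
  rw [← Fintype.card_coe, ← Nat.card_eq_fintype_card]
  refine Nat.card_le_card_of_injective (fun G : {G : PlaneGraph S // IsSpanningCycle G} =>
    (⟨G.1.edges, ?_⟩ : {x // x ∈ CC S})) ?_
  · have h := planeSet_of_graph G.1
    simp only [CC, Finset.mem_filter, Finset.mem_powerset]
    exact ⟨PlaneSet_sub h, h, G.2⟩
  · intro G H h
    exact Subtype.ext (PlaneGraph_ext (congrArg Subtype.val h))

lemma GP.eq_or {S : Finset Pt} (hS : GP S) {c d p : Pt} (hc : c ∈ S) (hd : d ∈ S) (hp : p ∈ S) (hcd : c ≠ d)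
    (h : oo c d p = 0) : p = c ∨ p = d := by
  by_contra hn
  push Not at hn
  exact hS c hc d hd p hp hcd hn.1.symm hn.2.symm h

/-- common interior point gives a crossing -/
lemma XX_of_pt {S : Finset Pt} (hS : GP S) {a b c d : Pt} (ha : a ∈ S) (hb : b ∈ S) (hc : c ∈ S) (hd : d ∈ S)
    (hab : a ≠ b) (hcd : c ≠ d) (hne : s(a,b) ≠ s(c,d)) {s t : ℝ} (s0 : 0 < s) (s1 : s < 1) (t0 : 0 ≤ t) (t1 : t ≤ 1)
    (h : a + s • (b - a) = c + t • (d - c)) : XX a b c d := by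
  by_contra hX
  have := (seg_comm_lemma hS ha hb hc hd hab hcd hne hX (mem_seg_of s0.le s1.le)
    (by rw [h]; exact mem_seg_of t0 t1)).1
  rcases this with h' | h'
  · have h2 : s • (b - a) = 0 := by simpa using h'
    rcases smul_eq_zero.1 h2 with h3 | h3
    · exact s0.ne' h3
    · exact hab (sub_eq_zero.1 h3).symm
  · have h2 : (1 - s) • (b - a) = 0 := by
      have : (1 - s) • (b - a) = b - (a + s • (b - a)) := by
        rw [sub_smul, one_smul]; abel
      rw [this, h', sub_self]
    rcases smul_eq_zero.1 h2 with h3 | h3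
    · linarith
    · exact hab (sub_eq_zero.1 h3).symm

/-- sign pattern case of the exit lemma -/
lemma EL_aux1 {p q r c d : Pt} {t : ℝ} (t0 : 0 < t) (t1 : t < 1)
    (w1 : 0 < oo p q (c + t • (d - c))) (w3 : 0 < oo r p (c + t • (d - c)))
    (hP : 0 < oo c d p) (hQ : oo c d q < 0) (hR : oo c d r ≤ 0) :
    (0 ≤ oo p q c ∧ 0 ≤ oo q r c ∧ 0 ≤ oo r p c) ∨ (oo p q c < 0 ∧ XX c d p q) := by
  rw [oo_comb] at w1 w3
  have e1 : oo p q d - oo p q c = oo c d p - oo c d q := by unfold oo; ring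
  have e3 : oo r p d - oo r p c = oo c d r - oo c d p := by unfold oo; ring
  have e4 : oo c d p * oo q r c + oo c d q * oo r p c + oo c d r * oo p q c = 0 := by unfold oo; ring
  have hd : 0 < oo p q d := by nlinarith
  have hc3 : 0 < oo r p c := by nlinarith
  by_cases h : oo p q c < 0
  · right
    exact ⟨h, mul_neg_of_pos_of_neg hP hQ, mul_neg_of_neg_of_pos h hd⟩
  · left
    push Not at h
    refine ⟨h, ?_, hc3.le⟩
    by_contra hn
    push Not at hn
    nlinarith [mul_pos hP (neg_pos.2 hn), mul_pos (neg_pos.2 hQ) hc3, mul_nonneg (neg_nonneg.2 hR) h]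

lemma EL_aux2 {p q r c d : Pt} {t : ℝ} (t0 : 0 < t) (t1 : t < 1)
    (w1 : 0 < oo p q (c + t • (d - c))) (w3 : 0 < oo r p (c + t • (d - c)))
    (hP : oo c d p < 0) (hQ : 0 ≤ oo c d q) (hR : 0 < oo c d r) :
    (0 ≤ oo p q c ∧ 0 ≤ oo q r c ∧ 0 ≤ oo r p c) ∨ (oo r p c < 0 ∧ XX c d r p) := by
  rw [oo_comb] at w1 w3
  have e1 : oo p q d - oo p q c = oo c d p - oo c d q := by unfold oo; ring
  have e3 : oo r p d - oo r p c = oo c d r - oo c d p := by unfold oo; ring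
  have e4 : oo c d p * oo q r c + oo c d q * oo r p c + oo c d r * oo p q c = 0 := by unfold oo; ring
  have hd : 0 < oo r p d := by nlinarith
  have hc3 : 0 < oo p q c := by nlinarith
  by_cases h : oo r p c < 0
  · right
    exact ⟨h, mul_neg_of_pos_of_neg hR hP, mul_neg_of_neg_of_pos h hd⟩
  · left
    push Not at h
    refine ⟨hc3.le, ?_, h⟩
    by_contra hn
    push Not at hn
    nlinarith [mul_pos (neg_pos.2 hP) (neg_pos.2 hn), mul_pos hR hc3, mul_nonneg hQ h]

def InTri (p q r x : Pt) : Prop := 0 < oo p q x ∧ 0 < oo q r x ∧ 0 < oo r p x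

lemma InTri.rot {p q r x : Pt} (h : InTri p q r x) : InTri q r p x := ⟨h.2.1, h.2.2, h.1⟩

lemma EL_aux3 {S : Finset Pt} (hS : GP S) {p q r c d : Pt} (hp : p ∈ S) (hc : c ∈ S) (hd : d ∈ S) (hcd : c ≠ d)
    {t : ℝ} (t0 : 0 < t) (t1 : t < 1) (hw : InTri p q r (c + t • (d - c)))
    (hP : oo c d p = 0) :
    (0 ≤ oo p q c ∧ 0 ≤ oo q r c ∧ 0 ≤ oo r p c) ∨ (oo q r c < 0 ∧ XX c d q r) := by
  obtain ⟨w1, w2, w3⟩ := hw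
  have hΔ : 0 < oo p q r := by
    have : oo p q (c + t • (d - c)) + oo q r (c + t • (d - c)) + oo r p (c + t • (d - c)) = oo p q r := by
      unfold oo; ring
    linarith
  rw [oo_comb] at w1 w2 w3
  rcases hS.eq_or hc hd hp hcd hP with h | h
  · left
    subst h
    rw [oo_self13, oo_self23]
    exact ⟨le_rfl, by rw [oo_rot]; exact hΔ.le, le_rfl⟩
  · subst h
    rw [oo_self13] at w1
    rw [oo_self23] at w3
    rw [oo_rot p q r] at w2
    have h1 : 0 < oo p q c := by nlinarith
    have h3 : 0 < oo r p c := by nlinarith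
    by_cases h2 : oo q r c < 0
    · right
      refine ⟨h2, ?_, ?_⟩
      · have e1 : oo c p q = oo p q c := by unfold oo; ring
        have e2 : oo c p r = - oo r p c := by unfold oo; ring
        rw [e1, e2]; nlinarith
      · rw [oo_rot p q r]; nlinarith
    · left; exact ⟨h1.le, not_lt.1 h2, h3.le⟩

/-- exit lemma -/
lemma EL {S : Finset Pt} (hS : GP S) {p q r c d : Pt} (hp : p ∈ S) (hq : q ∈ S) (hr : r ∈ S) (hc : c ∈ S) (hd : d ∈ S)
    {t : ℝ} (t0 : 0 < t) (t1 : t < 1) (hw : InTri p q r (c + t • (d - c))) :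
    (0 ≤ oo p q c ∧ 0 ≤ oo q r c ∧ 0 ≤ oo r p c) ∨ (oo p q c < 0 ∧ XX c d p q) ∨
      (oo q r c < 0 ∧ XX c d q r) ∨ (oo r p c < 0 ∧ XX c d r p) := by
  by_cases hcd : c = d
  · subst hcd
    simp at hw
    exact Or.inl ⟨hw.1.le, hw.2.1.le, hw.2.2.le⟩
  have e4 : oo c d p * oo q r (c + t • (d - c)) + oo c d q * oo r p (c + t • (d - c)) + oo c d r * oo p q (c + t • (d - c)) = 0 := by
    unfold oo; simp; ring
  have hw' := hw
  obtain ⟨w1, w2, w3⟩ := hw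
  rcases lt_trichotomy (oo c d p) 0 with hP | hP | hP
  · rcases lt_or_ge (oo c d q) 0 with hQ | hQ
    · -- P,Q<0 so R>0 ; r is the odd one
      have hR : 0 < oo c d r := by
        by_contra h; push Not at h
        nlinarith [mul_pos (neg_pos.2 hP) w2, mul_pos (neg_pos.2 hQ) w3, mul_nonneg (neg_nonneg.2 h) w1.le]
      rcases EL_aux1 (p := r) (q := p) (r := q) t0 t1 w3 w2 hR hP hQ.le with h | h
      · exact Or.inl ⟨h.2.1, h.2.2, h.1⟩
      · exact Or.inr (Or.inr (Or.inr h))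
    · rcases lt_or_ge 0 (oo c d r) with hR | hR
      · rcases EL_aux2 (p := p) (q := q) (r := r) t0 t1 w1 w3 hP hQ hR with h | h
        · exact Or.inl h
        · exact Or.inr (Or.inr (Or.inr h))
      · have hQ' : 0 < oo c d q := by
          by_contra h; push Not at h
          nlinarith [mul_pos (neg_pos.2 hP) w2, mul_nonneg (neg_nonneg.2 h) w3.le, mul_nonneg (neg_nonneg.2 hR) w1.le]
        -- P<0,R≤0,Q>0 : q odd : side qr
        rcases lt_or_eq_of_le hR with hR' | hR'
        · rcases EL_aux1 (p := q) (q := r) (r := p) t0 t1 w2 w1 hQ' hR' hP.le with h | h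
          · exact Or.inl ⟨h.2.2, h.1, h.2.1⟩
          · exact Or.inr (Or.inr (Or.inl h))
        · rcases EL_aux3 hS (p := r) (q := p) (r := q) hr hc hd hcd t0 t1 hw'.rot.rot hR' with h | h
          · exact Or.inl ⟨h.2.1, h.2.2, h.1⟩
          · exact Or.inr (Or.inl h)
  · rcases EL_aux3 hS hp hc hd hcd t0 t1 hw' hP with h | h
    · exact Or.inl h
    · exact Or.inr (Or.inr (Or.inl h))
  · rcases lt_or_ge 0 (oo c d q) with hQ | hQ
    · have hR : oo c d r < 0 := by
        by_contra h; push Not at h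
        nlinarith [mul_pos hP w2, mul_pos hQ w3, mul_nonneg h w1.le]
      rcases EL_aux2 (p := r) (q := p) (r := q) t0 t1 w3 w2 hR hP.le hQ with h | h
      · exact Or.inl ⟨h.2.1, h.2.2, h.1⟩
      · exact Or.inr (Or.inr (Or.inl h))
    · rcases lt_or_ge 0 (oo c d r) with hR | hR
      · -- P>0,R>0,Q≤0 so Q<0: q odd: side pq
        have hQ' : oo c d q < 0 := by
          by_contra h; push Not at h
          nlinarith [mul_pos hP w2, mul_nonneg h w3.le, mul_pos hR w1]
        rcases EL_aux2 (p := q) (q := r) (r := p) t0 t1 w2 w1 hQ' hR.le hP with h | h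
        · exact Or.inl ⟨h.2.2, h.1, h.2.1⟩
        · exact Or.inr (Or.inl h)
      · rcases lt_or_eq_of_le hQ with hQ | hQ
        · rcases EL_aux1 (p := p) (q := q) (r := r) t0 t1 w1 w3 hP hQ hR with h | h
          · exact Or.inl h
          · exact Or.inr (Or.inl h)
        · rcases EL_aux3 hS (p := q) (q := r) (r := p) hq hc hd hcd t0 t1 hw'.rot hQ with h | h
          · exact Or.inl ⟨h.2.2, h.1, h.2.1⟩
          · exact Or.inr (Or.inr (Or.inr h))

def Empty3 (S : Finset Pt) (p q r : Pt) : Prop := ∀ x ∈ S, ¬ InTri p q r x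

lemma Empty3.rot {S : Finset Pt} {p q r : Pt} (h : Empty3 S p q r) : Empty3 S q r p :=
  fun x hx hi => h x hx hi.rot.rot

lemma T_symm {T : Finset (Sym2 Pt)} {a b : Pt} (h : s(a,b) ∈ T) : s(b,a) ∈ T := by rwa [Sym2.eq_swap]

/-- no edge into the wedge of an empty triangle -/
lemma L_wedge {S : Finset Pt} {T : Finset (Sym2 Pt)} (hS : GP S) (hT : PlaneSet S T) {u v r x : Pt}
    (he : Empty3 S u v r) (hvr : s(v,r) ∈ T) (hux : s(u,x) ∈ T) (h1 : 0 < oo u v x) (h2 : 0 < oo u x r)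
    (h3 : 0 < oo u v r) : False := by
  obtain ⟨hu, hx, hux'⟩ := hT.mem _ _ hux
  obtain ⟨hv, hr, hvr'⟩ := hT.mem _ _ hvr
  rcases lt_trichotomy (oo v r x) 0 with h | h | h
  · refine hT.plane _ _ _ _ hux hvr ⟨?_, ?_⟩
    · rw [oo_swap23 u v x]; nlinarith
    · rw [oo_rot u v r]; nlinarith
  · rcases hS.eq_or hv hr hx hvr' h with rfl | rfl
    · rw [oo_self23] at h1; linarith
    · rw [oo_self23] at h2; linarith
  · exact he x hx ⟨h1, h, by rwa [oo_rot']⟩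

/-- closed empty triangle: only vertices -/
lemma closed_empty {S : Finset Pt} (hS : GP S) {p q r x : Pt} (hp : p ∈ S) (hq : q ∈ S) (hr : r ∈ S) (hx : x ∈ S)
    (hpqr : 0 < oo p q r) (he : Empty3 S p q r) (h1 : 0 ≤ oo p q x) (h2 : 0 ≤ oo q r x) (h3 : 0 ≤ oo r p x) :
    x = p ∨ x = q ∨ x = r := by
  have npq : p ≠ q := by rintro rfl; rw [oo_self12] at hpqr; linarith
  have nqr : q ≠ r := by rintro rfl; rw [oo_self23] at hpqr; linarith
  have nrp : r ≠ p := by rintro rfl; rw [oo_self13] at hpqr; linarith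
  rcases lt_or_eq_of_le h1 with h1 | h1
  · rcases lt_or_eq_of_le h2 with h2 | h2
    · rcases lt_or_eq_of_le h3 with h3 | h3
      · exact absurd ⟨h1, h2, h3⟩ (he x hx)
      · have := hS.eq_or hr hp hx nrp h3.symm; tauto
    · have := hS.eq_or hq hr hx nqr h2.symm; tauto
  · have := hS.eq_or hp hq hx npq h1.symm; tauto

/-- no edge through an interior point of an empty triangle -/
lemma L_tri {S : Finset Pt} {T : Finset (Sym2 Pt)} (hS : GP S) (hT : PlaneSet S T) {p q r c d : Pt}
    (he : Empty3 S p q r) (hpq : s(p,q) ∈ T) (hqr : s(q,r) ∈ T) (hrp : s(r,p) ∈ T) (hcd : s(c,d) ∈ T)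
    {t : ℝ} (t0 : 0 < t) (t1 : t < 1) (hw : InTri p q r (c + t • (d - c))) : False := by
  obtain ⟨hp, hq, -⟩ := hT.mem _ _ hpq
  obtain ⟨-, hr, -⟩ := hT.mem _ _ hqr
  obtain ⟨hc, hd, hcd'⟩ := hT.mem _ _ hcd
  have hΔ : 0 < oo p q r := by
    have : oo p q (c + t • (d - c)) + oo q r (c + t • (d - c)) + oo r p (c + t • (d - c)) = oo p q r := by
      unfold oo; ring
    obtain ⟨a, b, c⟩ := hw
    linarith
  have key : ∀ c d : Pt, s(c,d) ∈ T → c ∈ S → d ∈ S → ∀ t : ℝ, 0 < t → t < 1 → InTri p q r (c + t • (d - c)) →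
      c = p ∨ c = q ∨ c = r := by
    intro c d hcd hc hd t t0 t1 hw
    rcases EL hS hp hq hr hc hd t0 t1 hw with h | h | h | h
    · exact closed_empty hS hp hq hr hc hΔ he h.1 h.2.1 h.2.2
    · exact absurd h.2 (hT.plane _ _ _ _ hcd hpq)
    · exact absurd h.2 (hT.plane _ _ _ _ hcd hqr)
    · exact absurd h.2 (hT.plane _ _ _ _ hcd hrp)
  have k1 := key c d hcd hc hd t t0 t1 hw
  have k2 := key d c (T_symm hcd) hd hc (1 - t) (by linarith) (by linarith) (by
    have : d + (1 - t) • (c - d) = c + t • (d - c) := by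
      refine Prod.ext ?_ ?_ <;> simp <;> ring
    rwa [this])
  obtain ⟨w1, w2, w3⟩ := hw
  rw [oo_comb] at w1 w2 w3
  rcases k1 with rfl | rfl | rfl <;> rcases k2 with rfl | rfl | rfl <;>
    simp [oo_self13, oo_self23] at *

/-- angular selection -/
lemma sel_key (p q x y : Pt) : oo p x y * ((q.1-p.1)^2 + (q.2-p.2)^2) =
    ((q.1-p.1)*(x.1-p.1) + (q.2-p.2)*(x.2-p.2)) * oo p q y -
    ((q.1-p.1)*(y.1-p.1) + (q.2-p.2)*(y.2-p.2)) * oo p q x := by unfold oo; ring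

lemma sel_sq_pos {p q x : Pt} (h : 0 < oo p q x) : 0 < (q.1-p.1)^2 + (q.2-p.2)^2 := by
  by_contra hn
  push Not at hn
  have h1 : q.1 - p.1 = 0 := by nlinarith [sq_nonneg (q.1-p.1), sq_nonneg (q.2-p.2)]
  have h2 : q.2 - p.2 = 0 := by nlinarith [sq_nonneg (q.1-p.1), sq_nonneg (q.2-p.2)]
  unfold oo at h; rw [h1, h2] at h; simp at h

lemma sel_iff {p q x y : Pt} (hx : 0 < oo p q x) (hy : 0 < oo p q y) :
    0 ≤ oo p x y ↔ ((q.1-p.1)*(y.1-p.1) + (q.2-p.2)*(y.2-p.2)) / oo p q y ≤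
      ((q.1-p.1)*(x.1-p.1) + (q.2-p.2)*(x.2-p.2)) / oo p q x := by
  rw [div_le_div_iff₀ hy hx]
  have h1 := sel_key p q x y
  have h2 := mul_nonneg_iff_of_pos_right (b := oo p x y) (sel_sq_pos hx)
  rw [← h2, h1, sub_nonneg]

lemma sel_min {p q : Pt} {A : Finset Pt} (hA : ∀ x ∈ A, 0 < oo p q x) (hne : A.Nonempty) :
    ∃ x ∈ A, ∀ y ∈ A, 0 ≤ oo p x y := by
  obtain ⟨x, hx, h⟩ := Finset.exists_max_image A (fun x => ((q.1-p.1)*(x.1-p.1) + (q.2-p.2)*(x.2-p.2)) / oo p q x) hne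
  exact ⟨x, hx, fun y hy => (sel_iff (hA x hx) (hA y hy)).2 (h y hy)⟩

lemma sel_max {p q : Pt} {A : Finset Pt} (hA : ∀ x ∈ A, 0 < oo p q x) (hne : A.Nonempty) :
    ∃ x ∈ A, ∀ y ∈ A, 0 ≤ oo p y x := by
  obtain ⟨x, hx, h⟩ := Finset.exists_min_image A (fun x => ((q.1-p.1)*(x.1-p.1) + (q.2-p.2)*(x.2-p.2)) / oo p q x) hne
  exact ⟨x, hx, fun y hy => (sel_iff (hA y hy) (hA x hx)).2 (h y hy)⟩

lemma V_hit {S : Finset Pt} {T : Finset (Sym2 Pt)} (hS : GP S) (hT : PlaneSet S T) {a b : Pt} (hab : s(a,b) ∈ T)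
    (α β : Pt → ℝ) (hα : ∀ c d t, α (c + t • (d - c)) = (1 - t) * α c + t * α d)
    (hβ : ∀ c d t, β (c + t • (d - c)) = (1 - t) * β c + t * β d)
    (inj : ∀ x y, α x = α y → β x = β y → x = y)
    {τ s : ℝ} (τ0 : 0 < τ) (s0 : 0 < s) (s1 : s < 1) (αa : α a = 0) (βa : β a = 1)
    (αb : s * α b = τ) (βb : s * β b = s - 1)
    {c d : Pt} (hcd : s(c,d) ∈ T) {t1 t2 : ℝ} (t10 : 0 ≤ t1) (t11 : t1 ≤ 1) (t20 : 0 ≤ t2) (t21 : t2 ≤ 1)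
    {ya yb : ℝ} (ya0 : 0 ≤ ya) (yb0 : 0 < yb)
    (gm : α (c + t1 • (d - c)) + τ * β (c + t1 • (d - c)) - τ < 0)
    (gw : 0 ≤ α (c + t2 • (d - c)) + τ * β (c + t2 • (d - c)) - τ)
    (κm : α (c + t1 • (d - c)) * yb - β (c + t1 • (d - c)) * ya = 0)
    (κw : 0 < α (c + t2 • (d - c)) * yb - β (c + t2 • (d - c)) * ya)
    (bm : 0 < β (c + t1 • (d - c))) (bw : 0 ≤ β (c + t2 • (d - c))) : False := by
  obtain ⟨ha, hb, hab'⟩ := hT.mem _ _ hab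
  obtain ⟨hc, hd, hcd'⟩ := hT.mem _ _ hcd
  set m := c + t1 • (d - c) with hm
  set w' := c + t2 • (d - c) with hw'
  have hne : s(a,b) ≠ s(c,d) := by
    intro h
    have ga : α a + τ * β a - τ = 0 := by rw [αa, βa]; ring
    have gb : α b + τ * β b - τ = 0 := by
      have : s * (α b + τ * β b - τ) = 0 := by linear_combination αb + τ * βb
      rcases mul_eq_zero.1 this with h | h
      · linarith
      · exact h
    rw [hm, hα, hβ] at gm
    rcases Sym2.eq_iff.1 h with ⟨rfl, rfl⟩ | ⟨rfl, rfl⟩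
    · have : (1 - t1) * α a + t1 * α b + τ * ((1 - t1) * β a + t1 * β b) - τ = 0 := by
        linear_combination (1 - t1) * ga + t1 * gb
      linarith
    · have : (1 - t1) * α b + t1 * α a + τ * ((1 - t1) * β b + t1 * β a) - τ = 0 := by
        linear_combination (1 - t1) * gb + t1 * ga
      linarith
  set G := α m + τ * β m - τ with hG
  set G' := α w' + τ * β w' - τ with hG'
  have hpos : 0 < G' - G := by linarith
  obtain ⟨l, hl⟩ : ∃ l, l = -G / (G' - G) := ⟨_, rfl⟩
  have l0 : 0 < l := by rw [hl]; exact div_pos (by linarith) hpos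
  have l1 : l ≤ 1 := by rw [hl, div_le_one hpos]; linarith
  have hlG : (1 - l) * G + l * G' = 0 := by
    rw [hl]; field_simp; ring
  have hw : c + ((1 - l) * t1 + l * t2) • (d - c) = m + l • (w' - m) := by
    rw [hm, hw']; refine Prod.ext ?_ ?_ <;> simp <;> ring
  set w := m + l • (w' - m) with hwd
  have wα : α w = (1 - l) * α m + l * α w' := hα _ _ _
  have wβ : β w = (1 - l) * β m + l * β w' := hβ _ _ _
  have gw0 : α w + τ * β w - τ = 0 := by rw [wα, wβ]; linear_combination hlG
  have βw0 : 0 ≤ β w := by rw [wβ]; have := mul_nonneg (sub_nonneg.2 l1) bm.le; have := mul_nonneg l0.le bw; linarith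
  have κw0 : 0 < α w * yb - β w * ya := by
    have : α w * yb - β w * ya = l * (α w' * yb - β w' * ya) := by
      rw [wα, wβ]; linear_combination (1 - l) * κm
    rw [this]; positivity
  have αw0 : 0 < α w := by
    by_contra h; push Not at h
    nlinarith [mul_nonneg βw0 ya0, mul_nonneg (neg_nonneg.2 h) yb0.le]
  have βw1 : β w < 1 := by nlinarith
  refine hT.plane _ _ _ _ hab hcd (XX_of_pt hS ha hb hc hd hab' hcd' hne (s := s * (1 - β w)) (t := (1 - l) * t1 + l * t2)
    (mul_pos s0 (by linarith)) (by nlinarith)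
    (add_nonneg (mul_nonneg (by linarith) t10) (mul_nonneg l0.le t20)) (by nlinarith) ?_)
  rw [hw]
  apply inj
  · rw [hα, αa]
    linear_combination (1 - β w) * αb - gw0
  · rw [hβ, βa]
    linear_combination (1 - β w) * βb

set_option maxHeartbeats 1000000 in
lemma V_lem {S : Finset Pt} {T : Finset (Sym2 Pt)} (hS : GP S) (hT : Tri S T) {p q' z : Pt} (hp : p ∈ S) (hz : z ∈ S)
    (hz0 : 0 < oo p q' z) : ∃ x, s(p,x) ∈ T ∧ 0 < oo p q' x := by
  have hpz : p ≠ z := by rintro rfl; rw [oo_self13] at hz0; linarith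
  by_contra hno
  push Not at hno
  have hzT : s(p,z) ∉ T := fun h => absurd (hno z h) (not_le.2 hz0)
  set E := (S ×ˢ S).filter fun ab => s(ab.1,ab.2) ∈ T ∧ XX p z ab.1 ab.2 with hE
  have hEne : E.Nonempty := by
    by_contra hn
    apply hzT
    refine hT.max p hp z hz hpz fun a b hab hX => hn ⟨(a,b), ?_⟩
    obtain ⟨ha, hb, -⟩ := hT.mem _ _ hab
    simp [hE, ha, hb, hab, XX_symm.1 hX]
  obtain ⟨⟨a0, b0⟩, hab0, hmin⟩ := Finset.exists_min_image E
    (fun ab => oo ab.1 ab.2 p / (oo ab.1 ab.2 p - oo ab.1 ab.2 z)) hEne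
  simp only [hE, Finset.mem_filter, Finset.mem_product, and_imp, Prod.forall] at hab0 hmin
  have pair : ∃ a b, s(a,b) ∈ T ∧ XX p z a b ∧ 0 < oo p q' a ∧
      oo a b p / (oo a b p - oo a b z) = oo a0 b0 p / (oo a0 b0 p - oo a0 b0 z) := by
    obtain ⟨s, t, s0, s1, t0, t1, h⟩ := XX_point hab0.2.2
    have h1 : oo p q' (p + s • (z - p)) = oo p q' (a0 + t • (b0 - a0)) := by rw [h]
    rw [oo_comb, oo_comb, oo_self13] at h1
    have : 0 < s * oo p q' z := by positivity
    by_cases ha : 0 < oo p q' a0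
    · exact ⟨a0, b0, hab0.2.1, hab0.2.2, ha, rfl⟩
    · refine ⟨b0, a0, T_symm hab0.2.1, XX_swap2.2 hab0.2.2, ?_, ?_⟩
      · by_contra hb
        push Not at ha hb
        nlinarith [mul_nonneg (sub_nonneg.2 t1.le) (neg_nonneg.2 ha), mul_nonneg t0.le (neg_nonneg.2 hb)]
      · rw [oo_swap12 a0 b0 p, oo_swap12 a0 b0 z]
        rw [show - oo a0 b0 p - - oo a0 b0 z = -(oo a0 b0 p - oo a0 b0 z) by ring, neg_div_neg_eq]
  obtain ⟨a, b, hab, hX, ha0, hτeq⟩ := pair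
  rw [← hτeq] at hmin
  obtain ⟨ha, hb, hab'⟩ := hT.mem _ _ hab
  have hneX := XX_ne hX
  set Δ := oo p z a with hΔ
  have Δ0 : Δ ≠ 0 := hS p hp z hz a ha hpz hneX.2.2.1 hneX.2.2.2.2.1
  let α : Pt → ℝ := fun q => oo p q a / Δ
  let β : Pt → ℝ := fun q => oo p z q / Δ
  have hα : ∀ c d t, α (c + t • (d - c)) = (1 - t) * α c + t * α d := by
    intro c d t; simp only [α]; unfold oo; simp; ring
  have hβ : ∀ c d t, β (c + t • (d - c)) = (1 - t) * β c + t * β d := by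
    intro c d t; simp only [β]; unfold oo; simp; ring
  have rec1 : ∀ q : Pt, Δ * (q.1 - p.1) = oo p q a * (z.1 - p.1) + oo p z q * (a.1 - p.1) := by
    intro q; rw [hΔ]; unfold oo; ring
  have rec2 : ∀ q : Pt, Δ * (q.2 - p.2) = oo p q a * (z.2 - p.2) + oo p z q * (a.2 - p.2) := by
    intro q; rw [hΔ]; unfold oo; ring
  have inj : ∀ x y, α x = α y → β x = β y → x = y := by
    intro x y h1 h2
    simp only [α, β] at h1 h2
    have h1' := (div_left_inj' Δ0).1 h1
    have h2' := (div_left_inj' Δ0).1 h2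
    refine Prod.ext ?_ ?_
    · have : Δ * (x.1 - p.1) = Δ * (y.1 - p.1) := by rw [rec1, rec1, h1', h2']
      have := mul_left_cancel₀ Δ0 this; linarith
    · have : Δ * (x.2 - p.2) = Δ * (y.2 - p.2) := by rw [rec2, rec2, h1', h2']
      have := mul_left_cancel₀ Δ0 this; linarith
  have hH : ∀ q : Pt, oo p q' q = α q * oo p q' z + β q * oo p q' a := by
    intro q
    have : Δ * oo p q' q = oo p q a * oo p q' z + oo p z q * oo p q' a := by rw [hΔ]; unfold oo; ring
    simp only [α, β]; field_simp; linarith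
  have αp : α p = 0 := by simp [α, oo_self12]
  have βp : β p = 0 := by simp [β, oo_self13]
  have αz : α z = 1 := by simp only [α]; exact div_self Δ0
  have βz : β z = 0 := by simp [β, oo_self23]
  have αa : α a = 0 := by simp [α, oo_self23]
  have βa : β a = 1 := by simp only [β]; exact div_self Δ0
  obtain ⟨τ, s, τ0, τ1, s0, s1, hx⟩ := XX_point hX
  have αb : s * α b = τ := by
    have := congrArg α hx; rw [hα, hα, αp, αz, αa] at this; linarith
  have βb : s * β b = s - 1 := by
    have := congrArg β hx; rw [hβ, hβ, βp, βz, βa] at this; linarith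
  -- minimality
  have hpar : ∀ c d : Pt, ∀ u v : ℝ, XX p z c d → p + u • (z - p) = c + v • (d - c) →
      oo c d p / (oo c d p - oo c d z) = u := by
    intro c d u v hXc h
    have h1 : oo c d (p + u • (z - p)) = 0 := by
      rw [h, oo_comb, oo_self13, oo_self23]; ring
    rw [oo_comb] at h1
    have : oo c d p - oo c d z ≠ 0 := by
      intro h0
      have := hXc.2
      rw [← sub_eq_zero.1 h0] at this
      exact absurd (mul_self_nonneg (oo c d p)) (not_le.2 this)
    rw [div_eq_iff this]; linarith
  rw [hpar a b τ s hX hx] at hmin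
  -- choose y
  set Y := S.filter fun q => 0 ≤ α q ∧ 0 < β q ∧ α q + τ * β q - τ ≤ 0 with hY
  have haY : a ∈ Y := by
    simp [hY, ha, αa, βa]
  obtain ⟨y, hy, hymax⟩ := Finset.exists_max_image Y (fun q => α q / β q) ⟨a, haY⟩
  simp only [hY, Finset.mem_filter, and_imp] at hy hymax
  obtain ⟨hyS, y1, y2, y3⟩ := hy
  have hy0 : 0 < oo p q' y := by
    rw [hH]; have := mul_nonneg y1 hz0.le; have := mul_pos y2 ha0; linarith
  refine absurd (hno y ?_) (not_le.2 hy0)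
  have hpy : p ≠ y := by rintro rfl; rw [oo_self13] at hy0; linarith
  refine hT.max p hp y hyS hpy fun c d hcd hXc => ?_
  obtain ⟨t, μ, t0, t1, μ0, μ1, hm⟩ := XX_point hXc
  have key : ∀ c d : Pt, s(c,d) ∈ T → ∀ t : ℝ, 0 < t → t < 1 → c + t • (d - c) = p + μ • (y - p) →
      0 < α c * β y - β c * α y → False := by
    intro c d hcd t t0 t1 hm hκ
    obtain ⟨hc, hd, hcd'⟩ := hT.mem _ _ hcd
    have ma : α (c + t • (d - c)) = μ * α y := by rw [hm, hα, αp]; ring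
    have mb : β (c + t • (d - c)) = μ * β y := by rw [hm, hβ, βp]; ring
    have gm : α (c + t • (d - c)) + τ * β (c + t • (d - c)) - τ < 0 := by
      rw [ma, mb]; nlinarith
    have κm : α (c + t • (d - c)) * β y - β (c + t • (d - c)) * α y = 0 := by rw [ma, mb]; ring
    have bm : 0 < β (c + t • (d - c)) := by rw [mb]; positivity
    have e0 : c + (0:ℝ) • (d - c) = c := by simp
    have hit := fun t2 t20 t21 => V_hit hS hT.toPlaneSet hab α β hα hβ inj τ0 s0 s1 αa βa αb βb hcd t0.le t1.le (t2 := t2) t20 t21 y1 y2 gm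
    by_cases hβc : 0 ≤ β c
    · have hgc : 0 ≤ α c + τ * β c - τ := by
        by_contra hg
        push Not at hg
        have hαc : 0 ≤ α c := by
          by_contra h; push Not at h
          nlinarith [mul_nonneg hβc y1]
        rcases lt_or_eq_of_le hβc with h | h
        · have := hymax c hc hαc h hg.le
          rw [div_le_div_iff₀ h y2] at this
          linarith
        · have : oo p z c = 0 := by
            have h' : oo p z c / Δ = 0 := h.symm
            rcases div_eq_zero_iff.1 h' with h | h
            · exact h
            · exact absurd h Δ0
          rcases hS.eq_or hp hz hc hpz this with rfl | rfl
          · rw [αp, βp] at hκ; linarith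
          · rw [αz, βz] at hg; linarith
      exact hit 0 le_rfl zero_le_one (by rw [e0]; exact hgc) κm (by rw [e0]; exact hκ) bm (by rw [e0]; exact hβc)
    · push Not at hβc
      -- point on line pz
      obtain ⟨l, hl⟩ : ∃ l, l = - β c / (μ * β y - β c) := ⟨_, rfl⟩
      have hden : 0 < μ * β y - β c := by have := mul_pos μ0 y2; linarith
      have l0 : 0 < l := by rw [hl]; exact div_pos (by linarith) hden
      have l1 : l < 1 := by rw [hl, div_lt_one hden]; have := mul_pos μ0 y2; linarith
      have hlβ : (1 - l) * β c + l * (μ * β y) = 0 := by rw [hl]; field_simp; ring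
      have hw : c + (l * t) • (d - c) = c + l • ((c + t • (d - c)) - c) := by
        refine Prod.ext ?_ ?_ <;> simp <;> ring
      have wβ : β (c + (l * t) • (d - c)) = 0 := by rw [hw, hβ, mb]; exact hlβ
      have wα : α (c + (l * t) • (d - c)) = (1 - l) * α c + l * (μ * α y) := by rw [hw, hα, ma]
      have wκ : 0 < α (c + (l * t) • (d - c)) * β y - β (c + (l * t) • (d - c)) * α y := by
        have : α (c + (l * t) • (d - c)) * β y - β (c + (l * t) • (d - c)) * α y = (1 - l) * (α c * β y - β c * α y) := by
          rw [wβ, wα]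
          linear_combination α y * hlβ
        rw [this]; exact mul_pos (by linarith) hκ
      have lt0 : 0 < l * t := mul_pos l0 t0
      have lt1 : l * t < 1 := mul_lt_one_of_nonneg_of_lt_one_left l0.le l1 t1.le
      by_cases hg : 0 ≤ α (c + (l * t) • (d - c)) + τ * β (c + (l * t) • (d - c)) - τ
      · exact hit (l*t) lt0.le lt1.le hg κm wκ bm (by rw [wβ])
      · rw [wβ] at hg wκ
        push Not at hg
        have wpos : 0 < α (c + (l * t) • (d - c)) := by
          rw [zero_mul, sub_zero] at wκ
          exact pos_of_mul_pos_left wκ y2.le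
        have hpt : p + (α (c + (l * t) • (d - c))) • (z - p) = c + (l * t) • (d - c) := by
          apply inj
          · rw [hα p z, αp, αz]; ring
          · rw [hβ p z, βp, βz, wβ]; ring
        have hXX : XX p z c d := XX_of_pt hS hp hz hc hd hpz hcd' (fun h => hzT (h ▸ hcd)) wpos (by linarith) lt0.le lt1.le hpt
        have := hmin c.1 c.2 d.1 d.2 hc hd hcd hXX
        rw [hpar c d _ _ hXX hpt] at this
        linarith
  have hκ : α c * β y - β c * α y ≠ 0 := by
    intro h0
    obtain ⟨hc, hd, hcd'⟩ := hT.mem _ _ hcd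
    have : Δ * (α c * β y - β c * α y) = - oo p y c := by
      have : Δ * Δ * (α c * β y - β c * α y) = - Δ * oo p y c := by
        simp only [α, β]; field_simp; rw [hΔ]; unfold oo; ring
      apply mul_left_cancel₀ Δ0; linarith
    rw [h0] at this
    have h1 : oo p y c = 0 := by linarith
    have h2 := hXc.2
    rw [h1] at h2; linarith
  rcases lt_or_gt_of_ne hκ with h | h
  · have e1 : d + (1 - t) • (c - d) = c + t • (d - c) := by
      refine Prod.ext ?_ ?_ <;> simp <;> ring
    refine key d c (T_symm hcd) (1 - t) (by linarith) (by linarith) (by rw [e1, hm]) ?_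
    have ma : (1 - t) * α c + t * α d = μ * α y := by rw [← hα, hm, hα, αp]; ring
    have mb : (1 - t) * β c + t * β d = μ * β y := by rw [← hβ, hm, hβ, βp]; ring
    have : t * (α d * β y - β d * α y) = - ((1 - t) * (α c * β y - β c * α y)) := by
      linear_combination β y * ma - α y * mb
    by_contra hn
    push Not at hn
    nlinarith [mul_pos (sub_pos.2 t1) (neg_pos.2 h), mul_nonneg t0.le (neg_nonneg.2 hn)]
  · exact key c d hcd t t0 t1 hm h

lemma W_empty {S : Finset Pt} {T : Finset (Sym2 Pt)} (hS : GP S) (hT : Tri S T) {p q r : Pt}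
    (hpq : s(p,q) ∈ T) (hpr : s(p,r) ∈ T) (hΔ : 0 < oo p q r)
    (hno : ∀ x, s(p,x) ∈ T → 0 < oo p q x → 0 < oo p x r → False) : Empty3 S p q r := by
  obtain ⟨hp, hq, hpq'⟩ := hT.mem _ _ hpq
  obtain ⟨-, hr, hpr'⟩ := hT.mem _ _ hpr
  intro z0 hz0 hin0
  obtain ⟨z, hz, hmax⟩ := Finset.exists_max_image (S.filter fun x => InTri p q r x) (fun x => oo q r x)
    ⟨z0, by simp [hz0, hin0]⟩
  simp only [Finset.mem_filter, and_imp] at hz hmax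
  obtain ⟨hzS, z1, z2, z3⟩ := hz
  have hpz : p ≠ z := by rintro rfl; rw [oo_self13] at z1; linarith
  have hsum : ∀ x : Pt, oo p q x + oo q r x + oo r p x = oo p q r := by intro x; unfold oo; ring
  refine hno z (hT.max p hp z hzS hpz fun c d hcd hX => ?_) z1 (by rwa [← oo_rot' p z r])
  obtain ⟨t, s, t0, t1, s0, s1, hw⟩ := XX_point hX
  have key : ∀ c d : Pt, s(c,d) ∈ T → XX c d p z → ∀ t : ℝ, 0 < t → t < 1 → c + t • (d - c) = p + s • (z - p) →
      oo q r (c + t • (d - c)) ≤ oo q r c → False := by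
    intro c d hcd hX t t0 t1 hw hc0
    obtain ⟨hc, hd, hcd'⟩ := hT.mem _ _ hcd
    have hrp : oo q r p = oo p q r := oo_rot _ _ _
    have w1 : 0 < oo p q (c + t • (d - c)) := by rw [hw, oo_comb, oo_self13]; have := mul_pos s0 z1; linarith
    have w3 : 0 < oo r p (c + t • (d - c)) := by rw [hw, oo_comb, oo_self23]; have := mul_pos s0 z3; linarith
    have hz' := hsum z
    have w2 : oo q r z < oo q r (c + t • (d - c)) := by
      rw [hw, oo_comb, hrp]
      have : 0 < (1 - s) * (oo p q r - oo q r z) := mul_pos (by linarith) (by linarith)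
      linarith
    have hne := XX_ne hX
    rcases EL hS hp hq hr hc hd t0 t1 ⟨w1, by linarith, w3⟩ with h | h | h | h
    · have c1 : oo p q c ≠ 0 := by
        intro h0
        rcases hS.eq_or hp hq hc hpq' h0 with rfl | rfl
        · exact hne.2.2.1 rfl
        · rw [oo_self13] at hc0; linarith
      have c3 : oo r p c ≠ 0 := by
        intro h0
        rcases hS.eq_or hr hp hc hpr'.symm h0 with rfl | rfl
        · rw [oo_self23] at hc0; linarith
        · exact hne.2.2.1 rfl
      have := hmax c hc ⟨lt_of_le_of_ne h.1 c1.symm, by linarith, lt_of_le_of_ne h.2.2 c3.symm⟩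
      linarith
    · exact hT.plane _ _ _ _ hcd hpq h.2
    · linarith
    · exact hT.plane _ _ _ _ hcd (T_symm hpr) h.2
  by_cases hc : oo q r (c + t • (d - c)) ≤ oo q r c
  · exact key c d hcd hX t t0 t1 hw hc
  · have e1 : d + (1 - t) • (c - d) = c + t • (d - c) := by
      refine Prod.ext ?_ ?_ <;> simp <;> ring
    refine key d c (T_symm hcd) (XX_swap1.2 hX) (1 - t) (by linarith) (by linarith) (by rw [e1, hw]) ?_
    rw [e1]
    push Not at hc
    rw [oo_comb] at hc ⊢
    nlinarith

lemma eps_lem {A B : ℝ} (hA : 0 < A) (hB : 0 < B) (x y : ℝ) :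
    ∃ ε : ℝ, 0 < ε ∧ ε < 1 ∧ 0 < (1 - ε) * A + ε * x ∧ 0 < (1 - ε) * B + ε * y := by
  have hm : 0 < min A B := lt_min hA hB
  set m := min A B
  have hmA : m ≤ A := min_le_left _ _
  have hmB : m ≤ B := min_le_right _ _
  set k := |x| + |y| + 1 with hk
  have hk0 : 0 < k := by positivity
  have kx : 0 < k + x := by have := neg_abs_le x; have := abs_nonneg y; linarith
  have ky : 0 < k + y := by have := neg_abs_le y; have := abs_nonneg x; linarith
  refine ⟨m / (m + k), by positivity, by rw [div_lt_one (by positivity)]; linarith, ?_, ?_⟩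
  · have : (1 - m / (m + k)) * A + m / (m + k) * x = (k * A + m * x) / (m + k) := by field_simp; ring
    rw [this]; apply div_pos _ (by positivity); nlinarith [mul_pos hm kx]
  · have : (1 - m / (m + k)) * B + m / (m + k) * y = (k * B + m * y) / (m + k) := by field_simp; ring
    rw [this]; apply div_pos _ (by positivity); nlinarith [mul_pos hm ky]

lemma W_edge {S : Finset Pt} {T : Finset (Sym2 Pt)} (hS : GP S) (hT : Tri S T) {p q r : Pt}
    (hpq : s(p,q) ∈ T) (hpr : s(p,r) ∈ T) (hΔ : 0 < oo p q r)
    (hno : ∀ x, s(p,x) ∈ T → 0 < oo p q x → 0 < oo p x r → False) : s(q,r) ∈ T := by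
  have he := W_empty hS hT hpq hpr hΔ hno
  obtain ⟨hp, hq, hpq'⟩ := hT.mem _ _ hpq
  obtain ⟨-, hr, hpr'⟩ := hT.mem _ _ hpr
  have hqr : q ≠ r := by rintro rfl; rw [oo_self23] at hΔ; linarith
  refine hT.max q hq r hr hqr fun c d hcd hX => ?_
  have key : ∀ c d : Pt, s(c,d) ∈ T → XX c d q r → 0 < oo q r c → False := by
    intro c d hcd hX hc0
    obtain ⟨hc, hd, hcd'⟩ := hT.mem _ _ hcd
    obtain ⟨t, s, t0, t1, s0, s1, hw⟩ := XX_point hX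
    have a1 : oo p q (c + t • (d - c)) = s * oo p q r := by rw [hw, oo_comb, oo_self23]; ring
    have a2 : oo q r (c + t • (d - c)) = 0 := by rw [hw, oo_comb, oo_self23, oo_self13]; ring
    have a3 : oo r p (c + t • (d - c)) = (1 - s) * oo p q r := by rw [hw, oo_comb, oo_self13, oo_rot' p q r]; ring
    obtain ⟨ε, ε0, ε1, h1, h3⟩ := eps_lem (mul_pos s0 hΔ) (mul_pos (sub_pos.2 s1) hΔ) (oo p q c) (oo r p c)
    have hw' : c + ((1 - ε) * t) • (d - c) = (c + t • (d - c)) + ε • (c - (c + t • (d - c))) := by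
      refine Prod.ext ?_ ?_ <;> simp <;> ring
    have hne := XX_ne hX
    have hin : InTri p q r (c + ((1 - ε) * t) • (d - c)) := by
      rw [hw']
      refine ⟨?_, ?_, ?_⟩
      · rw [oo_comb, a1]; exact h1
      · rw [oo_comb, a2]; have := mul_pos ε0 hc0; linarith
      · rw [oo_comb, a3]; exact h3
    rcases EL hS hp hq hr hc hd (mul_pos (sub_pos.2 ε1) t0) (mul_lt_one_of_nonneg_of_lt_one_left (by linarith) (by linarith) t1.le) hin with h | h | h | h
    · rcases closed_empty hS hp hq hr hc hΔ he h.1 h.2.1 h.2.2 with rfl | rfl | rfl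
      · rw [oo_comb, oo_self13] at a1
        rw [oo_comb, oo_self23] at a3
        refine hno d hcd ?_ ?_
        · have : 0 < t * oo c q d := by have := mul_pos s0 hΔ; linarith
          exact pos_of_mul_pos_right this t0.le
        · have : 0 < t * oo r c d := by have := mul_pos (sub_pos.2 s1) hΔ; linarith
          rw [← oo_rot' c d r]
          exact pos_of_mul_pos_right this t0.le
      · exact hne.2.2.1 rfl
      · exact hne.2.2.2.1 rfl
    · exact hT.plane _ _ _ _ hcd hpq h.2
    · linarith
    · exact hT.plane _ _ _ _ hcd (T_symm hpr) h.2
  rcases mul_neg_iff.1 hX.2 with h | h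
  · exact key c d hcd hX h.1
  · exact key d c (T_symm hcd) (XX_swap1.2 hX) h.2

/-- out-neighbour on the hull -/
def Hout (S : Finset Pt) (p q : Pt) : Prop := q ∈ S ∧ p ≠ q ∧ ∀ x ∈ S, 0 ≤ oo p q x

def hullV (S : Finset Pt) (p : Pt) : Prop := ∃ q, Hout S p q

lemma Hout_unique {S : Finset Pt} (hS : GP S) {p q q' : Pt} (hp : p ∈ S) (h : Hout S p q) (h' : Hout S p q') : q = q' := by
  by_contra hne
  have h1 := h.2.2 q' h'.1
  have h2 := h'.2.2 q h.1
  rw [oo_swap23] at h2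
  exact hS p hp q h.1 q' h'.1 h.2.1 h'.2.1 hne (by linarith)

lemma Hout_edge {S : Finset Pt} {T : Finset (Sym2 Pt)} (hT : Tri S T) {p q : Pt} (hp : p ∈ S) (h : Hout S p q) : s(p,q) ∈ T := by
  refine hT.max p hp q h.1 h.2.1 fun a b hab hX => ?_
  obtain ⟨ha, hb, -⟩ := hT.mem _ _ hab
  have := hX.2
  have := mul_nonneg (h.2.2 a ha) (h.2.2 b hb)
  linarith

/-- `D` has edges at `p` in every open half plane -/
def Spans (D : Finset (Sym2 Pt)) (p : Pt) : Prop := ∀ q', q' ≠ p → ∃ x, s(p,x) ∈ D ∧ 0 < oo p q' x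

lemma pt_ray {p a q' : Pt} (hq' : q' ≠ p) (ha : 0 = oo p q' a) (hap : a ≠ p) :
    ∃ c : ℝ, c ≠ 0 ∧ ∀ x, oo p a x = c * oo p q' x := by
  have hsq : 0 < (q'.1-p.1)^2 + (q'.2-p.2)^2 := by
    by_contra hn
    push Not at hn
    apply hq'
    have h1 : q'.1 - p.1 = 0 := by nlinarith [sq_nonneg (q'.1-p.1), sq_nonneg (q'.2-p.2)]
    have h2 : q'.2 - p.2 = 0 := by nlinarith [sq_nonneg (q'.1-p.1), sq_nonneg (q'.2-p.2)]
    exact Prod.ext (by linarith) (by linarith)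
  have hsa : 0 < (a.1-p.1)^2 + (a.2-p.2)^2 := by
    by_contra hn
    push Not at hn
    apply hap
    have h1 : a.1 - p.1 = 0 := by nlinarith [sq_nonneg (a.1-p.1), sq_nonneg (a.2-p.2)]
    have h2 : a.2 - p.2 = 0 := by nlinarith [sq_nonneg (a.1-p.1), sq_nonneg (a.2-p.2)]
    exact Prod.ext (by linarith) (by linarith)
  set c := ((q'.1-p.1)*(a.1-p.1)+(q'.2-p.2)*(a.2-p.2))/((q'.1-p.1)^2 + (q'.2-p.2)^2) with hc
  have k1 : a.1 - p.1 = c * (q'.1 - p.1) := by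
    rw [hc]; field_simp; unfold oo at ha; linear_combination (q'.2 - p.2) * ha
  have k2 : a.2 - p.2 = c * (q'.2 - p.2) := by
    rw [hc]; field_simp; unfold oo at ha; linear_combination (-(q'.1 - p.1)) * ha
  refine ⟨c, ?_, fun x => by unfold oo; rw [k1, k2]; ring⟩
  intro h0
  rw [k1, k2, h0] at hsa; simp at hsa

lemma nonhull_pt {S : Finset Pt} (hS : GP S) {p q' : Pt} (hp : p ∈ S) (h2 : ∃ a ∈ S, a ≠ p) (hh : ¬ hullV S p)
    (hq' : q' ≠ p) : ∃ x ∈ S, 0 < oo p q' x := by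
  by_contra hno
  push Not at hno
  apply hh
  obtain ⟨q'', hq''⟩ : ∃ q'' : Pt, q'' = p + (-1 : ℝ) • (q' - p) := ⟨_, rfl⟩
  have ho : ∀ x, oo p q'' x = - oo p q' x := by intro x; rw [hq'']; unfold oo; simp; ring
  have hq2 : q'' ≠ p := by
    intro h; apply hq'; rw [hq''] at h
    have h1 := congrArg Prod.fst h
    have h2 := congrArg Prod.snd h
    simp at h1 h2
    exact Prod.ext (by linarith) (by linarith)
  have hle : ∀ x ∈ S, 0 ≤ oo p q'' x := fun x hx => by rw [ho]; linarith [hno x hx]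
  have hline : ∀ a ∈ S, ∀ b ∈ S, a ≠ p → b ≠ p → oo p q'' a = 0 → oo p q'' b = 0 → a = b := by
    intro a ha b hb hap hbp h1 h2
    by_contra hne
    obtain ⟨c, hc, hx⟩ := pt_ray hq2 h1.symm hap
    apply hS p hp a ha b hb hap.symm hbp.symm hne
    rw [hx, h2, mul_zero]
  by_cases hA : (S.filter fun x => 0 < oo p q'' x).Nonempty
  · obtain ⟨x, hx, hmin⟩ := sel_min (p := p) (q := q'') (A := S.filter fun x => 0 < oo p q'' x) (by simp) hA
    simp only [Finset.mem_filter, and_imp] at hx hmin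
    have hxp : p ≠ x := by rintro rfl; rw [oo_self13] at hx; linarith [hx.2]
    by_cases hB : ∃ a ∈ S, a ≠ p ∧ oo p q'' a = 0
    · obtain ⟨a, ha, hap, h0⟩ := hB
      obtain ⟨c, hc, hcx⟩ := pt_ray hq2 h0.symm hap
      rcases lt_or_gt_of_ne hc with hc | hc
      · refine ⟨x, hx.1, hxp, fun y hy => ?_⟩
        rcases lt_or_eq_of_le (hle y hy) with h | h
        · exact hmin y hy h
        · by_cases hyp : y = p
          · rw [hyp, oo_self13]
          · rw [hline y hy a ha hyp hap h.symm h0, oo_swap23, hcx]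
            nlinarith [hx.2]
      · refine ⟨a, ha, hap.symm, fun y hy => ?_⟩
        rw [hcx]; exact mul_nonneg hc.le (hle y hy)
    · refine ⟨x, hx.1, hxp, fun y hy => ?_⟩
      rcases lt_or_eq_of_le (hle y hy) with h | h
      · exact hmin y hy h
      · by_cases hyp : y = p
        · rw [hyp, oo_self13]
        · exact absurd ⟨y, hy, hyp, h.symm⟩ hB
  · obtain ⟨a, ha, hap⟩ := h2
    have h0 : ∀ y ∈ S, oo p q'' y = 0 := by
      intro y hy
      by_contra h
      exact hA ⟨y, by simp [hy, lt_of_le_of_ne (hle y hy) (Ne.symm h)]⟩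
    refine ⟨a, ha, hap.symm, fun y hy => ?_⟩
    by_cases hyp : y = p
    · rw [hyp, oo_self13]
    · rw [hline y hy a ha hyp hap (h0 y hy) (h0 a ha), oo_self23]

lemma Span_T {S : Finset Pt} {T : Finset (Sym2 Pt)} (hS : GP S) (hT : Tri S T) {p : Pt} (hp : p ∈ S)
    (h2 : ∃ a ∈ S, a ≠ p) (hh : ¬ hullV S p) : Spans T p := by
  intro q' hq'
  obtain ⟨z, hz, hz0⟩ := nonhull_pt hS hp h2 hh hq'
  exact V_lem hS hT hp hz hz0

def dirp (t c : ℝ) (p : Pt) : Pt := (p.1 + c * t, p.2 - c)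

lemma oo_dirp (t c : ℝ) (p x : Pt) : oo p (dirp t c p) x = c * (ell t x - ell t p) := by
  unfold oo dirp ell; simp; ring

def nb (S : Finset Pt) (T : Finset (Sym2 Pt)) (p : Pt) : Finset Pt := S.filter fun x => s(p,x) ∈ T

lemma mem_nb {S : Finset Pt} {T : Finset (Sym2 Pt)} (hT : PlaneSet S T) {p x : Pt} : x ∈ nb S T p ↔ s(p,x) ∈ T := by
  simp only [nb, Finset.mem_filter, and_iff_right_iff_imp]
  exact fun h => (hT.mem _ _ h).2.1

lemma pl (t : ℝ) (u x y z : Pt) : (ell t x - ell t u) * oo u y z =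
    (ell t y - ell t u) * oo u x z - (ell t z - ell t u) * oo u x y := by unfold ell oo; ring

structure Good (S : Finset Pt) (T : Finset (Sym2 Pt)) (t c : ℝ) (u x y : Pt) : Prop where
  dx : 0 < c * (ell t x - ell t u)
  dy : c * (ell t y - ell t u) < 0
  pos : 0 < oo u x y
  ux : s(u,x) ∈ T
  uy : s(u,y) ∈ T
  xy : s(x,y) ∈ T
  emp : Empty3 S u x y

lemma Good_x {S : Finset Pt} {T : Finset (Sym2 Pt)} (hS : GP S) (hT : PlaneSet S T) {t c : ℝ} {u x y x' y' : Pt}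
    (h : Good S T t c u x y) (h' : Good S T t c u x' y') : oo u x x' ≤ 0 ∧ oo u y' y ≤ 0 := by
  constructor
  · by_contra hn
    push Not at hn
    refine L_wedge hS hT h.emp h.xy h'.ux hn ?_ h.pos
    have e : (c * (ell t x - ell t u)) * oo u x' y =
      (c * (ell t x' - ell t u)) * oo u x y - (c * (ell t y - ell t u)) * oo u x x' := by
      linear_combination c * pl t u x x' y
    have : 0 < (c * (ell t x - ell t u)) * oo u x' y := by
      rw [e]; nlinarith [mul_pos h'.dx h.pos, mul_pos (neg_pos.2 h.dy) hn]
    exact pos_of_mul_pos_right this h.dx.le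
  · by_contra hn
    push Not at hn
    refine L_wedge hS hT h.emp h.xy h'.uy ?_ hn h.pos
    have e : (c * (ell t y - ell t u)) * oo u x y' =
      (c * (ell t y' - ell t u)) * oo u x y - (c * (ell t x - ell t u)) * oo u y' y := by
      unfold ell oo; ring
    have : (c * (ell t y - ell t u)) * oo u x y' < 0 := by
      rw [e]; nlinarith [mul_pos (neg_pos.2 h'.dy) h.pos, mul_pos h.dx hn]
    by_contra hq
    push Not at hq
    nlinarith [mul_nonneg (neg_pos.2 h.dy).le (neg_nonneg.2 hq)]

lemma Good_unique {S : Finset Pt} {T : Finset (Sym2 Pt)} (hS : GP S) (hT : PlaneSet S T) {t c : ℝ} {u x y x' y' : Pt}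
    (h : Good S T t c u x y) (h' : Good S T t c u x' y') : x = x' ∧ y = y' := by
  obtain ⟨h1, h2⟩ := Good_x hS hT h h'
  obtain ⟨h3, h4⟩ := Good_x hS hT h' h
  rw [oo_swap23] at h3 h4
  obtain ⟨hu, hx, hux⟩ := hT.mem _ _ h.ux
  obtain ⟨-, hy, huy⟩ := hT.mem _ _ h.uy
  obtain ⟨-, hx', hux'⟩ := hT.mem _ _ h'.ux
  obtain ⟨-, hy', huy'⟩ := hT.mem _ _ h'.uy
  constructor
  · by_contra hne
    exact hS u hu x hx x' hx' hux hux' hne (by linarith)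
  · by_contra hne
    exact hS u hu y' hy' y hy huy' huy (Ne.symm hne) (by linarith)

lemma side_nbr {S : Finset Pt} {T : Finset (Sym2 Pt)} (hS : GP S) (hT : Tri S T) {t c : ℝ} {v w : Pt} (hv : v ∈ S) (hw : w ∈ S)
    (h : 0 < c * (ell t w - ell t v)) : ∃ x, s(v,x) ∈ T ∧ 0 < c * (ell t x - ell t v) := by
  obtain ⟨x, hx, h0⟩ := V_lem hS hT (q' := dirp t c v) hv hw (by rwa [oo_dirp])
  exact ⟨x, hx, by rwa [oo_dirp] at h0⟩

lemma Good_or {S : Finset Pt} {T : Finset (Sym2 Pt)} (hS : GP S) (hT : Tri S T) {t c : ℝ} (hinj : Set.InjOn (ell t) (S : Set Pt))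
    (hc0 : c ≠ 0) {u a b : Pt} (hu : u ∈ S) (ha : a ∈ S) (hb : b ∈ S)
    (hda : 0 < c * (ell t a - ell t u)) (hdb : c * (ell t b - ell t u) < 0) :
    (∃ x y, Good S T t c u x y) ∨ ∃ x, 0 < c * (ell t x - ell t u) ∧ x ∈ S ∧ Hout S x u := by
  have hP := hT.toPlaneSet
  obtain ⟨a', ha', hda'⟩ := side_nbr hS hT hu ha hda
  obtain ⟨b', hb', hdb'⟩ := side_nbr (c := -c) hS hT hu hb (by linarith)
  obtain ⟨x, hx, hxm⟩ := sel_max (p := u) (q := dirp t c u) (A := (nb S T u).filter fun x => 0 < c * (ell t x - ell t u))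
    (by simp [oo_dirp]) ⟨a', by simp [mem_nb hP, ha', hda']⟩
  obtain ⟨y, hy, hym⟩ := sel_min (p := u) (q := dirp t (-c) u) (A := (nb S T u).filter fun x => c * (ell t x - ell t u) < 0)
    (by simp [oo_dirp]) ⟨b', by simp only [Finset.mem_filter, mem_nb hP]; exact ⟨hb', by linarith⟩⟩
  simp only [Finset.mem_filter, mem_nb hP, and_imp] at hx hy hxm hym
  obtain ⟨-, hxS, hux⟩ := hP.mem _ _ hx.1
  obtain ⟨-, hyS, huy⟩ := hP.mem _ _ hy.1
  have hsp : ∀ z, s(u,z) ∈ T → 0 < c * (ell t z - ell t u) ∨ c * (ell t z - ell t u) < 0 := by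
    intro z hz
    obtain ⟨-, hzS, huz⟩ := hP.mem _ _ hz
    have : c * (ell t z - ell t u) ≠ 0 := by
      apply mul_ne_zero hc0
      intro h
      exact huz (hinj hu hzS (by linarith))
    rcases lt_or_gt_of_ne this with h | h
    · exact Or.inr h
    · exact Or.inl h
  by_cases hpos : 0 < oo u x y
  · left
    refine ⟨x, y, hx.2, hy.2, hpos, hx.1, hy.1, ?_, ?_⟩
    all_goals
      first
      | refine W_edge hS hT hx.1 hy.1 hpos ?_
      | refine W_empty hS hT hx.1 hy.1 hpos ?_
      intro z hz h1 h2
      rcases hsp z hz with h | h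
      · have := hxm z hz h
        rw [oo_swap23] at this; linarith
      · have := hym z hz h
        rw [oo_swap23] at this; linarith
  · right
    push Not at hpos
    refine ⟨x, hx.2, hxS, hu, hux.symm, ?_⟩
    have hall : ∀ z, s(u,z) ∈ T → oo u x z ≤ 0 := by
      intro z hz
      rcases hsp z hz with h | h
      · have := hxm z hz h
        rw [oo_swap23] at this; linarith
      · have h1 := hym z hz h
        have e : (c * (ell t y - ell t u)) * oo u x z =
          (c * (ell t z - ell t u)) * oo u x y + (c * (ell t x - ell t u)) * oo u y z := by
          unfold ell oo; ring
        have : 0 ≤ (c * (ell t y - ell t u)) * oo u x z := by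
          rw [e]; nlinarith [mul_nonneg (neg_pos.2 h).le (neg_nonneg.2 hpos), mul_nonneg hx.2.le h1]
        by_contra hq
        push Not at hq
        nlinarith [mul_pos (neg_pos.2 hy.2) hq]
    intro z hz
    by_contra hn
    push Not at hn
    rw [oo_swap12] at hn
    obtain ⟨z', hz', h0⟩ := V_lem hS hT (q' := x) hu hz (by linarith)
    linarith [hall z' hz']

lemma hull_of_in {S : Finset Pt} (hS : GP S) {x u : Pt} (hx : x ∈ S) (h : Hout S x u) : hullV S u := by
  by_contra hn
  obtain ⟨z, hz, h0⟩ := nonhull_pt hS h.1 ⟨x, hx, h.2.1⟩ hn (q' := x) h.2.1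
  have := h.2.2 z hz
  rw [oo_swap12] at this; linarith

lemma Hin_unique {S : Finset Pt} (hS : GP S) {x x' u : Pt} (hx : x ∈ S) (hx' : x' ∈ S) (h : Hout S x u) (h' : Hout S x' u) : x = x' := by
  by_contra hne
  have h1 := h.2.2 x' hx'
  have h2 := h'.2.2 x hx
  have : oo x' u x = - oo x u x' := by unfold oo; ring
  exact hS x hx u h.1 x' hx' h.2.1 hne h'.2.1.symm (by linarith)

lemma hull_le_one {S : Finset Pt} {T : Finset (Sym2 Pt)} (hT : PlaneSet S T) {t : ℝ} (hinj : Set.InjOn (ell t) (S : Set Pt))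
    {u x y x' y' : Pt} (h : Good S T t 1 u x y) (h' : Good S T t (-1) u x' y') (hu : hullV S u) : False := by
  obtain ⟨w, hw, huw, hall⟩ := hu
  obtain ⟨huS, hx, hux⟩ := hT.mem _ _ h.ux
  obtain ⟨-, hy, huy⟩ := hT.mem _ _ h.uy
  obtain ⟨-, hx', hux'⟩ := hT.mem _ _ h'.ux
  obtain ⟨-, hy', huy'⟩ := hT.mem _ _ h'.uy
  have h1 := h.dx; have h2 := h.dy; have h3 := h'.dx; have h4 := h'.dy
  have hd : ell t w - ell t u ≠ 0 := fun h0 => huw (hinj huS hw (by linarith))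
  rcases lt_or_gt_of_ne hd with hd | hd
  · have := pl t u w x y
    have p1 := h.pos
    nlinarith [mul_pos (neg_pos.2 hd) p1, mul_nonneg (show 0 ≤ ell t x - ell t u by linarith) (hall y hy),
      mul_nonneg (show 0 ≤ -(ell t y - ell t u) by linarith) (hall x hx)]
  · have := pl t u w x' y'
    have p1 := h'.pos
    nlinarith [mul_pos hd p1, mul_nonneg (show 0 ≤ -(ell t x' - ell t u) by linarith) (hall y' hy'),
      mul_nonneg (show 0 ≤ (ell t y' - ell t u) by linarith) (hall x' hx')]

def Ep (S : Finset Pt) (T : Finset (Sym2 Pt)) (t : ℝ) : Finset (Pt × Pt) :=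
  (S ×ˢ S).filter fun e => s(e.1,e.2) ∈ T ∧ ell t e.1 < ell t e.2

def lowP (T : Finset (Sym2 Pt)) (t : ℝ) (e : Pt × Pt) : Prop :=
  ∃ x, s(e.1,x) ∈ T ∧ ell t e.1 < ell t x ∧ 0 < oo e.1 x e.2

lemma mem_Ep {S : Finset Pt} {T : Finset (Sym2 Pt)} (hT : PlaneSet S T) {t : ℝ} {v r : Pt} :
    (v, r) ∈ Ep S T t ↔ s(v,r) ∈ T ∧ ell t v < ell t r := by
  simp only [Ep, Finset.mem_filter, Finset.mem_product, and_iff_right_iff_imp]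
  rintro ⟨h, -⟩
  exact ⟨(hT.mem _ _ h).1, (hT.mem _ _ h).2.1⟩

lemma card_Ep {S : Finset Pt} {T : Finset (Sym2 Pt)} (hT : PlaneSet S T) {t : ℝ} (hinj : Set.InjOn (ell t) (S : Set Pt)) :
    (Ep S T t).card = T.card := by
  refine Finset.card_bij (fun e _ => s(e.1,e.2)) ?_ ?_ ?_
  · rintro ⟨v, r⟩ h; exact ((mem_Ep hT).1 h).1
  · rintro ⟨v, r⟩ h ⟨v', r'⟩ h' heq
    have h1 := ((mem_Ep hT).1 h).2
    have h2 := ((mem_Ep hT).1 h').2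
    rcases Sym2.eq_iff.1 heq with ⟨ha, hb⟩ | ⟨ha, hb⟩
    · exact Prod.ext ha hb
    · simp only at ha hb
      rw [ha, hb] at h1; linarith
  · intro e he
    induction e using Sym2.ind with
    | _ a b =>
      obtain ⟨ha, hb, hab⟩ := hT.mem _ _ he
      rcases lt_trichotomy (ell t a) (ell t b) with h | h | h
      · exact ⟨(a, b), (mem_Ep hT).2 ⟨he, h⟩, rfl⟩
      · exact absurd (hinj ha hb h) hab
      · exact ⟨(b, a), (mem_Ep hT).2 ⟨T_symm he, h⟩, Sym2.eq_swap⟩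

lemma card_low {S : Finset Pt} {T : Finset (Sym2 Pt)} (hS : GP S) (hT : Tri S T) {t : ℝ} (hinj : Set.InjOn (ell t) (S : Set Pt))
    (hne : S.Nonempty) : ((Ep S T t).filter fun e => ¬ lowP T t e).card + 1 = S.card := by
  have hP := hT.toPlaneSet
  obtain ⟨m, hm, hmax⟩ := Finset.exists_max_image S (ell t) hne
  rw [← Finset.card_erase_add_one hm]
  congr 1
  refine Finset.card_bij (fun e _ => e.1) ?_ ?_ ?_
  · rintro ⟨v, r⟩ h
    simp only [Finset.mem_filter, mem_Ep hP] at h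
    obtain ⟨hv, hr, -⟩ := hP.mem _ _ h.1.1
    refine Finset.mem_erase.2 ⟨?_, hv⟩
    rintro rfl
    have := hmax r hr
    linarith [h.1.2]
  · rintro ⟨v, r⟩ h ⟨v', r'⟩ h' heq
    simp only at heq
    subst heq
    simp only [Finset.mem_filter, mem_Ep hP] at h h'
    unfold lowP at h h'
    push Not at h h'
    obtain ⟨hv, hr, hvr⟩ := hP.mem _ _ h.1.1
    obtain ⟨-, hr', hvr'⟩ := hP.mem _ _ h'.1.1
    have h1 := h.2 r' h'.1.1 h'.1.2
    have h2 := h'.2 r h.1.1 h.1.2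
    rw [oo_swap23] at h1
    by_contra hne
    exact hS v hv r hr r' hr' hvr hvr' (fun h => hne (by rw [h])) (by linarith)
  · intro v hv
    obtain ⟨hvm, hv⟩ := Finset.mem_erase.1 hv
    have hlt : ell t v < ell t m := lt_of_le_of_ne (hmax v hv) (fun h => hvm (hinj hv hm h))
    obtain ⟨x, hx, hdx⟩ := side_nbr (c := 1) (t := t) hS hT hv hm (by linarith)
    obtain ⟨r, hr, hrm⟩ := sel_min (p := v) (q := dirp t 1 v) (A := (nb S T v).filter fun x => 0 < 1 * (ell t x - ell t v))
      (by simp [oo_dirp]) ⟨x, by simp only [Finset.mem_filter, mem_nb hP]; exact ⟨hx, hdx⟩⟩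
    simp only [Finset.mem_filter, mem_nb hP, and_imp] at hr hrm
    refine ⟨(v, r), ?_, rfl⟩
    simp only [Finset.mem_filter, mem_Ep hP]
    unfold lowP
    refine ⟨⟨hr.1, by linarith [hr.2]⟩, ?_⟩
    rintro ⟨y, hy, hdy, h0⟩
    have := hrm y hy (by linarith)
    rw [oo_swap23] at this; linarith

def TRs (S : Finset Pt) (T : Finset (Sym2 Pt)) (t : ℝ) : Finset (Pt × Pt × Pt) :=
  (S ×ˢ S ×ˢ S).filter fun e => ell t e.1 < ell t e.2.1 ∧ ell t e.1 < ell t e.2.2 ∧ 0 < oo e.1 e.2.1 e.2.2 ∧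
    s(e.1,e.2.1) ∈ T ∧ s(e.1,e.2.2) ∈ T ∧ s(e.2.1,e.2.2) ∈ T ∧ Empty3 S e.1 e.2.1 e.2.2

lemma mem_TRs {S : Finset Pt} {T : Finset (Sym2 Pt)} (hT : PlaneSet S T) {t : ℝ} {v q r : Pt} :
    (v, q, r) ∈ TRs S T t ↔ ell t v < ell t q ∧ ell t v < ell t r ∧ 0 < oo v q r ∧
    s(v,q) ∈ T ∧ s(v,r) ∈ T ∧ s(q,r) ∈ T ∧ Empty3 S v q r := by
  simp only [TRs, Finset.mem_filter, Finset.mem_product, and_iff_right_iff_imp]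
  rintro ⟨-, -, -, h1, h2, -⟩
  exact ⟨(hT.mem _ _ h1).1, (hT.mem _ _ h1).2.1, (hT.mem _ _ h2).2.1⟩

lemma card_TRs {S : Finset Pt} {T : Finset (Sym2 Pt)} (hS : GP S) (hT : Tri S T) {t : ℝ} :
    (TRs S T t).card = ((Ep S T t).filter fun e => lowP T t e).card := by
  have hP := hT.toPlaneSet
  refine Finset.card_bij (fun e _ => (e.1, e.2.2)) ?_ ?_ ?_
  · rintro ⟨v, q, r⟩ h
    rw [mem_TRs hP] at h
    simp only [Finset.mem_filter, mem_Ep hP]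
    unfold lowP
    exact ⟨⟨h.2.2.2.2.1, h.2.1⟩, q, h.2.2.2.1, h.1, h.2.2.1⟩
  · rintro ⟨v, q, r⟩ h ⟨v', q', r'⟩ h' heq
    simp only [Prod.mk.injEq] at heq
    obtain ⟨rfl, rfl⟩ := heq
    rw [mem_TRs hP] at h h'
    obtain ⟨h1, h2, h3, h4, h5, h6, h7⟩ := h
    obtain ⟨h1', h2', h3', h4', h5', h6', h7'⟩ := h'
    obtain ⟨hv, hq, hvq⟩ := hP.mem _ _ h4
    obtain ⟨-, hq', hvq'⟩ := hP.mem _ _ h4'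
    have : q = q' := by
      by_contra hne
      rcases lt_or_gt_of_ne (hS v hv q hq q' hq' hvq hvq' hne) with h | h
      · exact L_wedge hS hP h7' h6' h4 (by rw [oo_swap23]; linarith) h3 h3'
      · exact L_wedge hS hP h7 h6 h4' h h3' h3
    rw [this]
  · rintro ⟨v, r⟩ h
    simp only [Finset.mem_filter, mem_Ep hP] at h
    unfold lowP at h
    obtain ⟨⟨hvr, hl⟩, x, hx, hdx, h0⟩ := h
    obtain ⟨q, hq, hqm⟩ := sel_max (p := v) (q := dirp t 1 v) (A := (nb S T v).filter fun x => 0 < 1 * (ell t x - ell t v) ∧ 0 < oo v x r)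
      (by simp only [oo_dirp, Finset.mem_filter]; exact fun x h => h.2.1) ⟨x, by simp only [Finset.mem_filter, mem_nb hP]; exact ⟨hx, by linarith, h0⟩⟩
    simp only [Finset.mem_filter, mem_nb hP, and_imp] at hq hqm
    have hno : ∀ y, s(v,y) ∈ T → 0 < oo v q y → 0 < oo v y r → False := by
      intro y hy h1 h2
      by_cases hdy : 0 < 1 * (ell t y - ell t v)
      · have := hqm y hy hdy h2
        rw [oo_swap23] at this; linarith
      · have := pl t v y q r
        have e : (ell t y - ell t v) * oo v q r = (ell t q - ell t v) * oo v y r + (ell t r - ell t v) * oo v q y := by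
          unfold ell oo; ring
        nlinarith [mul_pos (show 0 < ell t q - ell t v by linarith [hq.2.1]) h2, mul_pos (show 0 < ell t r - ell t v by linarith) h1,
          mul_nonneg (show 0 ≤ -(ell t y - ell t v) by linarith) hq.2.2.le]
    refine ⟨(v, q, r), (mem_TRs hP).2 ⟨by linarith [hq.2.1], hl, hq.2.2, hq.1, hvr, W_edge hS hT hq.1 hvr hq.2.2 hno,
      W_empty hS hT hq.1 hvr hq.2.2 hno⟩, rfl⟩

/-- the middle vertex -/
def midF (t : ℝ) (e : Pt × Pt × Pt) : Pt × Bool := if ell t e.2.1 < ell t e.2.2 then (e.2.1, true) else (e.2.2, false)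

def sg (b : Bool) : ℝ := if b then 1 else -1

def GdS (S : Finset Pt) (T : Finset (Sym2 Pt)) (t : ℝ) : Finset (Pt × Bool) :=
  (S ×ˢ Finset.univ).filter fun e => ∃ x y, Good S T t (sg e.2) e.1 x y

lemma card_GdS {S : Finset Pt} {T : Finset (Sym2 Pt)} (hS : GP S) (hT : Tri S T) {t : ℝ} (hinj : Set.InjOn (ell t) (S : Set Pt)) :
    (TRs S T t).card = (GdS S T t).card := by
  have hP := hT.toPlaneSet
  have g1 : ∀ v q r, (v,q,r) ∈ TRs S T t → ell t q < ell t r → Good S T t 1 q r v := by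
    intro v q r h hl
    obtain ⟨h1, h2, h3, h4, h5, h6, h7⟩ := (mem_TRs hP).1 h
    exact ⟨by linarith, by linarith, by rwa [oo_rot v q r], h6, T_symm h4, T_symm h5, h7.rot⟩
  have g2 : ∀ v q r, (v,q,r) ∈ TRs S T t → ¬ ell t q < ell t r → Good S T t (-1) r v q := by
    intro v q r h hl
    obtain ⟨h1, h2, h3, h4, h5, h6, h7⟩ := (mem_TRs hP).1 h
    obtain ⟨hq, hr, hqr⟩ := hP.mem _ _ h6
    have : ell t r < ell t q := lt_of_le_of_ne (not_lt.1 hl) (fun h => hqr (hinj hr hq h).symm)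
    exact ⟨by linarith, by linarith, by rwa [oo_rot' v q r], T_symm h5, T_symm h6, h4, h7.rot.rot⟩
  refine Finset.card_bij (fun e _ => midF t e) ?_ ?_ ?_
  · rintro ⟨v, q, r⟩ h
    obtain ⟨h1, h2, h3, h4, h5, h6, h7⟩ := (mem_TRs hP).1 h
    obtain ⟨hq, hr, hqr⟩ := hP.mem _ _ h6
    unfold midF GdS
    by_cases hl : ell t q < ell t r
    · simp only [hl, if_true, Finset.mem_filter, Finset.mem_product, hq, Finset.mem_univ, and_self, true_and]
      exact ⟨_, _, by simpa [sg] using g1 v q r h hl⟩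
    · simp only [hl, if_false, Finset.mem_filter, Finset.mem_product, hr, Finset.mem_univ, and_self, true_and]
      exact ⟨_, _, by simpa [sg] using g2 v q r h hl⟩
  · rintro ⟨v, q, r⟩ h ⟨v', q', r'⟩ h' heq
    unfold midF at heq
    by_cases hl : ell t q < ell t r <;> by_cases hl' : ell t q' < ell t r' <;> simp [hl, hl'] at heq
    · have k1 := g1 v q r h hl
      have k2 := g1 v' q' r' h' hl'
      rw [← heq] at k2
      obtain ⟨e1, e2⟩ := Good_unique hS hP k1 k2
      rw [e1, e2, heq]
    · have k1 := g2 v q r h hl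
      have k2 := g2 v' q' r' h' hl'
      rw [← heq] at k2
      obtain ⟨e1, e2⟩ := Good_unique hS hP k1 k2
      rw [e1, e2, heq]
  · rintro ⟨u, b⟩ h
    simp only [GdS, Finset.mem_filter] at h
    obtain ⟨-, x, y, hg⟩ := h
    cases b
    · simp only [sg] at hg
      have d1 := hg.dx; have d2 := hg.dy
      simp at d1 d2
      refine ⟨(x, y, u), (mem_TRs hP).2 ⟨by linarith, by linarith, by rw [oo_rot u x y]; exact hg.pos, hg.xy, T_symm hg.ux, T_symm hg.uy, hg.emp.rot⟩, ?_⟩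
      unfold midF
      simp; linarith
    · simp only [sg] at hg
      have d1 := hg.dx; have d2 := hg.dy
      simp at d1 d2
      refine ⟨(y, u, x), (mem_TRs hP).2 ⟨by linarith, by linarith, by rw [oo_rot' u x y]; exact hg.pos, T_symm hg.uy, T_symm hg.xy, hg.ux, hg.emp.rot.rot⟩, ?_⟩
      unfold midF
      simp [d1]

def Hl (S : Finset Pt) : Finset Pt := S.filter fun p => hullV S p

lemma edge_count {S : Finset Pt} {T : Finset (Sym2 Pt)} (hS : GP S) (hT : Tri S T) (h2 : 2 ≤ S.card) :
    T.card + (Hl S).card ≤ 3 * S.card ∧ 3 * S.card ≤ T.card + (Hl S).card + 3 := by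
  obtain ⟨t, hinj⟩ := exists_shear S
  have hP := hT.toPlaneSet
  have hne : S.Nonempty := Finset.card_pos.1 (by omega)
  have c1 := card_Ep hP hinj
  have c2 := card_low hS hT hinj hne
  have c3 := card_TRs hS hT (t := t)
  have c4 := card_GdS hS hT hinj
  have c5 : ((Ep S T t).filter fun e => lowP T t e).card + ((Ep S T t).filter fun e => ¬ lowP T t e).card = (Ep S T t).card := Finset.card_filter_add_card_filter_not (s := Ep S T t) (lowP T t)
  -- fiber count
  obtain ⟨mx, hmx, hmax⟩ := Finset.exists_max_image S (ell t) hne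
  obtain ⟨mn, hmn, hmin⟩ := Finset.exists_min_image S (ell t) hne
  have hfib : (GdS S T t).card = ∑ u ∈ S, ((GdS S T t).filter fun e => e.1 = u).card := by
    refine Finset.card_eq_sum_card_fiberwise (f := Prod.fst) ?_
    intro e he
    simp only [GdS, Finset.coe_filter, Finset.mem_product, Set.mem_ofPred_eq] at he
    exact he.1.1
  have hcnt : ∀ u ∈ S, ((GdS S T t).filter fun e => e.1 = u).card =
      (if ∃ x y, Good S T t 1 u x y then 1 else 0) + (if ∃ x y, Good S T t (-1) u x y then 1 else 0) := by
    intro u hu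
    have : (GdS S T t).filter (fun e => e.1 = u) =
      (Finset.univ.filter fun b : Bool => ∃ x y, Good S T t (sg b) u x y).image (fun b => (u, b)) := by
      ext ⟨v, b⟩
      simp only [GdS, Finset.mem_filter, Finset.mem_product, Finset.mem_univ, and_true, true_and, Finset.mem_image, Prod.mk.injEq]
      constructor
      · rintro ⟨⟨-, h⟩, rfl⟩; exact ⟨b, h, rfl, rfl⟩
      · rintro ⟨b', h, rfl, rfl⟩; exact ⟨⟨hu, h⟩, rfl⟩
    rw [this, Finset.card_image_of_injective _ (fun a b h => by simpa using h), Finset.card_filter, Fintype.sum_bool]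
    simp only [sg, if_true, Bool.false_eq_true, if_false]
  have hup : ∀ u ∈ S, ((GdS S T t).filter fun e => e.1 = u).card + (if hullV S u then 1 else 0) ≤ 2 := by
    intro u hu
    rw [hcnt u hu]
    by_cases h1 : ∃ x y, Good S T t 1 u x y <;> by_cases h2 : ∃ x y, Good S T t (-1) u x y <;> by_cases h3 : hullV S u <;>
      simp only [if_pos, if_neg, h1, h2, h3, not_false_eq_true] <;> try omega
    exfalso
    obtain ⟨x, y, h⟩ := h1
    obtain ⟨x', y', h'⟩ := h2
    exact hull_le_one hP hinj h h' h3
  have hlo : ∀ u ∈ S, 2 ≤ ((GdS S T t).filter fun e => e.1 = u).card + (if hullV S u then 1 else 0) +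
      (if u = mx then 1 else 0) + (if u = mn then 1 else 0) := by
    intro u hu
    rw [hcnt u hu]
    by_cases hm : u = mx ∨ u = mn
    · have hh : hullV S u := by
        by_contra hn
        have hot : ∃ a ∈ S, a ≠ u := by
          obtain ⟨a, ha, b, hb, hab⟩ := Finset.one_lt_card.1 h2
          by_cases h : a = u
          · exact ⟨b, hb, fun h' => hab (h.trans h'.symm)⟩
          · exact ⟨a, ha, h⟩
        rcases hm with rfl | rfl
        · obtain ⟨x, hx, h0⟩ := nonhull_pt hS hu hot hn (q' := dirp t 1 u) (by
            intro h; have := congrArg Prod.snd h; simp [dirp] at this)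
          rw [oo_dirp] at h0
          linarith [hmax x hx]
        · obtain ⟨x, hx, h0⟩ := nonhull_pt hS hu hot hn (q' := dirp t (-1) u) (by
            intro h; have := congrArg Prod.snd h; simp [dirp] at this)
          rw [oo_dirp] at h0
          linarith [hmin x hx]
      rw [if_pos hh]; rcases hm with h | h <;> rw [if_pos h] <;> omega
    · push Not at hm
      have l1 : ell t u < ell t mx := lt_of_le_of_ne (hmax u hu) (fun h => hm.1 (hinj hu hmx h))
      have l2 : ell t mn < ell t u := lt_of_le_of_ne (hmin u hu) (fun h => hm.2 (hinj hmn hu h).symm)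
      have o1 := Good_or (t := t) (c := 1) hS hT hinj one_ne_zero hu hmx hmn (by linarith) (by linarith)
      have o2 := Good_or (t := t) (c := -1) hS hT hinj (by norm_num) hu hmn hmx (by linarith) (by linarith)
      rcases o1 with o1 | ⟨x, hx, hxS, hxo⟩ <;> rcases o2 with o2 | ⟨x', hx', hxS', hxo'⟩
      · simp only [o1, o2, if_true]; omega
      · simp only [o1, if_true, hull_of_in hS hxS' hxo']; omega
      · simp only [o2, if_true, hull_of_in hS hxS hxo]; omega
      · exfalso
        have := Hin_unique hS hxS hxS' hxo hxo'
        subst this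
        linarith
  have s1 := Finset.sum_le_sum hup
  have s2 := Finset.sum_le_sum hlo
  have hH : ∑ u ∈ S, (if hullV S u then 1 else 0) = (Hl S).card := by rw [Hl, Finset.card_filter]
  simp only [Finset.sum_add_distrib, hH, ← hfib, Finset.sum_const, smul_eq_mul, Finset.sum_ite_eq', hmx, hmn, if_true] at s1 s2
  constructor <;> omega

structure Vld (S : Finset Pt) (D : Finset (Sym2 Pt)) : Prop where
  hull : ∀ p ∈ S, ∀ q, Hout S p q → s(p,q) ∈ D
  span : ∀ p ∈ S, ¬ hullV S p → Spans D p

lemma Vld.mono {S : Finset Pt} {D D' : Finset (Sym2 Pt)} (h : Vld S D) (hs : D ⊆ D') : Vld S D' :=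
  ⟨fun p hp q hq => hs (h.hull p hp q hq), fun p hp hn q' hq' => by
    obtain ⟨x, hx, h0⟩ := h.span p hp hn q' hq'
    exact ⟨x, hs hx, h0⟩⟩

lemma pluck (p q r x s : Pt) : oo p q r * oo p x s = oo p q x * oo p r s - oo p q s * oo p r x := by
  unfold oo; ring

lemma flip_angle {S : Finset Pt} {T D : Finset (Sym2 Pt)} (hS : GP S) (hT : PlaneSet S T) (hD : Vld S D) (hDT : D ⊆ T)
    {p q r s : Pt} (hpq : s(p,q) ∈ T) (hpqD : s(p,q) ∉ D) (hr : 0 < oo p q r) (hs : 0 < oo p s q)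
    (er : Empty3 S p q r) (es : Empty3 S p s q) (hqr : s(q,r) ∈ T) (hsq : s(s,q) ∈ T) : 0 < oo p s r := by
  obtain ⟨hp, hq, hpq'⟩ := hT.mem _ _ hpq
  obtain ⟨-, hrS, -⟩ := hT.mem _ _ hqr
  obtain ⟨hsS, -, -⟩ := hT.mem _ _ hsq
  have hs' : oo p q s < 0 := by rw [oo_swap23]; linarith
  by_contra hn
  push Not at hn
  have hrs : 0 ≤ oo p r s := by rw [oo_swap23]; linarith
  have hall : ∀ x, s(p,x) ∈ D → 0 ≤ oo p x s := by
    intro x hx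
    obtain ⟨-, hxS, hpx⟩ := hT.mem _ _ (hDT hx)
    have hqx : oo p q x ≠ 0 := by
      apply hS p hp q hq x hxS hpq' hpx
      rintro rfl; exact hpqD hx
    rcases lt_or_gt_of_ne hqx with h | h
    · by_contra h0
      push Not at h0
      exact L_wedge hS hT es hsq (hDT hx) (by rw [oo_swap23]; linarith) (by rw [oo_swap23]; linarith) hs
    · have h1 : 0 ≤ oo p r x := by
        by_contra h0
        push Not at h0
        exact L_wedge hS hT er hqr (hDT hx) h (by rw [oo_swap23]; linarith) hr
      have := pluck p q r x s
      have h2 : 0 ≤ oo p q r * oo p x s := by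
        rw [this]; nlinarith [mul_nonneg h.le hrs, mul_nonneg (neg_pos.2 hs').le h1]
      exact nonneg_of_mul_nonneg_right h2 hr
  have hsp : s ≠ p := by rintro rfl; rw [oo_self12] at hs; linarith
  by_cases hh : hullV S p
  · obtain ⟨w, hw⟩ := hh
    -- all z have oo p w z ≥ 0, w is a D-neighbour
    have hwD := hD.hull p hp w hw
    -- in-neighbour
    have hin : ∃ v ∈ S, Hout S v p := by
      obtain ⟨v, hv, hvm⟩ := sel_max (p := p) (q := w) (A := S.filter fun x => 0 < oo p w x) (by simp)
        ⟨q, by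
          simp only [Finset.mem_filter, hq, true_and]
          refine lt_of_le_of_ne (hw.2.2 q hq) (Ne.symm ?_)
          apply hS p hp w hw.1 q hq hw.2.1 hpq'
          rintro rfl; exact hpqD hwD⟩
      simp only [Finset.mem_filter, and_imp] at hv hvm
      refine ⟨v, hv.1, hp, ?_, ?_⟩
      · rintro rfl; rw [oo_self13] at hv; linarith [hv.2]
      · intro x hx
        have e : oo v p x = oo p x v := by unfold oo; ring
        rw [e]
        rcases lt_or_eq_of_le (hw.2.2 x hx) with h | h
        · exact hvm x hx h
        · rcases hS.eq_or hp hw.1 hx hw.2.1 h.symm with rfl | rfl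
          · rw [oo_self12]
          · exact hv.2.le
    obtain ⟨v, hv, hvo⟩ := hin
    have hvD := hD.hull v hv p hvo
    have h1 := hall v (T_symm hvD)
    have h2 := hvo.2.2 s hsS
    rw [oo_swap12] at h2
    have h3 : oo p v s = 0 := by linarith
    rcases hS.eq_or hp hv hsS hvo.2.1.symm h3 with h | h
    · exact hsp h
    · have h4 := hvo.2.2 q hq
      rw [← h] at h4
      have : oo s p q = oo p q s := by unfold oo; ring
      linarith
  · obtain ⟨x, hx, h0⟩ := hD.span p hp hh s hsp
    have := hall x hx
    rw [oo_swap23] at this; linarith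

lemma enter {S : Finset Pt} (hS : GP S) {p q r a b : Pt} (hp : p ∈ S) (hq : q ∈ S) (hr : r ∈ S) (ha : a ∈ S) (hb : b ∈ S)
    (hΔ : 0 < oo p q r) (he : Empty3 S p q r) (hX : XX a b q r) (ha0 : 0 < oo q r a)
    (h1 : ¬ XX a b p q) (h3 : ¬ XX a b r p) : a = p := by
  obtain ⟨t, s, t0, t1, s0, s1, hw⟩ := XX_point hX
  have a1 : oo p q (a + t • (b - a)) = s * oo p q r := by rw [hw, oo_comb, oo_self23]; ring
  have a2 : oo q r (a + t • (b - a)) = 0 := by rw [hw, oo_comb, oo_self23, oo_self13]; ring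
  have a3 : oo r p (a + t • (b - a)) = (1 - s) * oo p q r := by rw [hw, oo_comb, oo_self13, oo_rot' p q r]; ring
  obtain ⟨ε, ε0, ε1, k1, k3⟩ := eps_lem (mul_pos s0 hΔ) (mul_pos (sub_pos.2 s1) hΔ) (oo p q a) (oo r p a)
  have hw' : a + ((1 - ε) * t) • (b - a) = (a + t • (b - a)) + ε • (a - (a + t • (b - a))) := by
    refine Prod.ext ?_ ?_ <;> simp <;> ring
  have hne := XX_ne hX
  have hin : InTri p q r (a + ((1 - ε) * t) • (b - a)) := by
    rw [hw']
    refine ⟨?_, ?_, ?_⟩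
    · rw [oo_comb, a1]; exact k1
    · rw [oo_comb, a2]; have := mul_pos ε0 ha0; linarith
    · rw [oo_comb, a3]; exact k3
  rcases EL hS hp hq hr ha hb (mul_pos (sub_pos.2 ε1) t0) (mul_lt_one_of_nonneg_of_lt_one_left (by linarith) (by linarith) t1.le) hin with h | h | h | h
  · rcases closed_empty hS hp hq hr ha hΔ he h.1 h.2.1 h.2.2 with rfl | rfl | rfl
    · rfl
    · exact absurd rfl hne.2.2.1
    · exact absurd rfl hne.2.2.2.1
  · exact absurd h.2 h1
  · linarith
  · exact absurd h.2 h3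

lemma flip_ex {S : Finset Pt} {T D : Finset (Sym2 Pt)} (hS : GP S) (hT : Tri S T) (hD : Vld S D) (hDT : D ⊆ T)
    {p q : Pt} (hpq : s(p,q) ∈ T) (hpqD : s(p,q) ∉ D) :
    ∃ r s, XX p q r s ∧ Tri S (insert s(r,s) (T.erase s(p,q))) := by
  have hP := hT.toPlaneSet
  obtain ⟨hp, hq, hpq'⟩ := hP.mem _ _ hpq
  have ex1 : ∃ z ∈ S, 0 < oo p q z := by
    by_contra hn
    push Not at hn
    refine hpqD (T_symm (hD.hull q hq p ⟨hp, hpq'.symm, fun x hx => ?_⟩))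
    rw [oo_swap12]; linarith [hn x hx]
  have ex2 : ∃ z ∈ S, oo p q z < 0 := by
    by_contra hn
    push Not at hn
    exact hpqD (hD.hull p hp q ⟨hq, hpq', hn⟩)
  obtain ⟨q'', hq''⟩ : ∃ q'' : Pt, q'' = p + (-1 : ℝ) • (q - p) := ⟨_, rfl⟩
  have ho : ∀ x, oo p q'' x = - oo p q x := by intro x; rw [hq'']; unfold oo; simp; ring
  obtain ⟨z1, hz1, hz1'⟩ := ex1
  obtain ⟨z2, hz2, hz2'⟩ := ex2
  obtain ⟨x1, hx1, hx1'⟩ := V_lem hS hT hp hz1 hz1'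
  obtain ⟨x2, hx2, hx2'⟩ := V_lem hS hT (q' := q'') hp hz2 (by rw [ho]; linarith)
  obtain ⟨r, hr, hrm⟩ := sel_min (p := p) (q := q) (A := (nb S T p).filter fun x => 0 < oo p q x) (by simp)
    ⟨x1, by simp [mem_nb hP, hx1, hx1']⟩
  obtain ⟨s, hs, hsm⟩ := sel_max (p := p) (q := q'') (A := (nb S T p).filter fun x => 0 < oo p q'' x) (by simp)
    ⟨x2, by simp [mem_nb hP, hx2, hx2']⟩
  simp only [Finset.mem_filter, mem_nb hP, and_imp, ho] at hr hs hrm hsm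
  have nor : ∀ x, s(p,x) ∈ T → 0 < oo p q x → 0 < oo p x r → False := by
    intro x hx h1 h2
    have := hrm x hx h1
    rw [oo_swap23] at this; linarith
  have nos : ∀ x, s(p,x) ∈ T → 0 < oo p s x → 0 < oo p x q → False := by
    intro x hx h1 h2
    rw [oo_swap23] at h1 h2
    have := hsm x hx h2
    linarith
  have hsq : 0 < oo p s q := by rw [oo_swap23]; exact hs.2
  have er := W_empty hS hT hpq hr.1 hr.2 nor
  have es := W_empty hS hT hs.1 hpq hsq nos
  have tqr := W_edge hS hT hpq hr.1 hr.2 nor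
  have tsq := W_edge hS hT hs.1 hpq hsq nos
  have ang1 := flip_angle hS hP hD hDT hpq hpqD hr.2 hsq er es tqr tsq
  have ang2 := flip_angle hS hP hD hDT (p := q) (q := p) (r := s) (s := r) (T_symm hpq) (fun h => hpqD (T_symm h))
    (by rw [← oo_rot' p s q] at hsq; exact hsq) (by rw [oo_rot p q r]; exact hr.2) es.rot.rot er.rot hs.1 (T_symm hr.1)
  obtain ⟨-, hrS, hpr⟩ := hP.mem _ _ hr.1
  obtain ⟨-, hsS, hps⟩ := hP.mem _ _ hs.1
  have k1 : oo r s p = - oo p s r := by unfold oo; ring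
  have k2 : oo r s q = oo q r s := by unfold oo; ring
  have hXX : XX p q r s := by
    refine ⟨by nlinarith [hr.2, hs.2], ?_⟩
    rw [k1, k2]; nlinarith
  have hrs : r ≠ s := (XX_ne hXX).2.1
  refine ⟨r, s, hXX, ?_, ?_⟩
  · refine PlaneSet_insert (PlaneSet_subset hP (Finset.erase_subset _ _)) hrS hsS hrs ?_
    intro c d hcd hX
    obtain ⟨hne, hcd⟩ := Finset.mem_erase.1 hcd
    obtain ⟨hc, hd, hcd'⟩ := hP.mem _ _ hcd
    obtain ⟨t, σ, t0, t1, σ0, σ1, hw⟩ := XX_point hX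
    rcases lt_trichotomy (oo p q (c + t • (d - c))) 0 with h | h | h
    · refine L_tri hS hP es hs.1 tsq (T_symm hpq) hcd t0 t1 ⟨?_, ?_, by rw [oo_swap12]; linarith⟩
      · rw [hw, oo_comb, oo_self23]; have := mul_pos (sub_pos.2 σ1) ang1; linarith
      · rw [hw, oo_comb, oo_self13]
        have e : oo s q r = oo q r s := by unfold oo; ring
        rw [e]; have := mul_pos (sub_pos.2 σ1) ang2; linarith
    · obtain ⟨τ, σ', τ0, τ1, σ0', σ1', hw2⟩ := XX_point hXX
      have e1 : oo p q (r + σ' • (s - r)) = 0 := by rw [← hw2, oo_comb, oo_self13, oo_self23]; ring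
      have e2 : σ' = σ := by
        rw [hw, oo_comb] at h
        rw [oo_comb] at e1
        have : (σ' - σ) * (oo p q r - oo p q s) = 0 := by linarith
        rcases mul_eq_zero.1 this with h | h
        · linarith
        · linarith [hr.2, hs.2]
      rw [e2] at hw2
      exact hP.plane _ _ _ _ hpq hcd (XX_of_pt hS hp hq hc hd hpq' hcd' (Ne.symm hne) τ0 τ1 t0.le t1.le (by rw [hw2, hw]))
    · refine L_tri hS hP er hpq tqr (T_symm hr.1) hcd t0 t1 ⟨h, ?_, ?_⟩
      · rw [hw, oo_comb, oo_self23]; have := mul_pos σ0 ang2; linarith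
      · rw [hw, oo_comb, oo_self13]
        have e : oo r p s = oo p s r := by unfold oo; ring
        rw [e]; have := mul_pos σ0 ang1; linarith
  · intro a ha b hb hab hun
    have hunT : ∀ c d, s(c,d) ∈ T → s(c,d) ≠ s(p,q) → ¬ XX a b c d := fun c d h hne hX =>
      hun c d (Finset.mem_insert_of_mem (Finset.mem_erase.2 ⟨hne, h⟩)) (XX_symm.1 hX)
    by_cases hX : XX a b p q
    · have main : ∀ a b : Pt, a ∈ S → b ∈ S → XX a b p q → (∀ c d, s(c,d) ∈ T → s(c,d) ≠ s(p,q) → ¬ XX a b c d) →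
          0 < oo p q a → a = r ∧ b = s := by
        intro a b ha hb hX hunT ha0
        have hqr : q ≠ r := (XX_ne hXX).2.2.2.2.1
        have hqs : q ≠ s := (XX_ne hXX).2.2.2.2.2
        constructor
        · refine enter hS (p := r) (q := p) (r := q) hrS hp hq ha hb (by rw [oo_rot']; exact hr.2) er.rot.rot hX ha0 ?_ ?_
          · exact hunT r p (T_symm hr.1) (by simp [hqr.symm, hpq', hpr.symm])
          · exact hunT q r tqr (by simp [hqr.symm, hpq'.symm, hpr.symm])
        · have hb0 : oo p q b < 0 := by
            have := hX.2
            by_contra h; push Not at h; nlinarith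
          refine enter hS (p := s) (q := q) (r := p) hsS hq hp hb ha (by rw [oo_rot p s q]; exact hsq) es.rot ?_ ?_ ?_ ?_
          · exact XX_swap1.2 (XX_swap2.2 hX)
          · rw [oo_swap12]; linarith
          · exact fun h => hunT s q tsq (by simp [hqs.symm, hpq'.symm, hps.symm]) (XX_swap1.2 h)
          · exact fun h => hunT p s hs.1 (by simp [hqs.symm, hpq', hps.symm]) (XX_swap1.2 h)
      rcases mul_neg_iff.1 hX.2 with h | h
      · obtain ⟨rfl, rfl⟩ := main a b ha hb hX hunT h.1
        exact Finset.mem_insert_self _ _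
      · obtain ⟨rfl, rfl⟩ := main b a hb ha (XX_swap1.2 hX) (fun c d h1 h2 h3 => hunT c d h1 h2 (XX_swap1.2 h3)) h.2
        rw [Sym2.eq_swap]; exact Finset.mem_insert_self _ _
    · have habT : s(a,b) ∈ T := by
        refine hT.max a ha b hb hab fun c d hcd hX' => ?_
        by_cases hne : s(c,d) = s(p,q)
        · apply hX
          rcases Sym2.eq_iff.1 hne with ⟨rfl, rfl⟩ | ⟨rfl, rfl⟩
          · exact XX_symm.1 hX'
          · exact XX_swap2.1 (XX_symm.1 hX')
        · exact hunT c d hcd hne (XX_symm.1 hX')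
      refine Finset.mem_insert_of_mem (Finset.mem_erase.2 ⟨?_, habT⟩)
      intro hne
      apply hun r s (Finset.mem_insert_self _ _)
      rcases Sym2.eq_iff.1 hne with ⟨rfl, rfl⟩ | ⟨rfl, rfl⟩
      · exact XX_symm.1 hXX
      · exact XX_symm.1 (XX_swap1.1 hXX)

def SP (S : Finset Pt) (D : Finset (Sym2 Pt)) : Finset (Finset (Sym2 Pt)) := (TT S).filter fun T => D ⊆ T

lemma supp_ge {S : Finset Pt} (hS : GP S) : ∀ (n : ℕ) (T D : Finset (Sym2 Pt)), Tri S T → Vld S D → D ⊆ T →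
    (T \ D).card = n → 2 ^ n ≤ (SP S D).card := by
  intro n
  induction n with
  | zero =>
    intro T D hT hD hDT hc
    rw [pow_zero, Nat.one_le_iff_ne_zero, ← Nat.pos_iff_ne_zero, Finset.card_pos]
    exact ⟨T, by simp [SP, mem_TT, hT, hDT]⟩
  | succ n ih =>
    intro T D hT hD hDT hc
    have : (T \ D).Nonempty := Finset.card_pos.1 (by omega)
    obtain ⟨e, he⟩ := this
    induction e using Sym2.ind with
    | _ p q =>
    obtain ⟨heT, heD⟩ := Finset.mem_sdiff.1 he
    obtain ⟨r, s, hX, hT'⟩ := flip_ex hS hT hD hDT heT heD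
    have hrsT : s(r,s) ∉ T := fun h => hT.plane _ _ _ _ heT h hX
    have h1 := ih T (insert s(p,q) D) hT (hD.mono (Finset.subset_insert _ _)) (by
      intro x hx; rcases Finset.mem_insert.1 hx with rfl | h
      · exact heT
      · exact hDT h) (by
      rw [Finset.sdiff_insert, Finset.card_erase_of_mem he, hc]; rfl)
    have h2 := ih _ (insert s(r,s) D) hT' (hD.mono (Finset.subset_insert _ _)) (by
      intro x hx; rcases Finset.mem_insert.1 hx with rfl | h
      · exact Finset.mem_insert_self _ _
      · refine Finset.mem_insert_of_mem (Finset.mem_erase.2 ⟨?_, hDT h⟩)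
        rintro rfl; exact heD h) (by
      have : insert s(r,s) (T.erase s(p,q)) \ insert s(r,s) D = (T \ D).erase s(p,q) := by
        ext x
        simp only [Finset.mem_sdiff, Finset.mem_insert, Finset.mem_erase]
        constructor
        · rintro ⟨h1 | h1, h2⟩
          · exact absurd (Or.inl h1) h2
          · exact ⟨h1.1, h1.2, fun h => h2 (Or.inr h)⟩
        · rintro ⟨h1, h2, h3⟩
          refine ⟨Or.inr ⟨h1, h2⟩, ?_⟩
          rintro (rfl | h)
          · exact hrsT h2
          · exact h3 h
      rw [this, Finset.card_erase_of_mem he, hc]; rfl)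
    have hdisj : Disjoint (SP S (insert s(p,q) D)) (SP S (insert s(r,s) D)) := by
      rw [Finset.disjoint_left]
      intro U hU hU'
      simp only [SP, Finset.mem_filter, mem_TT] at hU hU'
      exact hU.1.plane _ _ _ _ (hU.2 (Finset.mem_insert_self _ _)) (hU'.2 (Finset.mem_insert_self _ _)) hX
    have hsub : SP S (insert s(p,q) D) ∪ SP S (insert s(r,s) D) ⊆ SP S D := by
      intro U hU
      simp only [SP, Finset.mem_union, Finset.mem_filter] at hU ⊢
      rcases hU with h | h
      · exact ⟨h.1, (Finset.subset_insert _ _).trans h.2⟩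
      · exact ⟨h.1, (Finset.subset_insert _ _).trans h.2⟩
    have := Finset.card_le_card hsub
    rw [Finset.card_union_of_disjoint hdisj] at this
    rw [pow_succ]; omega

/-- positive triple around `p` -/
def PT (p a b c : Pt) : Prop := 0 < oo p a b ∧ 0 < oo p b c ∧ 0 < oo p c a

/-- unordered valid triple around `p` -/
def Vt (p a b c : Pt) : Prop := PT p a b c ∨ PT p a c b

lemma PT.rot {p a b c : Pt} (h : PT p a b c) : PT p b c a := ⟨h.2.1, h.2.2, h.1⟩

lemma PT_span {D : Finset (Sym2 Pt)} {p a b c : Pt} (h : PT p a b c) (ha : s(p,a) ∈ D) (hb : s(p,b) ∈ D)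
    (hc : s(p,c) ∈ D) : Spans D p := by
  intro q' hq'
  by_contra hno
  push Not at hno
  have h1 := hno a ha
  have h2 := hno b hb
  have h3 := hno c hc
  obtain ⟨k1, k2, k3⟩ := h
  have hid : oo p b c * oo p q' a + oo p c a * oo p q' b + oo p a b * oo p q' c = 0 := by
    unfold oo; ring
  have z1 : oo p q' a = 0 := by nlinarith [mul_nonneg k2.le (neg_nonneg.2 h1), mul_nonneg k3.le (neg_nonneg.2 h2), mul_nonneg k1.le (neg_nonneg.2 h3)]
  have z2 : oo p q' b = 0 := by nlinarith [mul_nonneg k2.le (neg_nonneg.2 h1), mul_nonneg k3.le (neg_nonneg.2 h2), mul_nonneg k1.le (neg_nonneg.2 h3)]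
  have e1 : oo p a b * (q'.1 - p.1) = 0 := by
    have : oo p a b * (q'.1 - p.1) = (a.1-p.1) * oo p q' b - (b.1-p.1) * oo p q' a := by unfold oo; ring
    rw [this, z1, z2]; ring
  have e2 : oo p a b * (q'.2 - p.2) = 0 := by
    have : oo p a b * (q'.2 - p.2) = (a.2-p.2) * oo p q' b - (b.2-p.2) * oo p q' a := by unfold oo; ring
    rw [this, z1, z2]; ring
  apply hq'
  have f1 := (mul_eq_zero.1 e1).resolve_left k1.ne'
  have f2 := (mul_eq_zero.1 e2).resolve_left k1.ne'
  exact Prod.ext (by linarith) (by linarith)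

lemma Vt_span {D : Finset (Sym2 Pt)} {p a b c : Pt} (h : Vt p a b c) (ha : s(p,a) ∈ D) (hb : s(p,b) ∈ D)
    (hc : s(p,c) ∈ D) : Spans D p := by
  rcases h with h | h
  · exact PT_span h ha hb hc
  · exact PT_span h ha hc hb

lemma ex_PT {S : Finset Pt} {T : Finset (Sym2 Pt)} (hS : GP S) (hT : PlaneSet S T) {p a : Pt}
    (hsp : Spans T p) (ha : s(p,a) ∈ T) : ∃ e y, s(p,e) ∈ T ∧ s(p,y) ∈ T ∧ PT p a e y := by
  obtain ⟨hp, haS, hpa⟩ := hT.mem _ _ ha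
  obtain ⟨x, hx, hx0⟩ := hsp a hpa.symm
  let A := (nb S T p).filter fun x => 0 < oo p a x
  obtain ⟨e, he, hmax⟩ := sel_max (p := p) (q := a) (A := A) (fun x hx => (Finset.mem_filter.1 hx).2)
    ⟨x, Finset.mem_filter.2 ⟨(mem_nb hT).2 hx, hx0⟩⟩
  obtain ⟨he1, he2⟩ := Finset.mem_filter.1 he
  rw [mem_nb hT] at he1
  obtain ⟨_, heS, hpe⟩ := hT.mem _ _ he1
  obtain ⟨y, hy, hy0⟩ := hsp e hpe.symm
  obtain ⟨_, hyS, hpy⟩ := hT.mem _ _ hy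
  refine ⟨e, y, he1, hy, he2, hy0, ?_⟩
  have hay : a ≠ y := by
    rintro rfl; rw [oo_swap23] at hy0; linarith
  rcases lt_trichotomy (oo p a y) 0 with h | h | h
  · rw [oo_swap23]; linarith
  · exact absurd h (hS p hp a haS y hyS hpa hpy hay)
  · have := hmax y (Finset.mem_filter.2 ⟨(mem_nb hT).2 hy, h⟩)
    rw [oo_swap23] at this; linarith

/-- flexible pair -/
def Flex (T : Finset (Sym2 Pt)) (p a : Pt) : Prop :=
  s(p,a) ∈ T ∧ ∃ e y y', s(p,e) ∈ T ∧ s(p,y) ∈ T ∧ s(p,y') ∈ T ∧ y ≠ y' ∧ Vt p a e y ∧ Vt p a e y'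

lemma flex_cone {T : Finset (Sym2 Pt)} {p a b c d : Pt} (h : PT p a b c) (ha : s(p,a) ∈ T) (hb : s(p,b) ∈ T)
    (hc : s(p,c) ∈ T) (hd : s(p,d) ∈ T) (h1 : 0 < oo p a d) (h2 : 0 < oo p d b) (hcd : oo p c d ≠ 0) :
    ∃ u v, u ≠ v ∧ Flex T p u ∧ Flex T p v := by
  have nab : a ≠ b := by rintro rfl; have := h.1; rw [oo_self23] at this; linarith
  have nbc : b ≠ c := by rintro rfl; have := h.2.1; rw [oo_self23] at this; linarith
  have nca : c ≠ a := by rintro rfl; have := h.2.2; rw [oo_self23] at this; linarith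
  have nad : a ≠ d := by rintro rfl; rw [oo_self23] at h1; linarith
  have ndb : d ≠ b := by rintro rfl; rw [oo_self23] at h2; linarith
  rcases lt_or_gt_of_ne hcd with hh | hh
  · have h' : PT p a d c := ⟨h1, by rw [oo_swap23]; linarith, h.2.2⟩
    exact ⟨a, c, nca.symm, ⟨ha, c, b, d, hc, hb, hd, ndb.symm, Or.inr h, Or.inr h'⟩,
      ⟨hc, a, b, d, ha, hb, hd, ndb.symm, Or.inl h.rot.rot, Or.inl h'.rot.rot⟩⟩
  · have h' : PT p d b c := ⟨h2, h.2.1, hh⟩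
    exact ⟨b, c, nbc, ⟨hb, c, a, d, hc, ha, hd, nad, Or.inl h.rot, Or.inl h'.rot⟩,
      ⟨hc, b, a, d, hb, ha, hd, nad, Or.inr h.rot.rot, Or.inr h'.rot.rot⟩⟩

lemma flex_two {S : Finset Pt} {T : Finset (Sym2 Pt)} (hS : GP S) (hT : PlaneSet S T) {p : Pt}
    (hsp : Spans T p) (hdeg : 4 ≤ (nb S T p).card) : ∃ u v, u ≠ v ∧ Flex T p u ∧ Flex T p v := by
  have : (nb S T p).Nonempty := Finset.card_pos.1 (by omega)
  obtain ⟨a, ha⟩ := this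
  rw [mem_nb hT] at ha
  obtain ⟨b, c, hb, hc, h⟩ := ex_PT hS hT hsp ha
  have : ∃ d ∈ nb S T p, d ∉ ({a, b, c} : Finset Pt) := by
    by_contra hno
    push Not at hno
    have h1 := Finset.card_le_card (show nb S T p ⊆ {a,b,c} from hno)
    have h2 : ({a,b,c} : Finset Pt).card ≤ 3 := Finset.card_le_three
    omega
  obtain ⟨d, hd, hdn⟩ := this
  rw [mem_nb hT] at hd
  simp only [Finset.mem_insert, Finset.mem_singleton, not_or] at hdn
  obtain ⟨hp, haS, hpa⟩ := hT.mem _ _ ha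
  obtain ⟨_, hbS, hpb⟩ := hT.mem _ _ hb
  obtain ⟨_, hcS, hpc⟩ := hT.mem _ _ hc
  obtain ⟨_, hdS, hpd⟩ := hT.mem _ _ hd
  have na := hS p hp a haS d hdS hpa hpd (Ne.symm hdn.1)
  have nb := hS p hp b hbS d hdS hpb hpd (Ne.symm hdn.2.1)
  have nc := hS p hp c hcS d hdS hpc hpd (Ne.symm hdn.2.2)
  obtain ⟨k1, k2, k3⟩ := id h
  have hid : oo p b c * oo p a d + oo p c a * oo p b d + oo p a b * oo p c d = 0 := by
    unfold oo; ring
  rcases lt_or_gt_of_ne na with A | A <;> rcases lt_or_gt_of_ne nb with B | B <;> rcases lt_or_gt_of_ne nc with C | C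
  · nlinarith [mul_pos k2 (neg_pos.2 A), mul_pos k3 (neg_pos.2 B), mul_pos k1 (neg_pos.2 C)]
  · exact flex_cone h.rot.rot hc ha hb hd C (by rw [oo_swap23]; linarith) nb
  · exact flex_cone h.rot hb hc ha hd B (by rw [oo_swap23]; linarith) na
  · exact flex_cone h.rot.rot hc ha hb hd C (by rw [oo_swap23]; linarith) nb
  · exact flex_cone h ha hb hc hd A (by rw [oo_swap23]; linarith) nc
  · exact flex_cone h ha hb hc hd A (by rw [oo_swap23]; linarith) nc
  · exact flex_cone h.rot hb hc ha hd B (by rw [oo_swap23]; linarith) na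
  · nlinarith [mul_pos k2 A, mul_pos k3 B, mul_pos k1 C]

lemma choice_lem {α β : Type} [DecidableEq α] [DecidableEq β] (Base : Finset β) (Φ : Finset α) (g1 g2 : α → β) (hne : ∀ p ∈ Φ, g1 p ≠ g2 p) :
    ∃ (g g' : α → β) (Disc : Finset α), (∀ p, (g p = g1 p ∧ g' p = g2 p) ∨ (g p = g2 p ∧ g' p = g1 p)) ∧
      Disc ⊆ Φ ∧
      (∀ p ∈ Disc, g p ∉ Base ∧ ∀ p' ∈ Φ, g p' = g p → p' = p) ∧
      (∀ p ∈ Disc, g' p ∉ Base ∪ Φ.image g) ∧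
      2 * (Base ∪ Φ.image g).card ≤ 2 * Base.card + Φ.card + Disc.card := by
  let gA : Finset α → α → β := fun A p => if p ∈ A then g1 p else g2 p
  obtain ⟨A, hA, hmin⟩ := Finset.exists_min_image Φ.powerset (fun A => (Base ∪ Φ.image (gA A)).card) ⟨∅, by simp⟩
  let g := gA A
  let g' : α → β := fun p => if p ∈ A then g2 p else g1 p
  let Disc := Φ.filter fun p => g p ∉ Base ∧ ∀ p' ∈ Φ, g p' = g p → p' = p
  have hgg : ∀ p, (g p = g1 p ∧ g' p = g2 p) ∨ (g p = g2 p ∧ g' p = g1 p) := by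
    intro p
    by_cases h : p ∈ A
    · left; simp [g, g', gA, h]
    · right; simp [g, g', gA, h]
  refine ⟨g, g', Disc, hgg, Finset.filter_subset _ _, fun p hp => (Finset.mem_filter.1 hp).2, ?_, ?_⟩
  · intro p hp hmem
    obtain ⟨hpΦ, hpB, hpu⟩ := Finset.mem_filter.1 hp
    let A' := if p ∈ A then A.erase p else insert p A
    have hA' : A' ∈ Φ.powerset := by
      rw [Finset.mem_powerset] at hA ⊢
      by_cases h : p ∈ A
      · simp only [A', h, if_true]; exact (Finset.erase_subset _ _).trans hA
      · simp only [A', h, if_false]; exact Finset.insert_subset hpΦ hA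
    have hAp : gA A' p = g' p := by
      by_cases h : p ∈ A <;> simp [A', g', gA, h]
    have hAq : ∀ q, q ≠ p → gA A' q = g q := by
      intro q hq
      by_cases h : p ∈ A <;> simp [A', g, gA, h, hq]
    have hgne : g' p ≠ g p := by
      rcases hgg p with ⟨h1, h2⟩ | ⟨h1, h2⟩ <;> rw [h1, h2]
      · exact (hne p hpΦ).symm
      · exact hne p hpΦ
    have hle := hmin A' hA'
    have hlt : (Base ∪ Φ.image (gA A')).card < (Base ∪ Φ.image (gA A)).card := by
      apply Finset.card_lt_card
      rw [Finset.ssubset_iff_of_subset]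
      · refine ⟨g p, Finset.mem_union_right _ (Finset.mem_image_of_mem _ hpΦ), ?_⟩
        intro h
        rcases Finset.mem_union.1 h with h | h
        · exact hpB h
        · obtain ⟨q, hq, hq'⟩ := Finset.mem_image.1 h
          by_cases hqp : q = p
          · subst hqp; rw [hAp] at hq'; exact hgne hq'
          · rw [hAq q hqp] at hq'; exact hqp (hpu q hq hq')
      · intro b hb
        rcases Finset.mem_union.1 hb with h | h
        · exact Finset.mem_union_left _ h
        · obtain ⟨q, hq, rfl⟩ := Finset.mem_image.1 h
          by_cases hqp : q = p
          · subst hqp; rw [hAp]; exact hmem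
          · rw [hAq q hqp]; exact Finset.mem_union_right _ (Finset.mem_image_of_mem _ hq)
    omega
  · let X := Φ.image g \ Base
    have h1 : (Base ∪ Φ.image g).card ≤ Base.card + X.card := by
      rw [← Finset.union_sdiff_self_eq_union]; exact Finset.card_union_le _ _
    have h2 : ∀ b ∈ X, 2 ≤ (Φ.filter fun p => g p = b).card + (Disc.filter fun p => g p = b).card := by
      intro b hb
      obtain ⟨hb1, hb2⟩ := Finset.mem_sdiff.1 hb
      obtain ⟨p, hp, rfl⟩ := Finset.mem_image.1 hb1
      have hpos : 0 < (Φ.filter fun q => g q = g p).card := Finset.card_pos.2 ⟨p, Finset.mem_filter.2 ⟨hp, rfl⟩⟩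
      by_cases hd : p ∈ Disc
      · have : 0 < (Disc.filter fun q => g q = g p).card := Finset.card_pos.2 ⟨p, Finset.mem_filter.2 ⟨hd, rfl⟩⟩
        omega
      · have : ∃ p' ∈ Φ, g p' = g p ∧ p' ≠ p := by
          by_contra hno
          push Not at hno
          exact hd (Finset.mem_filter.2 ⟨hp, hb2, hno⟩)
        obtain ⟨p', hp', he, hnep⟩ := this
        have : 1 < (Φ.filter fun q => g q = g p).card :=
          Finset.one_lt_card.2 ⟨p', Finset.mem_filter.2 ⟨hp', he⟩, p, Finset.mem_filter.2 ⟨hp, rfl⟩, hnep⟩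
        omega
    have h3 := Finset.sum_le_sum h2
    rw [Finset.sum_add_distrib, Finset.sum_const, smul_eq_mul] at h3
    have h4 : ∀ Y : Finset α, ∑ b ∈ X, (Y.filter fun p => g p = b).card ≤ Y.card := by
      intro Y
      have h := (Finset.sum_card_fiberwise_eq_card_filter Y X g).trans_le (Finset.card_filter_le _ _)
      convert h
    have h5 := h4 Φ
    have h6 := h4 Disc
    omega

/-- flexible points for a matching -/
def PhiF (S : Finset Pt) (T M : Finset (Sym2 Pt)) : Finset Pt :=
  S.filter fun p => ¬ hullV S p ∧ ∃ a, s(p,a) ∈ M ∧ Flex T p a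

structure Scheme (S : Finset Pt) (T M D : Finset (Sym2 Pt)) (Disc : Finset Pt) (g g' : Pt → Sym2 Pt) : Prop where
  MD : M ⊆ D
  DT : D ⊆ T
  DiscS : Disc ⊆ S
  gmem : ∀ p ∈ Disc, p ∈ g p ∧ p ∈ g' p ∧ g p ≠ g' p
  gD : ∀ p ∈ Disc, g p ∈ D
  gM : ∀ p ∈ Disc, g p ∉ M
  ginj : ∀ p ∈ Disc, ∀ p' ∈ Disc, g p = g p' → p = p'
  g'D : ∀ p ∈ Disc, g' p ∈ T \ D
  val : ∀ E : Finset (Sym2 Pt), (∀ e ∈ D, e ∈ E ∨ ∃ p ∈ Disc, e = g p ∧ g' p ∈ E) → Vld S E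
  cnt : S.card + (PhiF S T M).card ≤ 2 * (T \ D).card + Disc.card + 10
  le : Disc.card ≤ (PhiF S T M).card

lemma scheme_ex {S S1 : Finset Pt} {T M : Finset (Sym2 Pt)} (hS : GP S) (hT : Tri S T) (h2 : 2 ≤ S.card)
    (hS1 : S1 ⊆ S) (hS1c : (S \ S1).card ≤ 2) (hM : PM S1 M) (hMT : M ⊆ T) :
    ∃ D Disc g g', Scheme S T M D Disc g g' := by
  have hP := hT.toPlaneSet
  have hoth : ∀ p, ∃ a ∈ S, a ≠ p := fun p => Finset.exists_mem_ne (by omega) p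
  have hnh : ∀ p, p ∈ S → ¬ hullV S p → ∃ a e y y2, s(p,a) ∈ T ∧ s(p,e) ∈ T ∧ s(p,y) ∈ T ∧ Vt p a e y ∧
      (p ∈ S1 → s(p,a) ∈ M) ∧ (p ∈ PhiF S T M → s(p,y2) ∈ T ∧ y ≠ y2 ∧ Vt p a e y2) := by
    intro p hp hh
    have hsp := Span_T hS hT hp (hoth p) hh
    by_cases hF : p ∈ PhiF S T M
    · obtain ⟨_, _, a, haM, haT, e, y, y', he, hy, hy', hne, hv, hv'⟩ := Finset.mem_filter.1 hF
      exact ⟨a, e, y, y', haT, he, hy, hv, fun _ => haM, fun _ => ⟨hy', hne, hv'⟩⟩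
    · have : ∃ a, s(p,a) ∈ T ∧ (p ∈ S1 → s(p,a) ∈ M) := by
        by_cases hp1 : p ∈ S1
        · obtain ⟨e, ⟨heM, hpe⟩, -⟩ := hM.2 p hp1
          obtain ⟨a, rfl⟩ := Sym2.mem_iff_exists.1 hpe
          exact ⟨a, hMT heM, fun _ => heM⟩
        · obtain ⟨q', _, hq'⟩ := hoth p
          obtain ⟨x, hx, -⟩ := hsp q' hq'
          exact ⟨x, hx, fun h => absurd h hp1⟩
      obtain ⟨a, ha, haM⟩ := this
      obtain ⟨e, y, he, hy, hv⟩ := ex_PT hS hP hsp ha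
      exact ⟨a, e, y, y, ha, he, hy, Or.inl hv, haM, fun h => absurd h hF⟩
  choose! a e y y2 ha he hy hv haM hF using hnh
  have hhull : ∀ p, hullV S p → ∃ q, Hout S p q := fun p h => h
  choose! hq hHq using hhull
  set Φ := PhiF S T M with hΦ
  let Nh := S.filter fun p => ¬ hullV S p
  have hNh : ∀ {p}, p ∈ Nh ↔ p ∈ S ∧ ¬ hullV S p := fun {p} => Finset.mem_filter
  have hHl : ∀ {p}, p ∈ Hl S ↔ p ∈ S ∧ hullV S p := fun {p} => Finset.mem_filter
  have hΦN : Φ ⊆ Nh := fun p hp => hNh.2 ⟨(Finset.mem_filter.1 hp).1, (Finset.mem_filter.1 hp).2.1⟩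
  let B1 := (Hl S).image fun p => s(p, hq p)
  let B2 := (Nh.filter fun p => p ∉ S1).image fun p => s(p, a p)
  let B3 := Nh.image fun p => s(p, e p)
  let B4 := (Nh \ Φ).image fun p => s(p, y p)
  let Base := M ∪ B1 ∪ B2 ∪ B3 ∪ B4
  have hBT : Base ⊆ T := by
    refine Finset.union_subset (Finset.union_subset (Finset.union_subset (Finset.union_subset hMT ?_) ?_) ?_) ?_
    · intro b hb
      obtain ⟨p, hp, rfl⟩ := Finset.mem_image.1 hb
      obtain ⟨hp1, hp2⟩ := hHl.1 hp
      exact Hout_edge hT hp1 (hHq p hp2)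
    · intro b hb
      obtain ⟨p, hp, rfl⟩ := Finset.mem_image.1 hb
      obtain ⟨hp1, hp2⟩ := hNh.1 (Finset.mem_filter.1 hp).1
      exact ha p hp1 hp2
    · intro b hb
      obtain ⟨p, hp, rfl⟩ := Finset.mem_image.1 hb
      obtain ⟨hp1, hp2⟩ := hNh.1 hp
      exact he p hp1 hp2
    · intro b hb
      obtain ⟨p, hp, rfl⟩ := Finset.mem_image.1 hb
      obtain ⟨hp1, hp2⟩ := hNh.1 (Finset.mem_sdiff.1 hp).1
      exact hy p hp1 hp2
  have hne : ∀ p ∈ Φ, s(p, y p) ≠ s(p, y2 p) := by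
    intro p hp h
    obtain ⟨hp1, hp2⟩ := hNh.1 (hΦN hp)
    exact (hF p hp1 hp2 hp).2.1 (Sym2.congr_right.1 h)
  obtain ⟨g, g', Disc, hgg, hDΦ, hD1, hD2, hcard⟩ := choice_lem Base Φ (fun p => s(p, y p)) (fun p => s(p, y2 p)) hne
  have hgT : ∀ p ∈ Φ, g p ∈ T ∧ g' p ∈ T := by
    intro p hp
    obtain ⟨hp1, hp2⟩ := hNh.1 (hΦN hp)
    rcases hgg p with ⟨h1, h2⟩ | ⟨h1, h2⟩ <;> rw [h1, h2]
    · exact ⟨hy p hp1 hp2, (hF p hp1 hp2 hp).1⟩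
    · exact ⟨(hF p hp1 hp2 hp).1, hy p hp1 hp2⟩
  have hDT : Base ∪ Φ.image g ⊆ T := by
    refine Finset.union_subset hBT ?_
    intro b hb
    obtain ⟨p, hp, rfl⟩ := Finset.mem_image.1 hb
    exact (hgT p hp).1
  refine ⟨Base ∪ Φ.image g, Disc, g, g', ?_, hDT, ?_, ?_, ?_, ?_, ?_, ?_, ?_, ?_, ?_⟩
  · intro b hb
    simp only [Base, Finset.mem_union]; tauto
  · exact fun p hp => (hNh.1 (hΦN (hDΦ hp))).1
  · intro p hp
    have := hne p (hDΦ hp)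
    rcases hgg p with ⟨h1, h2⟩ | ⟨h1, h2⟩ <;> rw [h1, h2]
    · exact ⟨Sym2.mem_mk_left _ _, Sym2.mem_mk_left _ _, this⟩
    · exact ⟨Sym2.mem_mk_left _ _, Sym2.mem_mk_left _ _, this.symm⟩
  · exact fun p hp => Finset.mem_union_right _ (Finset.mem_image_of_mem _ (hDΦ hp))
  · intro p hp h
    apply (hD1 p hp).1
    simp only [Base, Finset.mem_union]; tauto
  · exact fun p hp p' hp' h => (hD1 p' hp').2 p (hDΦ hp) h
  · exact fun p hp => Finset.mem_sdiff.2 ⟨(hgT p (hDΦ hp)).2, hD2 p hp⟩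
  · intro E hE
    have hB : Base ⊆ E := by
      intro b hb
      rcases hE b (Finset.mem_union_left _ hb) with h | ⟨p, hp, rfl, -⟩
      · exact h
      · exact absurd hb (hD1 p hp).1
    constructor
    · intro p hp q hpq
      have hpH : hullV S p := ⟨q, hpq⟩
      rw [Hout_unique hS hp hpq (hHq p hpH)]
      apply hB
      have : s(p, hq p) ∈ B1 := Finset.mem_image.2 ⟨p, hHl.2 ⟨hp, hpH⟩, rfl⟩
      simp only [Base, Finset.mem_union]; tauto
    · intro p hp hpn
      have hpN := hNh.2 ⟨hp, hpn⟩
      have k1 : s(p, a p) ∈ E := by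
        apply hB
        by_cases h1 : p ∈ S1
        · have := haM p hp hpn h1
          simp only [Base, Finset.mem_union]; tauto
        · have : s(p, a p) ∈ B2 := Finset.mem_image.2 ⟨p, Finset.mem_filter.2 ⟨hpN, h1⟩, rfl⟩
          simp only [Base, Finset.mem_union]; tauto
      have k2 : s(p, e p) ∈ E := by
        apply hB
        have : s(p, e p) ∈ B3 := Finset.mem_image.2 ⟨p, hpN, rfl⟩
        simp only [Base, Finset.mem_union]; tauto
      by_cases hpΦ : p ∈ Φ
      · have k3 : g p ∈ E ∨ g' p ∈ E := by
          rcases hE (g p) (Finset.mem_union_right _ (Finset.mem_image_of_mem _ hpΦ)) with h | ⟨p', hp', he', hg'⟩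
          · exact Or.inl h
          · have := (hD1 p' hp').2 p hpΦ he'
            subst this
            exact Or.inr hg'
        have k4 : s(p, y p) ∈ E ∨ s(p, y2 p) ∈ E := by
          rcases hgg p with ⟨h1, h2⟩ | ⟨h1, h2⟩ <;> rw [h1, h2] at k3
          · exact k3
          · exact k3.symm
        rcases k4 with k4 | k4
        · exact Vt_span (hv p hp hpn) k1 k2 k4
        · exact Vt_span (hF p hp hpn hpΦ).2.2 k1 k2 k4
      · have k3 : s(p, y p) ∈ E := by
          apply hB
          have : s(p, y p) ∈ B4 := Finset.mem_image.2 ⟨p, Finset.mem_sdiff.2 ⟨hpN, hpΦ⟩, rfl⟩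
          simp only [Base, Finset.mem_union]; tauto
        exact Vt_span (hv p hp hpn) k1 k2 k3
  · have c0 : S1.card = M.card * 2 := PM_card hM
    have c0' := Finset.card_le_card hS1
    have c1 : B1.card ≤ (Hl S).card := Finset.card_image_le
    have c2 : B2.card ≤ 2 := by
      refine Finset.card_image_le.trans (le_trans (Finset.card_le_card ?_) hS1c)
      intro p hp
      obtain ⟨hp1, hp2⟩ := Finset.mem_filter.1 hp
      exact Finset.mem_sdiff.2 ⟨(hNh.1 hp1).1, hp2⟩
    have c3 : B3.card ≤ Nh.card := Finset.card_image_le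
    have c4 : B4.card ≤ (Nh \ Φ).card := Finset.card_image_le
    have c5 : (Nh \ Φ).card + Φ.card = Nh.card := Finset.card_sdiff_add_card_eq_card hΦN
    have c6 : (Hl S).card + Nh.card = S.card := Finset.card_filter_add_card_filter_not _
    have c7 : Base.card ≤ M.card + B1.card + B2.card + B3.card + B4.card := by
      have u1 := Finset.card_union_le (M ∪ B1 ∪ B2 ∪ B3) B4
      have u2 := Finset.card_union_le (M ∪ B1 ∪ B2) B3
      have u3 := Finset.card_union_le (M ∪ B1) B2
      have u4 := Finset.card_union_le M B1
      simp only [Base]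
      omega
    have c8 := (edge_count hS hT h2).2
    have c9 : (T \ (Base ∪ Φ.image g)).card + (Base ∪ Φ.image g).card = T.card := Finset.card_sdiff_add_card_eq_card hDT
    have c10 : (PhiF S T M).card = Φ.card := rfl
    omega
  · exact Finset.card_le_card hDΦ

/-- multiplicity of an edge as alternative edge -/
def kk (Disc : Finset Pt) (g' : Pt → Sym2 Pt) (e : Sym2 Pt) : ℕ := (Disc.filter fun p => g' p = e).card

/-- weight of an edge in the second matching -/
def uu (F : Finset (Sym2 Pt)) (Disc : Finset Pt) (g' : Pt → Sym2 Pt) (e : Sym2 Pt) : ℝ :=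
  (if e ∈ F then 2 else 1) * (1/2) ^ (kk Disc g' e)

lemma uu_nonneg (F : Finset (Sym2 Pt)) (Disc : Finset Pt) (g' : Pt → Sym2 Pt) (e : Sym2 Pt) : 0 ≤ uu F Disc g' e := by
  unfold uu
  split_ifs <;> positivity

lemma sum_kk (Disc : Finset Pt) (g' : Pt → Sym2 Pt) (X : Finset (Sym2 Pt)) :
    ∑ e ∈ X, kk Disc g' e = (Disc.filter fun p => g' p ∈ X).card := by
  have h := Finset.sum_card_fiberwise_eq_card_filter Disc X g'
  unfold kk
  convert h

lemma supp_M2 {S S2 : Finset Pt} {T M D M2 : Finset (Sym2 Pt)} {Disc : Finset Pt} {g g' : Pt → Sym2 Pt}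
    (hS : GP S) (hT : Tri S T) (h : Scheme S T M D Disc g g') (hM2 : PM S2 M2) (hM2T : M2 ⊆ T) {x : Sym2 Pt} (hx : x ∈ T) :
    (1 : ℝ) / (SP S (M ∪ M2 ∪ {x})).card ≤ 2 * (1/2) ^ (T \ D).card * ∏ e ∈ M2, uu (T \ D) Disc g' e := by
  let P := Disc.filter fun p => g' p ∈ M2
  let Rem := P.image g
  let E := M ∪ M2 ∪ {x} ∪ (D \ Rem)
  have hMT : M ⊆ T := h.MD.trans h.DT
  have hET : E ⊆ T := by
    refine Finset.union_subset (Finset.union_subset (Finset.union_subset hMT hM2T) (Finset.singleton_subset_iff.2 hx))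
      (Finset.sdiff_subset.trans h.DT)
  have hV : Vld S E := by
    apply h.val
    intro e he
    by_cases hr : e ∈ Rem
    · obtain ⟨p, hp, rfl⟩ := Finset.mem_image.1 hr
      obtain ⟨hp1, hp2⟩ := Finset.mem_filter.1 hp
      refine Or.inr ⟨p, hp1, rfl, ?_⟩
      simp only [E, Finset.mem_union]; tauto
    · left
      simp only [E, Finset.mem_union, Finset.mem_sdiff]; tauto
  have hsupp := supp_ge hS _ T E hT hV hET rfl
  have hle : (SP S E).card ≤ (SP S (M ∪ M2 ∪ {x})).card := by
    apply Finset.card_le_card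
    intro T' hT'
    obtain ⟨k1, k2⟩ := Finset.mem_filter.1 hT'
    exact Finset.mem_filter.2 ⟨k1, Finset.subset_union_left.trans k2⟩
  have hRemD : Rem ⊆ D := by
    intro e he
    obtain ⟨p, hp, rfl⟩ := Finset.mem_image.1 he
    exact h.gD p (Finset.mem_filter.1 hp).1
  have hRemc : Rem.card = P.card := by
    apply Finset.card_image_of_injOn
    intro p hp p' hp' hpp
    exact h.ginj p (Finset.mem_filter.1 hp).1 p' (Finset.mem_filter.1 hp').1 hpp
  have hcount : (T \ D).card + P.card ≤ (T \ E).card + (M2.filter fun e => e ∈ T \ D).card + 1 := by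
    have hdis : Disjoint (T \ D) Rem := Finset.disjoint_left.2 fun e he hr => (Finset.mem_sdiff.1 he).2 (hRemD hr)
    rw [← hRemc, ← Finset.card_union_of_disjoint hdis]
    have hsub : (T \ D) ∪ Rem ⊆ (T \ E) ∪ (M2.filter fun e => e ∈ T \ D) ∪ {x} := by
      intro e he
      rcases Finset.mem_union.1 he with he | he
      · have he' := Finset.mem_sdiff.1 he
        have hm : e ∉ M := fun hm => he'.2 (h.MD hm)
        by_cases hgx : e ∈ ({x} : Finset (Sym2 Pt))
        · exact Finset.mem_union_right _ hgx
        refine Finset.mem_union_left _ ?_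
        by_cases hm2 : e ∈ M2
        · exact Finset.mem_union_right _ (Finset.mem_filter.2 ⟨hm2, he⟩)
        · refine Finset.mem_union_left _ (Finset.mem_sdiff.2 ⟨he'.1, fun hE => ?_⟩)
          rcases Finset.mem_union.1 hE with hE | hE
          · rcases Finset.mem_union.1 hE with hE | hE
            · rcases Finset.mem_union.1 hE with hE | hE
              · exact hm hE
              · exact hm2 hE
            · exact hgx hE
          · exact he'.2 (Finset.mem_sdiff.1 hE).1
      · obtain ⟨p, hp, rfl⟩ := Finset.mem_image.1 he
        obtain ⟨hp1, hp2⟩ := Finset.mem_filter.1 hp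
        have hm := h.gM p hp1
        have hm2 : g p ∉ M2 := by
          intro hg
          obtain ⟨m1, m2, m3⟩ := h.gmem p hp1
          have hpS := (hM2.1 _ hg).2 p m1
          exact m3 ((hM2.2 p hpS).unique ⟨hg, m1⟩ ⟨hp2, m2⟩)
        have hgT := h.DT (h.gD p hp1)
        by_cases hgx : g p ∈ ({x} : Finset (Sym2 Pt))
        · exact Finset.mem_union_right _ hgx
        · refine Finset.mem_union_left _ (Finset.mem_union_left _ (Finset.mem_sdiff.2 ⟨hgT, fun hE => ?_⟩))
          rcases Finset.mem_union.1 hE with hE | hE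
          · rcases Finset.mem_union.1 hE with hE | hE
            · rcases Finset.mem_union.1 hE with hE | hE
              · exact hm hE
              · exact hm2 hE
            · exact hgx hE
          · exact (Finset.mem_sdiff.1 hE).2 he
    refine (Finset.card_le_card hsub).trans ?_
    have u1 := Finset.card_union_le ((T \ E) ∪ (M2.filter fun e => e ∈ T \ D)) {x}
    have u2 := Finset.card_union_le (T \ E) (M2.filter fun e => e ∈ T \ D)
    rw [Finset.card_singleton] at u1
    omega
  have hprod : ∏ e ∈ M2, uu (T \ D) Disc g' e = 2 ^ (M2.filter fun e => e ∈ T \ D).card * (1/2) ^ P.card := by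
    unfold uu
    rw [Finset.prod_mul_distrib, Finset.prod_pow_eq_pow_sum, sum_kk]
    congr 1
    rw [Finset.prod_ite]
    simp
  rw [hprod]
  have hc : (2 : ℝ) ^ (T \ E).card ≤ (SP S (M ∪ M2 ∪ {x})).card := by
    exact_mod_cast hsupp.trans hle
  have hpos : (0:ℝ) < 2 ^ (T \ E).card := by positivity
  refine (one_div_le_one_div_of_le hpos hc).trans ?_
  rw [div_le_iff₀ hpos]
  have key : (2:ℝ) ^ ((T \ D).card + P.card) ≤ 2 ^ ((T \ E).card + (M2.filter fun e => e ∈ T \ D).card + 1) :=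
    pow_le_pow_right₀ (by norm_num) hcount
  rw [pow_add, pow_add, pow_add, pow_one] at key
  have e1 : (2:ℝ) ^ (T \ D).card * (1/2) ^ (T \ D).card = 1 := by rw [← mul_pow]; norm_num
  have e2 : (2:ℝ) ^ P.card * (1/2) ^ P.card = 1 := by rw [← mul_pow]; norm_num
  calc (1:ℝ) = (2 ^ (T \ D).card * 2 ^ P.card) * ((1/2) ^ (T \ D).card * (1/2) ^ P.card) := by
        rw [mul_mul_mul_comm, e1, e2]; norm_num
    _ ≤ (2 ^ (T \ E).card * 2 ^ (M2.filter fun e => e ∈ T \ D).card * 2) * ((1/2) ^ (T \ D).card * (1/2) ^ P.card) := by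
        gcongr
    _ = _ := by ring

lemma uu_sum {S : Finset Pt} {T M D : Finset (Sym2 Pt)} {Disc : Finset Pt} {g g' : Pt → Sym2 Pt}
    (h : Scheme S T M D Disc g g') :
    ∑ e ∈ T \ M, uu (T \ D) Disc g' e ^ 2 ≤ T.card - M.card + 3 * (T \ D).card - 15/8 * Disc.card := by
  have hpt : ∀ e ∈ T \ M, uu (T \ D) Disc g' e ^ 2 ≤ 1 + 3 * (if e ∈ T \ D then 1 else 0) - 15/8 * (kk Disc g' e : ℝ) := by
    intro e he
    have hk2 : kk Disc g' e ≤ 2 := by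
      induction e using Sym2.ind with
      | _ a b =>
        have : (Disc.filter fun p => g' p = s(a,b)) ⊆ {a, b} := by
          intro p hp
          obtain ⟨hp1, hp2⟩ := Finset.mem_filter.1 hp
          have := (h.gmem p hp1).2.1
          rw [hp2, Sym2.mem_iff] at this
          simpa using this
        exact (Finset.card_le_card this).trans Finset.card_le_two
    by_cases hF : e ∈ T \ D
    · unfold uu
      simp only [hF, if_true]
      interval_cases kk Disc g' e <;> norm_num
    · have hk0 : kk Disc g' e = 0 := by
        unfold kk
        rw [Finset.card_eq_zero, Finset.filter_eq_empty_iff]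
        intro p hp hpe
        exact hF (hpe ▸ h.g'D p hp)
      unfold uu
      simp only [hF, if_false, hk0]
      norm_num
  refine (Finset.sum_le_sum hpt).trans ?_
  rw [Finset.sum_sub_distrib, Finset.sum_add_distrib, ← Finset.mul_sum, ← Finset.mul_sum]
  have s1 : ∑ e ∈ T \ M, (1:ℝ) = T.card - M.card := by
    have : (T \ M).card + M.card = T.card := Finset.card_sdiff_add_card_eq_card (h.MD.trans h.DT)
    rw [Finset.sum_const, nsmul_eq_mul, mul_one, ← this]; push_cast; ring
  have s2 : ∑ e ∈ T \ M, (if e ∈ T \ D then (1:ℝ) else 0) ≤ (T \ D).card := by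
    rw [← Finset.sum_filter, Finset.sum_const, nsmul_eq_mul, mul_one]
    exact_mod_cast Finset.card_le_card fun e he => (Finset.mem_filter.1 he).2
  have s3 : ∑ e ∈ T \ M, (kk Disc g' e : ℝ) = Disc.card := by
    rw [← Nat.cast_sum, sum_kk]
    congr 2
    rw [Finset.filter_eq_self]
    intro p hp
    have := Finset.mem_sdiff.1 (h.g'D p hp)
    exact Finset.mem_sdiff.2 ⟨this.1, fun hm => this.2 (h.MD hm)⟩
  rw [s1, s3]
  linarith

lemma sum_pairs {S : Finset Pt} {G : Finset (Sym2 Pt)} (hG : ∀ a b, s(a,b) ∈ G → a ∈ S ∧ b ∈ S ∧ a ≠ b) (F : Sym2 Pt → ℝ) :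
    ∑ p ∈ S, ∑ q ∈ S, (if s(p,q) ∈ G then F s(p,q) else 0) = 2 * ∑ e ∈ G, F e := by
  rw [← Finset.sum_product', ← Finset.sum_filter, Finset.mul_sum]
  rw [← Finset.sum_fiberwise_of_maps_to (s := (S ×ˢ S).filter fun x => s(x.1, x.2) ∈ G) (t := G) (g := fun x => s(x.1,x.2))
    (fun x hx => (Finset.mem_filter.1 hx).2)]
  apply Finset.sum_congr rfl
  intro e he
  have : ∀ x ∈ ((S ×ˢ S).filter fun x => s(x.1, x.2) ∈ G).filter (fun x => s(x.1,x.2) = e), F s(x.1,x.2) = F e := by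
    intro x hx
    rw [(Finset.mem_filter.1 hx).2]
  rw [Finset.sum_congr rfl this, Finset.sum_const, nsmul_eq_mul]
  congr 1
  induction e using Sym2.ind with
  | _ a b =>
    obtain ⟨ha, hb, hab⟩ := hG a b he
    have : ((S ×ˢ S).filter fun x => s(x.1, x.2) ∈ G).filter (fun x => s(x.1,x.2) = s(a,b)) = {(a,b), (b,a)} := by
      ext ⟨u, v⟩
      simp only [Finset.mem_filter, Finset.mem_product, Finset.mem_insert, Finset.mem_singleton, Prod.mk_inj]
      rw [Sym2.eq_iff]
      constructor
      · exact fun h => h.2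
      · rintro (⟨rfl, rfl⟩ | ⟨rfl, rfl⟩)
        · exact ⟨⟨⟨ha, hb⟩, he⟩, Or.inl ⟨rfl, rfl⟩⟩
        · exact ⟨⟨⟨hb, ha⟩, by rw [Sym2.eq_swap]; exact he⟩, Or.inr ⟨rfl, rfl⟩⟩
    rw [this, Finset.card_pair (fun h => hab (Prod.mk_inj.1 h).1)]
    norm_num

lemma kast_exp {S S2 : Finset Pt} {G : Finset (Sym2 Pt)} (hS : GP S) (hS2 : S2 ⊆ S) (hG : PlaneSet S G)
    (w : Sym2 Pt → ℝ) (hw : ∀ e, 0 ≤ w e) (b : Pt → ℝ) (hb0 : ∀ p ∈ S, 0 ≤ b p)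
    (hb : ∀ p ∈ S, (∑ q ∈ S, if s(p,q) ∈ G then w s(p,q) ^ 2 else 0) ≤ Real.exp (b p)) :
    ∑ M ∈ G.powerset.filter (PM S2), ∏ e ∈ M, w e ≤ Real.exp ((∑ p ∈ S, b p) / 4) := by
  have hGP2 : GP S2 := fun p hp q hq r hr => hS p (hS2 hp) q (hS2 hq) r (hS2 hr)
  refine (kast S2 hGP2 G (fun e he => ?_) hG.plane w hw).trans ?_
  · induction e using Sym2.ind with
    | _ a b => rw [Sym2.mk_isDiag_iff]; exact (hG.mem a b he).2.2
  have hsq : ∀ x : ℝ, Real.sqrt (Real.exp x) = Real.exp (x/2) := by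
    intro x
    rw [Real.exp_half]
  have h1 : ∏ p ∈ S2, Real.sqrt (∑ q ∈ S2, if s(p,q) ∈ G then w s(p,q) ^ 2 else 0) ≤ Real.exp ((∑ p ∈ S, b p)/2) := by
    calc _ ≤ ∏ p ∈ S2, Real.exp (b p / 2) := by
          apply Finset.prod_le_prod
          · intro p _; exact Real.sqrt_nonneg _
          · intro p hp
            rw [← hsq]
            apply Real.sqrt_le_sqrt
            refine le_trans ?_ (hb p (hS2 hp))
            apply Finset.sum_le_sum_of_subset_of_nonneg hS2
            intro q _ _
            split_ifs <;> positivity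
      _ = Real.exp (∑ p ∈ S2, b p / 2) := (Real.exp_sum _ _).symm
      _ ≤ _ := by
          apply Real.exp_le_exp.2
          rw [Finset.sum_div]
          apply Finset.sum_le_sum_of_subset_of_nonneg hS2
          intro p hp _
          have := hb0 p hp
          positivity
  refine (Real.sqrt_le_sqrt h1).trans ?_
  rw [hsq]
  apply le_of_eq
  congr 1
  ring

lemma log2_lo : (0.693:ℝ) < Real.log 2 := by have := Real.log_two_gt_d9; linarith
lemma log2_hi : Real.log 2 < (0.6932:ℝ) := by have := Real.log_two_lt_d9; linarith

lemma M2_sum {S S2 : Finset Pt} {T M D : Finset (Sym2 Pt)} {Disc : Finset Pt} {g g' : Pt → Sym2 Pt}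
    (hS : GP S) (hT : Tri S T) (h2 : 2 ≤ S.card) (h : Scheme S T M D Disc g g') (hM : S.card ≤ 2 * M.card + 2) (hS2 : S2 ⊆ S) :
    ∑ M2 ∈ (T \ M).powerset.filter (PM S2), 2 * (1/2) ^ (T \ D).card * ∏ e ∈ M2, uu (T \ D) Disc g' e ≤
      2 * Real.exp 3 * Real.exp (Real.log 2 * S.card / 4) * (9/10) ^ (PhiF S T M).card := by
  rw [← Finset.mul_sum]
  have hG : PlaneSet S (T \ M) := PlaneSet_subset hT.toPlaneSet Finset.sdiff_subset
  let R : Pt → ℝ := fun p => ∑ q ∈ S, if s(p,q) ∈ T \ M then uu (T \ D) Disc g' s(p,q) ^ 2 else 0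
  have hR0 : ∀ p, 0 ≤ R p := by
    intro p
    apply Finset.sum_nonneg
    intro q _
    split_ifs <;> positivity
  have L1 := log2_lo
  have L2 := log2_hi
  have hk := kast_exp hS hS2 hG (uu (T \ D) Disc g') (uu_nonneg _ _ _) (fun p => 3 * Real.log 2 - 1 + R p / 8)
    (fun p _ => by have := hR0 p; linarith) (fun p _ => by
      change R p ≤ _
      have e8 : Real.exp (3 * Real.log 2) = 8 := by
        rw [show (3:ℝ) * Real.log 2 = Real.log 2 + Real.log 2 + Real.log 2 by ring, Real.exp_add, Real.exp_add,
          Real.exp_log (by norm_num)]; norm_num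
      rw [show 3 * Real.log 2 - 1 + R p / 8 = 3 * Real.log 2 + (R p / 8 - 1) by ring, Real.exp_add, e8]
      have := Real.add_one_le_exp (R p / 8 - 1)
      linarith)
  have hsum : ∑ p ∈ S, (3 * Real.log 2 - 1 + R p / 8) = S.card * (3 * Real.log 2 - 1) + (∑ p ∈ S, R p) / 8 := by
    rw [Finset.sum_add_distrib, Finset.sum_const, nsmul_eq_mul, Finset.sum_div]
  have hRs : ∑ p ∈ S, R p = 2 * ∑ e ∈ T \ M, uu (T \ D) Disc g' e ^ 2 :=
    sum_pairs hG.mem (fun e => uu (T \ D) Disc g' e ^ 2)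
  have hus := uu_sum h
  rw [hsum, hRs] at hk
  have hTc : (T.card : ℝ) ≤ 3 * S.card := by
    have := (edge_count hS hT h2).1
    exact_mod_cast (by omega : T.card ≤ 3 * S.card)
  have hMc : (S.card : ℝ) ≤ 2 * M.card + 2 := by exact_mod_cast hM
  have hf : (S.card : ℝ) + (PhiF S T M).card ≤ 2 * (T \ D).card + Disc.card + 10 := by exact_mod_cast h.cnt
  have hd : (Disc.card : ℝ) ≤ (PhiF S T M).card := by exact_mod_cast h.le
  have hhalf : ((1:ℝ)/2) ^ (T \ D).card = Real.exp (-(Real.log 2) * (T \ D).card) := by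
    rw [mul_comm, Real.exp_nat_mul, Real.exp_neg, Real.exp_log (by norm_num)]; norm_num
  have h910 : Real.exp (-(1/9) * (PhiF S T M).card) ≤ ((9:ℝ)/10) ^ (PhiF S T M).card := by
    rw [mul_comm, Real.exp_nat_mul]
    apply pow_le_pow_left₀ (Real.exp_pos _).le
    have := Real.one_sub_inv_le_log_of_pos (x := (9:ℝ)/10) (by norm_num)
    rw [← Real.le_log_iff_exp_le (by norm_num)]
    norm_num at this ⊢
    exact this
  calc _ ≤ 2 * (1/2) ^ (T \ D).card * Real.exp ((S.card * (3 * Real.log 2 - 1) + 2 * (∑ e ∈ T \ M, uu (T \ D) Disc g' e ^ 2) / 8) / 4) := by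
        gcongr
    _ = 2 * Real.exp (-(Real.log 2) * (T \ D).card + (S.card * (3 * Real.log 2 - 1) + 2 * (∑ e ∈ T \ M, uu (T \ D) Disc g' e ^ 2) / 8) / 4) := by
        rw [hhalf, Real.exp_add]; ring
    _ ≤ 2 * Real.exp (3 + Real.log 2 * S.card / 4 + -(1/9) * (PhiF S T M).card) := by
        refine mul_le_mul_of_nonneg_left (Real.exp_le_exp.2 ?_) (by norm_num)
        generalize (∑ e ∈ T \ M, uu (T \ D) Disc g' e ^ 2) = U at *
        generalize ((T \ D).card : ℝ) = f at *
        generalize ((PhiF S T M).card : ℝ) = φ at *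
        generalize hdd : (Disc.card : ℝ) = d at *
        generalize (M.card : ℝ) = m at *
        generalize (T.card : ℝ) = t at *
        generalize (S.card : ℝ) = n at *
        have hd0 : 0 ≤ d := by rw [← hdd]; positivity
        have A := mul_le_mul_of_nonneg_left hf (show (0:ℝ) ≤ (Real.log 2 - 3/16)/2 by linarith)
        have B := mul_le_mul_of_nonneg_right L1.le (show (0:ℝ) ≤ φ - d by linarith)
        nlinarith
    _ ≤ _ := by
        rw [Real.exp_add, Real.exp_add]
        have : 0 ≤ 2 * (Real.exp 3 * Real.exp (Real.log 2 * S.card / 4)) := by positivity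
        nlinarith

/-- flexible endpoints of an edge -/
def FF (S : Finset Pt) (T : Finset (Sym2 Pt)) (e : Sym2 Pt) : Finset Pt :=
  S.filter fun p => ¬ hullV S p ∧ ∃ a, e = s(p,a) ∧ Flex T p a

lemma mem_FF {S : Finset Pt} {T : Finset (Sym2 Pt)} {e : Sym2 Pt} {p : Pt} : p ∈ FF S T e ↔
    p ∈ S ∧ ¬ hullV S p ∧ ∃ a, e = s(p,a) ∧ Flex T p a := Finset.mem_filter

lemma FF_le_two (S : Finset Pt) (T : Finset (Sym2 Pt)) (e : Sym2 Pt) : (FF S T e).card ≤ 2 := by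
  induction e using Sym2.ind with
  | _ a b =>
    have : FF S T s(a,b) ⊆ {a, b} := by
      intro p hp
      obtain ⟨_, _, c, hc, _⟩ := mem_FF.1 hp
      have : p ∈ s(a,b) := by rw [hc]; exact Sym2.mem_mk_left _ _
      rw [Sym2.mem_iff] at this
      simpa using this
    exact (Finset.card_le_card this).trans Finset.card_le_two

/-- interior points of degree at least four -/
def N4 (S : Finset Pt) (T : Finset (Sym2 Pt)) : Finset Pt := S.filter fun p => ¬ hullV S p ∧ 4 ≤ (nb S T p).card
/-- interior points of degree at most three -/
def N3 (S : Finset Pt) (T : Finset (Sym2 Pt)) : Finset Pt := S.filter fun p => ¬ hullV S p ∧ (nb S T p).card < 4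

lemma card_N34 (S : Finset Pt) (T : Finset (Sym2 Pt)) : (Hl S).card + (N3 S T).card + (N4 S T).card = S.card := by
  have c6 : (Hl S).card + (S.filter fun p => ¬ hullV S p).card = S.card := Finset.card_filter_add_card_filter_not _
  have c7 := Finset.card_filter_add_card_filter_not (s := S.filter fun p => ¬ hullV S p) (fun p => (nb S T p).card < 4)
  rw [Finset.filter_filter, Finset.filter_filter] at c7
  have e1 : (S.filter fun p => ¬ hullV S p ∧ ¬ (nb S T p).card < 4) = N4 S T := by
    unfold N4
    apply Finset.filter_congr
    intro p _
    rw [not_lt]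
  rw [e1] at c7
  unfold N3
  omega

lemma sum_FF {S : Finset Pt} {T : Finset (Sym2 Pt)} (hS : GP S) (hT : Tri S T) (h2 : 2 ≤ S.card) :
    2 * (N4 S T).card ≤ ∑ e ∈ T, (FF S T e).card := by
  have h1 : ∑ e ∈ T, (FF S T e).card = ∑ p ∈ S, (T.filter fun e => p ∈ FF S T e).card := by
    have a1 : ∀ e, (FF S T e).card = ∑ p ∈ S, if p ∈ FF S T e then 1 else 0 := by
      intro e
      rw [← Finset.sum_filter, Finset.sum_const, smul_eq_mul, mul_one]
      congr 1
      ext p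
      rw [Finset.mem_filter]
      exact ⟨fun h => ⟨(mem_FF.1 h).1, h⟩, fun h => h.2⟩
    simp only [a1]
    rw [Finset.sum_comm]
    apply Finset.sum_congr rfl
    intro p _
    rw [← Finset.sum_filter, Finset.sum_const, smul_eq_mul, mul_one]
  rw [h1]
  have hsub : N4 S T ⊆ S := Finset.filter_subset _ _
  refine le_trans ?_ (Finset.sum_le_sum_of_subset hsub)
  rw [mul_comm, ← smul_eq_mul]
  apply Finset.card_nsmul_le_sum
  intro p hp
  obtain ⟨hpS, hh, hdeg⟩ := Finset.mem_filter.1 hp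
  have hsp := Span_T hS hT hpS (Finset.exists_mem_ne (by omega) p) hh
  obtain ⟨u, v, huv, hu, hv⟩ := flex_two hS hT.toPlaneSet hsp hdeg
  apply Nat.succ_le_of_lt
  apply Finset.one_lt_card.2
  exact ⟨s(p,u), Finset.mem_filter.2 ⟨hu.1, mem_FF.2 ⟨hpS, hh, u, rfl, hu⟩⟩, s(p,v),
    Finset.mem_filter.2 ⟨hv.1, mem_FF.2 ⟨hpS, hh, v, rfl, hv⟩⟩, fun h => huv (Sym2.congr_right.1 h)⟩

lemma Phi_prod {S S1 : Finset Pt} {T M : Finset (Sym2 Pt)} (hM : PM S1 M) :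
    ((9:ℝ)/10) ^ (PhiF S T M).card ≤ ∏ e ∈ M, ((9:ℝ)/10) ^ (FF S T e).card := by
  rw [Finset.prod_pow_eq_pow_sum]
  apply pow_le_pow_of_le_one (by norm_num) (by norm_num)
  rw [← Finset.card_biUnion]
  · apply Finset.card_le_card
    intro p hp
    obtain ⟨e, he, hpe⟩ := Finset.mem_biUnion.1 hp
    obtain ⟨h1, h2, a, rfl, h3⟩ := mem_FF.1 hpe
    exact Finset.mem_filter.2 ⟨h1, h2, a, he, h3⟩
  · intro e he e' he' hne
    apply Finset.disjoint_left.2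
    intro p hp hp'
    obtain ⟨_, _, a, ha, _⟩ := mem_FF.1 hp
    obtain ⟨_, _, a', ha', _⟩ := mem_FF.1 hp'
    have m1 : p ∈ e := by rw [ha]; exact Sym2.mem_mk_left _ _
    have m2 : p ∈ e' := by rw [ha']; exact Sym2.mem_mk_left _ _
    exact hne ((hM.2 p ((hM.1 e he).2 p m1)).unique ⟨he, m1⟩ ⟨he', m2⟩)

lemma deg3_num {R : ℝ} (h : R ≤ 3) : R ≤ 6 * Real.exp (R / 6 - 1 - 1/10) := by
  have h1 : (1:ℝ)/2 ≤ Real.exp (-(6/10)) := by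
    rw [← Real.log_le_iff_le_exp (by norm_num), one_div, Real.log_inv]
    have := log2_lo
    linarith
  have h2 := Real.add_one_le_exp (R/6 - 1/2)
  rw [show R / 6 - 1 - 1/10 = -(6/10) + (R/6 - 1/2) by ring, Real.exp_add]
  have h3 : 1/2 * Real.exp (R/6 - 1/2) ≤ Real.exp (-(6/10)) * Real.exp (R/6 - 1/2) := by
    gcongr
  linarith

lemma M1_sum {S S1 : Finset Pt} {T : Finset (Sym2 Pt)} (hS : GP S) (hT : Tri S T) (h2 : 2 ≤ S.card) (hS1 : S1 ⊆ S) :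
    ∑ M ∈ T.powerset.filter (PM S1), ((9:ℝ)/10) ^ (PhiF S T M).card ≤ Real.exp ((Real.log 6 - 1/10) * S.card / 4) := by
  let w : Sym2 Pt → ℝ := fun e => (9/10) ^ (FF S T e).card
  have hw0 : ∀ e, 0 ≤ w e := fun e => by simp only [w]; positivity
  have hw1 : ∀ e, w e ^ 2 ≤ 1 - 0.17195 * (FF S T e).card := by
    intro e
    have := FF_le_two S T e
    simp only [w]
    interval_cases (FF S T e).card <;> norm_num
  let R : Pt → ℝ := fun p => ∑ q ∈ S, if s(p,q) ∈ T then w s(p,q) ^ 2 else 0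
  have hR0 : ∀ p, 0 ≤ R p := by
    intro p
    apply Finset.sum_nonneg
    intro q _
    split_ifs <;> positivity
  have hRd : ∀ p, R p ≤ (nb S T p).card := by
    intro p
    have : ((nb S T p).card : ℝ) = ∑ q ∈ S, if s(p,q) ∈ T then (1:ℝ) else 0 := by
      rw [← Finset.sum_filter, Finset.sum_const, nsmul_eq_mul, mul_one]; rfl
    rw [this]
    apply Finset.sum_le_sum
    intro q _
    split_ifs
    · have := hw1 s(p,q)
      have h0 : (0:ℝ) ≤ (FF S T s(p,q)).card := by positivity
      linarith
    · exact le_rfl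
  have e6 : Real.exp (Real.log 6) = 6 := Real.exp_log (by norm_num)
  have l6 : (11/10 : ℝ) ≤ Real.log 6 := by
    rw [show (6:ℝ) = 2 * 3 by norm_num, Real.log_mul (by norm_num) (by norm_num)]
    have := log2_lo
    have h3 : 1 ≤ Real.log 3 := by
      rw [Real.le_log_iff_exp_le (by norm_num)]
      have := Real.exp_one_lt_d9
      linarith
    linarith
  have hk := kast_exp hS hS1 hT.toPlaneSet w hw0
    (fun p => Real.log 6 - 1 + R p / 6 - if p ∈ N3 S T then 1/10 else 0)
    (fun p _ => by have := hR0 p; split_ifs <;> linarith) (fun p _ => by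
      change R p ≤ _
      split_ifs with h
      · have hd := (Finset.mem_filter.1 h).2.2
        have hd' : ((nb S T p).card : ℝ) ≤ 3 := by exact_mod_cast (by omega : (nb S T p).card ≤ 3)
        rw [show Real.log 6 - 1 + R p / 6 - 1/10 = Real.log 6 + (R p / 6 - 1 - 1/10) by ring, Real.exp_add, e6]
        exact deg3_num ((hRd p).trans hd')
      · rw [show Real.log 6 - 1 + R p / 6 - 0 = Real.log 6 + (R p / 6 - 1) by ring, Real.exp_add, e6]
        have := Real.add_one_le_exp (R p / 6 - 1)
        linarith)
  refine le_trans (Finset.sum_le_sum fun M hM => Phi_prod (S := S) (T := T) (Finset.mem_filter.1 hM).2) (hk.trans ?_)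
  apply Real.exp_le_exp.2
  have hsum : ∑ p ∈ S, (Real.log 6 - 1 + R p / 6 - if p ∈ N3 S T then 1/10 else 0) =
      S.card * (Real.log 6 - 1) + (∑ p ∈ S, R p) / 6 - (N3 S T).card / 10 := by
    rw [Finset.sum_sub_distrib, Finset.sum_add_distrib, Finset.sum_const, nsmul_eq_mul, Finset.sum_div]
    congr 1
    rw [← Finset.sum_filter, Finset.sum_const, nsmul_eq_mul]
    have : (S.filter fun p => p ∈ N3 S T) = N3 S T := by
      ext p
      rw [Finset.mem_filter]
      exact ⟨fun h => h.2, fun h => ⟨(Finset.mem_filter.1 h).1, h⟩⟩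
    rw [this]; ring
  rw [hsum]
  have hRs : ∑ p ∈ S, R p = 2 * ∑ e ∈ T, w e ^ 2 := sum_pairs hT.mem (fun e => w e ^ 2)
  have hws : ∑ e ∈ T, w e ^ 2 ≤ T.card - 0.17195 * (2 * (N4 S T).card) := by
    refine (Finset.sum_le_sum fun e _ => hw1 e).trans ?_
    rw [Finset.sum_sub_distrib, Finset.sum_const, nsmul_eq_mul, mul_one, ← Finset.mul_sum]
    have : (2:ℝ) * (N4 S T).card ≤ ∑ e ∈ T, ((FF S T e).card : ℝ) := by exact_mod_cast sum_FF hS hT h2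
    linarith
  have hTc : (T.card : ℝ) + (Hl S).card ≤ 3 * S.card := by exact_mod_cast (edge_count hS hT h2).1
  have hN : ((Hl S).card : ℝ) + (N3 S T).card + (N4 S T).card = S.card := by exact_mod_cast card_N34 S T
  have h0 : (0:ℝ) ≤ (Hl S).card := by positivity
  have h4 : (0:ℝ) ≤ (N4 S T).card := by positivity
  rw [hRs]
  nlinarith

/-- subsets missing at most two points -/
def QQ (S : Finset Pt) : Finset (Finset Pt) := S.powerset.filter fun A => (S \ A).card ≤ 2

lemma QQ_card (S : Finset Pt) : (QQ S).card ≤ S.card ^ 2 + 1 := by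
  have hsub : QQ S ⊆ insert S ((S ×ˢ S).image fun x => S \ {x.1, x.2}) := by
    intro A hA
    obtain ⟨h1, h2⟩ := Finset.mem_filter.1 hA
    rw [Finset.mem_powerset] at h1
    have hAA : S \ (S \ A) = A := Finset.sdiff_sdiff_eq_self h1
    rw [Finset.mem_insert, Finset.mem_image]
    have hc : (S \ A).card = 0 ∨ (S \ A).card = 1 ∨ (S \ A).card = 2 := by omega
    rcases hc with hc | hc | hc
    · left
      rw [Finset.card_eq_zero] at hc
      rw [← hAA, hc, Finset.sdiff_empty]
    · right
      obtain ⟨a, ha⟩ := Finset.card_eq_one.1 hc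
      have haS : a ∈ S := (Finset.mem_sdiff.1 (ha ▸ Finset.mem_singleton_self a : a ∈ S \ A)).1
      exact ⟨(a,a), Finset.mem_product.2 ⟨haS, haS⟩, by simpa [ha] using hAA⟩
    · right
      obtain ⟨a, b, _, hab⟩ := Finset.card_eq_two.1 hc
      have haS : a ∈ S := (Finset.mem_sdiff.1 (by rw [hab]; simp : a ∈ S \ A)).1
      have hbS : b ∈ S := (Finset.mem_sdiff.1 (by rw [hab]; simp : b ∈ S \ A)).1
      exact ⟨(a,b), Finset.mem_product.2 ⟨haS, hbS⟩, by simpa [hab] using hAA⟩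
  refine (Finset.card_le_card hsub).trans ((Finset.card_insert_le _ _).trans ?_)
  have : ((S ×ˢ S).image fun x => S \ {x.1, x.2}).card ≤ S.card ^ 2 := by
    refine Finset.card_image_le.trans ?_
    rw [Finset.card_product, sq]
  omega

lemma cyc_split {S : Finset Pt} {n : ℕ} (f : Fin (n+1) ≃ {p : Pt // p ∈ S}) (C : Finset (Sym2 Pt))
    (hC : C = Finset.univ.image fun i => s((f i : Pt), (f (finRotate (n+1) i) : Pt))) :
    ∃ S1 ∈ QQ S, ∃ S2 ∈ QQ S, ∃ M1 M2 x, PM S1 M1 ∧ PM S2 M2 ∧ Disjoint M1 M2 ∧ C = M1 ∪ M2 ∪ {x} := by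
  let v : ℕ → Pt := fun k => if h : k < n+1 then (f ⟨k,h⟩ : Pt) else (0,0)
  have vS : ∀ k, k < n+1 → v k ∈ S := by
    intro k hk
    simp only [v, hk, dif_pos]
    exact (f ⟨k,hk⟩).2
  have vinj : ∀ k l, k < n+1 → l < n+1 → v k = v l → k = l := by
    intro k l hk hl h
    simp only [v, hk, hl, dif_pos] at h
    have := f.injective (Subtype.ext h)
    simpa using this
  have vsurj : ∀ p ∈ S, ∃ k, k < n+1 ∧ v k = p := by
    intro p hp
    refine ⟨(f.symm ⟨p,hp⟩ : Fin (n+1)), (f.symm ⟨p,hp⟩).2, ?_⟩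
    simp only [v, (f.symm ⟨p,hp⟩).2, dif_pos, Fin.eta, Equiv.apply_symm_apply]
  let E : ℕ → Sym2 Pt := fun k => s(v k, v (k+1))
  have Einj : ∀ k l, k < n → l < n → E k = E l → k = l := by
    intro k l hk hl h
    rcases Sym2.eq_iff.1 h with ⟨h1, _⟩ | ⟨h1, h2⟩
    · exact vinj _ _ (by omega) (by omega) h1
    · have a1 := vinj _ _ (by omega) (by omega) h1
      have a2 := vinj _ _ (by omega) (by omega) h2
      omega
  let J : ℕ → Finset ℕ := fun r => (Finset.range n).filter fun k => k % 2 = r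
  have mJ : ∀ {r k}, k ∈ J r ↔ k < n ∧ k % 2 = r := by
    intro r k
    simp only [J, Finset.mem_filter, Finset.mem_range]
  let A : ℕ → Finset Pt := fun r => (J r).image v ∪ (J r).image fun k => v (k+1)
  have mA : ∀ {r p}, p ∈ A r ↔ ∃ k ∈ J r, p ∈ E k := by
    intro r p
    simp only [A, Finset.mem_union, Finset.mem_image, E, Sym2.mem_iff]
    constructor
    · rintro (⟨k, hk, rfl⟩ | ⟨k, hk, rfl⟩)
      · exact ⟨k, hk, Or.inl rfl⟩
      · exact ⟨k, hk, Or.inr rfl⟩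
    · rintro ⟨k, hk, rfl | rfl⟩
      · exact Or.inl ⟨k, hk, rfl⟩
      · exact Or.inr ⟨k, hk, rfl⟩
  have hPM : ∀ r, PM (A r) ((J r).image E) := by
    intro r
    constructor
    · intro e he
      obtain ⟨k, hk, rfl⟩ := Finset.mem_image.1 he
      have hk' := mJ.1 hk
      refine ⟨?_, fun p hp => mA.2 ⟨k, hk, hp⟩⟩
      rw [Sym2.mk_isDiag_iff]
      intro h
      have := vinj _ _ (by omega) (by omega) h
      omega
    · intro p hp
      obtain ⟨k, hk, hpk⟩ := mA.1 hp
      refine ⟨E k, ⟨Finset.mem_image_of_mem _ hk, hpk⟩, ?_⟩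
      rintro e ⟨he, hpe⟩
      obtain ⟨l, hl, rfl⟩ := Finset.mem_image.1 he
      have hk' := mJ.1 hk
      have hl' := mJ.1 hl
      have : k = l := by
        rcases Sym2.mem_iff.1 hpk with h1 | h1 <;> rcases Sym2.mem_iff.1 hpe with h2 | h2
        · exact vinj _ _ (by omega) (by omega) (h1.symm.trans h2)
        · have := vinj _ _ (by omega) (by omega) (h1.symm.trans h2)
          omega
        · have := vinj _ _ (by omega) (by omega) (h1.symm.trans h2)
          omega
        · have := vinj _ _ (by omega) (by omega) (h1.symm.trans h2)
          omega
      rw [this]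
  have hQ : ∀ r, r < 2 → A r ∈ QQ S := by
    intro r hr
    refine Finset.mem_filter.2 ⟨Finset.mem_powerset.2 ?_, ?_⟩
    · intro p hp
      obtain ⟨k, hk, hpk⟩ := mA.1 hp
      have hk' := mJ.1 hk
      rcases Sym2.mem_iff.1 hpk with rfl | rfl
      · exact vS _ (by omega)
      · exact vS _ (by omega)
    · have : S \ A r ⊆ {v 0, v n} := by
        intro p hp
        obtain ⟨hp1, hp2⟩ := Finset.mem_sdiff.1 hp
        obtain ⟨k, hk, rfl⟩ := vsurj p hp1
        rw [Finset.mem_insert, Finset.mem_singleton]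
        by_contra hno
        push Not at hno
        have k0 : k ≠ 0 := fun h => hno.1 (by rw [h])
        have kn : k ≠ n := fun h => hno.2 (by rw [h])
        apply hp2
        by_cases hkr : k % 2 = r
        · exact mA.2 ⟨k, mJ.2 ⟨by omega, hkr⟩, Sym2.mem_mk_left _ _⟩
        · refine mA.2 ⟨k-1, mJ.2 ⟨by omega, by omega⟩, ?_⟩
          have : E (k-1) = s(v (k-1), v k) := by
            simp only [E]
            rw [Nat.sub_add_cancel (by omega)]
          rw [this]
          exact Sym2.mem_mk_right _ _
      exact (Finset.card_le_card this).trans Finset.card_le_two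
  refine ⟨A 0, hQ 0 (by norm_num), A 1, hQ 1 (by norm_num), (J 0).image E, (J 1).image E, s(v n, v 0), hPM 0, hPM 1, ?_, ?_⟩
  · apply Finset.disjoint_left.2
    intro e he he'
    obtain ⟨k, hk, rfl⟩ := Finset.mem_image.1 he
    obtain ⟨l, hl, hlk⟩ := Finset.mem_image.1 he'
    have hk' := mJ.1 hk
    have hl' := mJ.1 hl
    have := Einj _ _ (by omega) (by omega) hlk
    omega
  · have key1 : ∀ k, (hk : k < n) → s((f ⟨k, by omega⟩ : Pt), (f (finRotate (n+1) ⟨k, by omega⟩) : Pt)) = E k := by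
      intro k hk
      rw [finRotate_of_lt hk]
      have h1 : k < n+1 := by omega
      have h2 : k+1 < n+1 := by omega
      simp only [E, v, h1, h2, dif_pos]
    have key2 : s((f ⟨n, by omega⟩ : Pt), (f (finRotate (n+1) ⟨n, by omega⟩) : Pt)) = s(v n, v 0) := by
      rw [finRotate_last']
      have h1 : n < n+1 := by omega
      have h2 : 0 < n+1 := by omega
      simp only [v, h1, h2, dif_pos]
    rw [hC]
    ext e
    rw [Finset.mem_image, Finset.mem_union, Finset.mem_union, Finset.mem_image, Finset.mem_image, Finset.mem_singleton]
    constructor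
    · rintro ⟨⟨k, hk⟩, -, rfl⟩
      by_cases hkn : k < n
      · rw [key1 k hkn]
        rcases Nat.mod_two_eq_zero_or_one k with h | h
        · exact Or.inl (Or.inl ⟨k, mJ.2 ⟨hkn, h⟩, rfl⟩)
        · exact Or.inl (Or.inr ⟨k, mJ.2 ⟨hkn, h⟩, rfl⟩)
      · have : k = n := by omega
        subst this
        exact Or.inr key2
    · rintro ((⟨k, hk, rfl⟩ | ⟨k, hk, rfl⟩) | rfl)
      · have hk' := mJ.1 hk
        exact ⟨⟨k, by omega⟩, Finset.mem_univ _, key1 k hk'.1⟩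
      · have hk' := mJ.1 hk
        exact ⟨⟨k, by omega⟩, Finset.mem_univ _, key1 k hk'.1⟩
      · exact ⟨⟨n, by omega⟩, Finset.mem_univ _, key2⟩

lemma Cyc_split {S : Finset Pt} {C : Finset (Sym2 Pt)} (h : Cyc S C) :
    ∃ S1 ∈ QQ S, ∃ S2 ∈ QQ S, ∃ M1 M2 x, PM S1 M1 ∧ PM S2 M2 ∧ Disjoint M1 M2 ∧ C = M1 ∪ M2 ∪ {x} := by
  obtain ⟨h3, f, hC⟩ := h
  generalize hm : S.card = m at f h3 hC
  obtain ⟨n, rfl⟩ : ∃ n, m = n + 1 := ⟨m - 1, by omega⟩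
  exact cyc_split f C hC

lemma perT {S : Finset Pt} {T : Finset (Sym2 Pt)} (hS : GP S) (hT : Tri S T) (h2 : 2 ≤ S.card) :
    ∑ C ∈ (CC S).filter (fun C => C ⊆ T), (1:ℝ) / (SP S C).card ≤
      (T.card * ((QQ S).card * (QQ S).card) : ℕ) * (2 * Real.exp 3 * Real.exp (Real.log 2 * S.card / 4) *
        Real.exp ((Real.log 6 - 1/10) * S.card / 4)) := by
  let I0 := T ×ˢ ((QQ S) ×ˢ (QQ S))
  let I1 : Sym2 Pt × (Finset Pt × Finset Pt) → Finset (Finset (Sym2 Pt)) := fun t => T.powerset.filter (PM t.2.1)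
  let I2 : Sym2 Pt × (Finset Pt × Finset Pt) → Finset (Sym2 Pt) → Finset (Finset (Sym2 Pt)) :=
    fun t M1 => (T \ M1).powerset.filter (PM t.2.2)
  let J : Finset (Σ _ : Sym2 Pt × (Finset Pt × Finset Pt), Σ _ : Finset (Sym2 Pt), Finset (Sym2 Pt)) :=
    I0.sigma fun t => (I1 t).sigma fun M1 => I2 t M1
  let hh : (Σ _ : Sym2 Pt × (Finset Pt × Finset Pt), Σ _ : Finset (Sym2 Pt), Finset (Sym2 Pt)) → Finset (Sym2 Pt) :=
    fun i => i.2.1 ∪ i.2.2 ∪ {i.1.1}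
  have hex : ∀ C, C ∈ (CC S).filter (fun C => C ⊆ T) → ∃ i ∈ J, hh i = C := by
    intro C hC
    obtain ⟨hC1, hCT⟩ := Finset.mem_filter.1 hC
    obtain ⟨-, -, hcyc⟩ := Finset.mem_filter.1 hC1
    obtain ⟨S1, hS1, S2, hS2, M1, M2, x, hM1, hM2, hdis, rfl⟩ := Cyc_split hcyc
    refine ⟨⟨(x, (S1, S2)), ⟨M1, M2⟩⟩, ?_, rfl⟩
    have hM1T : M1 ⊆ T := Finset.subset_union_left.trans (Finset.subset_union_left.trans hCT)
    have hM2T : M2 ⊆ T := Finset.subset_union_right.trans (Finset.subset_union_left.trans hCT)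
    have hxT : x ∈ T := hCT (Finset.mem_union_right _ (Finset.mem_singleton_self x))
    refine Finset.mem_sigma.2 ⟨Finset.mem_product.2 ⟨hxT, Finset.mem_product.2 ⟨hS1, hS2⟩⟩,
      Finset.mem_sigma.2 ⟨Finset.mem_filter.2 ⟨Finset.mem_powerset.2 hM1T, hM1⟩,
        Finset.mem_filter.2 ⟨Finset.mem_powerset.2 ?_, hM2⟩⟩⟩
    intro e he
    exact Finset.mem_sdiff.2 ⟨hM2T he, fun h => Finset.disjoint_left.1 hdis h he⟩
  choose! i hiJ hih using hex
  have hstep1 : ∑ C ∈ (CC S).filter (fun C => C ⊆ T), (1:ℝ) / (SP S C).card ≤ ∑ j ∈ J, (1:ℝ) / (SP S (hh j)).card := by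
    have e1 : ∑ C ∈ (CC S).filter (fun C => C ⊆ T), (1:ℝ) / (SP S C).card =
        ∑ j ∈ ((CC S).filter (fun C => C ⊆ T)).image i, (1:ℝ) / (SP S (hh j)).card := by
      rw [Finset.sum_image]
      · apply Finset.sum_congr rfl
        intro C hC
        rw [hih C hC]
      · intro C hC C' hC' h
        rw [← hih C hC, ← hih C' hC', h]
    rw [e1]
    apply Finset.sum_le_sum_of_subset_of_nonneg
    · intro j hj
      obtain ⟨C, hC, rfl⟩ := Finset.mem_image.1 hj
      exact hiJ C hC
    · intro j _ _
      positivity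
  refine hstep1.trans ?_
  simp only [J]
  rw [Finset.sum_sigma]
  have hcard : I0.card = T.card * ((QQ S).card * (QQ S).card) := by
    simp only [I0, Finset.card_product]
  rw [← hcard, ← nsmul_eq_mul]
  apply Finset.sum_le_card_nsmul
  rintro ⟨x, S1, S2⟩ ht
  obtain ⟨hx, hS12⟩ := Finset.mem_product.1 ht
  obtain ⟨hS1, hS2⟩ := Finset.mem_product.1 hS12
  obtain ⟨hS1s, hS1c⟩ := Finset.mem_filter.1 hS1
  obtain ⟨hS2s, hS2c⟩ := Finset.mem_filter.1 hS2
  rw [Finset.mem_powerset] at hS1s hS2s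
  rw [Finset.sum_sigma]
  have hin : ∀ M1 ∈ I1 (x, (S1, S2)), ∑ M2 ∈ I2 (x, (S1, S2)) M1, (1:ℝ) / (SP S (hh ⟨(x, (S1, S2)), ⟨M1, M2⟩⟩)).card ≤
      2 * Real.exp 3 * Real.exp (Real.log 2 * S.card / 4) * (9/10) ^ (PhiF S T M1).card := by
    intro M1 hM1
    obtain ⟨hM1T, hM1P⟩ := Finset.mem_filter.1 hM1
    rw [Finset.mem_powerset] at hM1T
    obtain ⟨D, Disc, g, g', hsch⟩ := scheme_ex hS hT h2 hS1s hS1c hM1P hM1T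
    have hMc : S.card ≤ 2 * M1.card + 2 := by
      have a1 := PM_card hM1P
      have a2 : (S \ S1).card + S1.card = S.card := Finset.card_sdiff_add_card_eq_card hS1s
      have hS1c' : (S \ S1).card ≤ 2 := hS1c
      dsimp only at a1
      omega
    refine le_trans (Finset.sum_le_sum fun M2 hM2 => ?_) (M2_sum hS hT h2 hsch hMc hS2s)
    obtain ⟨hM2T, hM2P⟩ := Finset.mem_filter.1 hM2
    rw [Finset.mem_powerset] at hM2T
    exact supp_M2 hS hT hsch hM2P (hM2T.trans Finset.sdiff_subset) hx
  refine (Finset.sum_le_sum hin).trans ?_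
  rw [← Finset.mul_sum]
  apply mul_le_mul_of_nonneg_left (M1_sum hS hT h2 hS1s)
  positivity

lemma final_num : ∃ c : ℝ, 0 < c ∧ ∀ n : ℕ, (3 * n * ((n:ℝ)^2 + 1)^2) * (2 * Real.exp 3 * Real.exp (Real.log 2 * n / 4) *
        Real.exp ((Real.log 6 - 1/10) * n / 4)) ≤ c * (10.9247 : ℝ) ^ ((n : ℝ) / 4) := by
  obtain ⟨r, hr⟩ : ∃ r : ℝ, r = Real.log 10.9247 - (Real.log 2 + Real.log 6 - 1/10) := ⟨_, rfl⟩
  have hr0 : 0 < r := by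
    have h1 : Real.log 2 + Real.log 6 = Real.log 12 := by
      rw [← Real.log_mul (by norm_num) (by norm_num)]; norm_num
    have h2 : Real.log (12 / 10.9247) < 1/10 := by
      rw [Real.log_lt_iff_lt_exp (by norm_num)]
      have := Real.quadratic_le_exp_of_nonneg (x := 1/10) (by norm_num)
      norm_num at this ⊢
      linarith
    rw [Real.log_div (by norm_num) (by norm_num)] at h2
    rw [hr, h1]; linarith
  refine ⟨6 * Real.exp 3 * (120 * (4/r)^5 * Real.exp (r/4)), by positivity, fun n => ?_⟩
  have hn0 : (0:ℝ) ≤ n := by positivity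
  have hpoly : (n:ℝ) * ((n:ℝ)^2+1)^2 ≤ ((n:ℝ)+1)^5 := by
    have : ((n:ℝ)+1)^5 - (n:ℝ) * ((n:ℝ)^2+1)^2 = 5*(n:ℝ)^4 + 8*(n:ℝ)^3 + 10*(n:ℝ)^2 + 4*(n:ℝ) + 1 := by ring
    have h0 : (0:ℝ) ≤ 5*(n:ℝ)^4 + 8*(n:ℝ)^3 + 10*(n:ℝ)^2 + 4*(n:ℝ) + 1 := by positivity
    linarith
  have hexp : ((n:ℝ)+1)^5 ≤ 120 * (4/r)^5 * Real.exp (r/4) * Real.exp (r*n/4) := by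
    have h := Real.pow_div_factorial_le_exp (r * ((n:ℝ)+1) / 4) (by positivity) 5
    rw [show r * ((n:ℝ)+1) / 4 = r/4 + r*n/4 by ring, Real.exp_add] at h
    have h5 : ((Nat.factorial 5 : ℕ) : ℝ) = 120 := by norm_num [Nat.factorial]
    rw [h5, div_le_iff₀ (by norm_num)] at h
    have e : ((n:ℝ)+1)^5 = (4/r)^5 * (r/4 + r*n/4)^5 := by
      rw [← mul_pow]; congr 1; field_simp; ring
    rw [e]
    calc _ ≤ (4/r)^5 * (Real.exp (r/4) * Real.exp (r*n/4) * 120) := by gcongr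
      _ = _ := by ring
  have hrp : (10.9247 : ℝ) ^ ((n : ℝ) / 4) = Real.exp (r*n/4) * (Real.exp (Real.log 2 * n / 4) *
        Real.exp ((Real.log 6 - 1/10) * n / 4)) := by
    rw [Real.rpow_def_of_pos (by norm_num), ← Real.exp_add, ← Real.exp_add, hr]
    congr 1; ring
  rw [hrp]
  have hq := hpoly.trans hexp
  calc _ = 6 * Real.exp 3 * ((n:ℝ) * ((n:ℝ)^2+1)^2) * (Real.exp (Real.log 2 * n / 4) *
        Real.exp ((Real.log 6 - 1/10) * n / 4)) := by ring
    _ ≤ 6 * Real.exp 3 * (120 * (4/r)^5 * Real.exp (r/4) * Real.exp (r*n/4)) * (Real.exp (Real.log 2 * n / 4) *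
        Real.exp ((Real.log 6 - 1/10) * n / 4)) := by gcongr
    _ = _ := by ring

lemma statement13_aux :
    ∃ c : ℝ, 0 < c ∧ ∀ S : Finset Pt, GenPos S →
      (scCount S : ℝ) ≤ c * (10.9247 : ℝ) ^ ((S.card : ℝ) / 4) * (triCount S : ℝ) := by
  obtain ⟨c, hc, hn⟩ := final_num
  refine ⟨c, hc, fun S hG => ?_⟩
  have hS : GP S := GP_of_GenPos hG
  have hsc : (scCount S : ℝ) ≤ ((CC S).card : ℝ) := by exact_mod_cast scCount_le
  refine hsc.trans ?_
  rw [triCount_eq hS]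
  by_cases h3 : 3 ≤ S.card
  swap
  · have : CC S = ∅ := by
      apply Finset.filter_eq_empty_iff.2
      rintro C - ⟨-, hcyc⟩
      exact h3 hcyc.1
    rw [this]
    simp only [Finset.card_empty, Nat.cast_zero]
    positivity
  have h2 : 2 ≤ S.card := by omega
  have e1 : ((CC S).card : ℝ) = ∑ C ∈ CC S, ∑ T ∈ SP S C, (1:ℝ) / (SP S C).card := by
    rw [Finset.card_eq_sum_ones, Nat.cast_sum]
    apply Finset.sum_congr rfl
    intro C hC
    obtain ⟨-, hP, -⟩ := Finset.mem_filter.1 hC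
    obtain ⟨T, hT, hCT⟩ := exists_tri hP
    have hne : 0 < (SP S C).card := Finset.card_pos.2 ⟨T, Finset.mem_filter.2 ⟨mem_TT.2 hT, hCT⟩⟩
    have hne' : ((SP S C).card : ℝ) ≠ 0 := by positivity
    rw [Finset.sum_const, nsmul_eq_mul]
    field_simp
    simp
  have e2 : ∑ C ∈ CC S, ∑ T ∈ SP S C, (1:ℝ) / (SP S C).card =
      ∑ T ∈ TT S, ∑ C ∈ (CC S).filter (fun C => C ⊆ T), (1:ℝ) / (SP S C).card := by
    apply Finset.sum_comm'
    intro C T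
    simp only [SP, Finset.mem_filter]
    tauto
  rw [e1, e2, mul_comm, ← nsmul_eq_mul]
  apply Finset.sum_le_card_nsmul
  intro T hT
  have hT' := mem_TT.1 hT
  refine (perT hS hT' h2).trans (le_trans ?_ (hn S.card))
  apply mul_le_mul_of_nonneg_right _ (by positivity)
  have a1 : (T.card : ℝ) ≤ 3 * S.card := by
    have := (edge_count hS hT' h2).1
    have h : T.card ≤ 3 * S.card := by omega
    exact_mod_cast h
  have a2 : ((QQ S).card : ℝ) ≤ (S.card : ℝ)^2 + 1 := by exact_mod_cast QQ_card S
  push_cast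
  rw [pow_two ((S.card : ℝ)^2 + 1)]
  gcongr

/-- `sc(S) ≤ c · 10.9247^{N/4} · tr(S) = O(1.8181^N) · tr(S)`. -/
theorem statement13 :
    ∃ c : ℝ, 0 < c ∧ ∀ S : Finset Pt, GenPos S →
      (scCount S : ℝ) ≤ c * (10.9247 : ℝ) ^ ((S.card : ℝ) / 4) * (triCount S : ℝ) := by
  exact statement13_aux

end
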